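/- arXiv:2604.10888 — 2 statements merged into one kernel-verified Lean document; each statement's English description precedes it below -/
import Mathlib

section
/- Let G = GL₂(F_q) be the general linear group of 2×2 invertible matrices over the finite field with q elements, where q is a prime power, and let χ be a complex irreducible character of G. Then there exists an element g ∈ G such that c(χ) = c(χ(g)), i.e., the conductor of χ is realized at a single group element. -/
open CategoryTheory

/-- `z` is a complex root of unity. -/
def IsRootOfUnity (z : ℂ) : Prop := ∃ n : ℕ, 0 < n ∧ z ^ n = 1

/-- The `n`-th cyclotomic field `ℚ(ζ_n)`, realized as the subfield of `ℂ` generated by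
all `n`-th roots of unity. -/
noncomputable def cycField (n : ℕ) : Subfield ℂ := Subfield.closure {z : ℂ | z ^ n = 1}

/-- The conductor of a set `S` of cyclotomic integers: the smallest positive integer `n`
such that `S ⊆ ℚ(ζ_n)`. -/
noncomputable def conductorOf (S : Set ℂ) : ℕ := sInf {n : ℕ | 0 < n ∧ S ⊆ (cycField n : Set ℂ)}

open scoped ComplexConjugate MatrixGroups

section UnitComplex

theorem conj_mem_cycField {n : ℕ} {z : ℂ} (hz : z ∈ cycField n) : conj z ∈ cycField n := by
  have h : cycField n ≤ (cycField n).comap (starRingEnd ℂ) := by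
    refine Subfield.closure_le.2 fun w hw => ?_
    refine Subfield.subset_closure ?_
    simp only [Set.mem_ofPred_eq] at hw ⊢
    rw [← map_pow, hw, map_one]
  exact h hz

theorem mul_mul_conj_add_eq {x y : ℂ} (hx : ‖x‖ = 1) (hy : ‖y‖ = 1) :
    x * y * conj (x + y) = x + y := by
  have h₁ : x * conj x = 1 := by rw [Complex.mul_conj, Complex.normSq_eq_norm_sq, hx]; simp
  have h₂ : y * conj y = 1 := by rw [Complex.mul_conj, Complex.normSq_eq_norm_sq, hy]; simp
  rw [map_add]
  linear_combination y * h₁ + x * h₂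

/-- Two pairs of unit complex numbers with the same nonzero sum coincide. -/
theorem pair_eq_of_add_eq {x y u v : ℂ} (hx : ‖x‖ = 1) (hy : ‖y‖ = 1) (hu : ‖u‖ = 1)
    (hv : ‖v‖ = 1) (h : x + y = u + v) (h0 : x + y ≠ 0) :
    (x = u ∧ y = v) ∨ (x = v ∧ y = u) := by
  have hp : x * y = u * v := by
    have h₁ := mul_mul_conj_add_eq hx hy
    have h₂ := mul_mul_conj_add_eq hu hv
    rw [← h] at h₂
    exact mul_right_cancel₀ ((map_ne_zero _).2 h0) (h₁.trans h₂.symm)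
  have hq : (x - u) * (x - v) = 0 := by linear_combination x * h - hp
  rcases mul_eq_zero.1 hq with h' | h'
  · left
    have := sub_eq_zero.1 h'
    exact ⟨this, by linear_combination h - this⟩
  · right
    have := sub_eq_zero.1 h'
    exact ⟨this, by linear_combination h - this⟩

theorem eq_of_add_eq_two_mul {x y w : ℂ} (hx : ‖x‖ = 1) (hy : ‖y‖ = 1) (hw : ‖w‖ = 1)
    (h : x + y = 2 * w) : x = w ∧ y = w := by
  have hw0 : w ≠ 0 := norm_ne_zero_iff.1 (by rw [hw]; exact one_ne_zero)
  have := pair_eq_of_add_eq hx hy hw hw (by rw [h]; ring) (by rw [h]; simpa using hw0)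
  tauto

theorem mul_mem_cycField_of_add_mem {n : ℕ} {x y : ℂ} (hx : ‖x‖ = 1) (hy : ‖y‖ = 1)
    (h0 : x + y ≠ 0) (h : x + y ∈ cycField n) : x * y ∈ cycField n := by
  have : x * y = (x + y) / conj (x + y) :=
    (eq_div_iff ((map_ne_zero _).2 h0)).2 (mul_mul_conj_add_eq hx hy)
  rw [this]
  exact div_mem h (conj_mem_cycField h)

theorem pow_add_pow_mem {L : Subfield ℂ} {x y : ℂ} (h : x + y ∈ L) (h' : x * y ∈ L) (k : ℕ) :
    x ^ k + y ^ k ∈ L := by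
  induction k using Nat.strong_induction_on with
  | _ k ih =>
    match k, ih with
    | 0, _ => simpa using add_mem (one_mem L) (one_mem L)
    | 1, _ => simpa using h
    | k + 2, ih =>
      have h₁ := ih (k + 1) (by omega)
      have h₂ := ih k (by omega)
      have : x ^ (k + 2) + y ^ (k + 2) =
          (x + y) * (x ^ (k + 1) + y ^ (k + 1)) - x * y * (x ^ k + y ^ k) := by ring
      rw [this]
      exact sub_mem (mul_mem h h₁) (mul_mem h' h₂)

theorem pow_mul_pow_add_mem {L : Subfield ℂ} {x y : ℂ} (h : x + y ∈ L) (h' : x * y ∈ L)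
    (s t : ℕ) : x ^ s * y ^ t + y ^ s * x ^ t ∈ L := by
  rcases le_total s t with hst | hst
  · obtain ⟨k, rfl⟩ := Nat.exists_eq_add_of_le hst
    have : x ^ s * y ^ (s + k) + y ^ s * x ^ (s + k) = (x * y) ^ s * (x ^ k + y ^ k) := by
      ring
    rw [this]
    exact mul_mem (pow_mem h' _) (pow_add_pow_mem h h' k)
  · obtain ⟨k, rfl⟩ := Nat.exists_eq_add_of_le hst
    have : x ^ (t + k) * y ^ t + y ^ (t + k) * x ^ t = (x * y) ^ t * (x ^ k + y ^ k) := by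
      ring
    rw [this]
    exact mul_mem (pow_mem h' _) (pow_add_pow_mem h h' k)

end UnitComplex

theorem conductorOf_range_eq {ι : Type*} {f : ι → ℂ} (i : ι)
    (h : ∀ n, f i ∈ cycField n → ∀ j, f j ∈ cycField n) :
    conductorOf (Set.range f) = conductorOf {f i} := by
  have : ∀ n, Set.range f ⊆ (cycField n : Set ℂ) ↔ {f i} ⊆ (cycField n : Set ℂ) := by
    intro n
    rw [Set.range_subset_iff, Set.singleton_subset_iff]
    exact ⟨fun h' => h' i, fun h' => h n h'⟩
  simp only [conductorOf, this]

section Fourier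

open Additive

variable {A : Type*} [CommGroup A] [Fintype A]

theorem eq_sum_of_sum_mul_char {f : A → ℂ} {c : AddChar (Additive A) ℂ → ℂ}
    (h : ∀ θ, ∑ a, f a * θ (ofMul a⁻¹) = Fintype.card A * c θ) (a : A) :
    f a = ∑ θ, c θ * θ (ofMul a) := by
  classical
  have hA : (Fintype.card A : ℂ) ≠ 0 := Nat.cast_ne_zero.2 Fintype.card_ne_zero
  apply mul_left_cancel₀ hA
  rw [Finset.mul_sum]
  simp_rw [← mul_assoc, ← h, Finset.sum_mul]
  rw [Finset.sum_comm]
  simp_rw [mul_assoc, ← AddChar.map_add_eq_mul, ← Finset.mul_sum, AddChar.sum_apply_eq_ite]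
  have : ∀ b : A, ofMul b⁻¹ + ofMul a = 0 ↔ b = a := by
    intro b
    rw [← ofMul_mul, ofMul_eq_zero, inv_mul_eq_one]
  simp only [this]
  simp [mul_comm, Fintype.card_congr (Additive.ofMul (α := A)).symm]

theorem sum_mul_inv_eq {f : A → ℂ} {c : AddChar (Additive A) ℂ → ℂ}
    (h : ∀ θ, ∑ a, f a * θ (ofMul a⁻¹) = Fintype.card A * c θ) :
    ∑ a, f a * f a⁻¹ = Fintype.card A * ∑ θ, c θ ^ 2 := by
  have h₁ : ∀ a, f a * f a⁻¹ = ∑ θ, c θ * (f a * θ (ofMul a⁻¹)) := by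
    intro a
    conv_lhs => rw [eq_sum_of_sum_mul_char h a⁻¹, Finset.mul_sum]
    exact Finset.sum_congr rfl fun θ _ => by ring
  simp_rw [h₁]
  rw [Finset.sum_comm]
  simp_rw [← Finset.mul_sum, h]
  rw [Finset.mul_sum]
  exact Finset.sum_congr rfl fun θ _ => by ring

end Fourier

section SumSquares

variable {ι : Type*} [Fintype ι] {c : ι → ℤ}

theorem exists_unit_of_sum_sq_eq_one (h : ∑ i, c i ^ 2 = 1) :
    ∃ i, (c i = 1 ∨ c i = -1) ∧ ∀ j, j ≠ i → c j = 0 := by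
  classical
  obtain ⟨i, hi⟩ : ∃ i, c i ≠ 0 := by
    by_contra! h0
    simp [h0] at h
  have h1 := Finset.add_sum_erase Finset.univ (fun i => c i ^ 2) (Finset.mem_univ i)
  rw [h] at h1
  have h2 : 0 < c i ^ 2 := by positivity
  have h3 : 0 ≤ ∑ j ∈ Finset.univ.erase i, c j ^ 2 := Finset.sum_nonneg fun _ _ => sq_nonneg _
  have h4 : ∑ j ∈ Finset.univ.erase i, c j ^ 2 = 0 := by omega
  refine ⟨i, sq_eq_one_iff.1 (by omega), fun j hj => ?_⟩
  have := (Finset.sum_eq_zero_iff_of_nonneg fun _ _ => sq_nonneg _).1 h4 j (by simp [hj])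
  simpa using this

theorem exists_units_of_sum_sq_eq_two (h : ∑ i, c i ^ 2 = 2) :
    ∃ i j, i ≠ j ∧ (c i = 1 ∨ c i = -1) ∧ (c j = 1 ∨ c j = -1) ∧
      ∀ k, k ≠ i → k ≠ j → c k = 0 := by
  classical
  obtain ⟨i, hi⟩ : ∃ i, c i ≠ 0 := by
    by_contra! h0
    simp [h0] at h
  have h1 := Finset.add_sum_erase Finset.univ (fun i => c i ^ 2) (Finset.mem_univ i)
  rw [h] at h1

  have h2 : 0 < c i ^ 2 := by positivity
  have h3 : 0 ≤ ∑ j ∈ Finset.univ.erase i, c j ^ 2 := Finset.sum_nonneg fun _ _ => sq_nonneg _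
  have h4 : c i ^ 2 = 1 := Int.sq_eq_one_of_sq_le_three (by omega) hi
  have h5 : ∑ j, (if j = i then 0 else c j) ^ 2 = 1 := by
    rw [← Finset.add_sum_erase Finset.univ _ (Finset.mem_univ i)]
    have : ∑ j ∈ Finset.univ.erase i, (if j = i then 0 else c j) ^ 2 =
        ∑ j ∈ Finset.univ.erase i, c j ^ 2 :=
      Finset.sum_congr rfl fun j hj => by rw [if_neg (Finset.ne_of_mem_erase hj)]
    rw [this]
    simp only [↓reduceIte]
    omega
  obtain ⟨j, hj, hj'⟩ := exists_unit_of_sum_sq_eq_one h5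
  have hji : j ≠ i := by
    rintro rfl
    simp at hj
  rw [if_neg hji] at hj
  refine ⟨i, j, hji.symm, sq_eq_one_iff.1 h4, hj, fun k hk hk' => ?_⟩
  simpa [hk] using hj' k hk'

end SumSquares

section Companion

variable {F : Type*} [Field F]

/-- The determinant of the matrix with columns `v` and `M v`. -/
def cyclicDet (M : Matrix (Fin 2) (Fin 2) F) (v : F × F) : F :=
  M 1 0 * v.1 ^ 2 + (M 1 1 - M 0 0) * v.1 * v.2 - M 0 1 * v.2 ^ 2

/-- The matrix with columns `v` and `M v`. -/
def cyclicMatrix (M : Matrix (Fin 2) (Fin 2) F) (v : F × F) : Matrix (Fin 2) (Fin 2) F :=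
  !![v.1, M 0 0 * v.1 + M 0 1 * v.2; v.2, M 1 0 * v.1 + M 1 1 * v.2]

theorem det_cyclicMatrix (M : Matrix (Fin 2) (Fin 2) F) (v : F × F) :
    (cyclicMatrix M v).det = cyclicDet M v := by
  simp only [cyclicMatrix, cyclicDet, Matrix.det_fin_two_of]
  ring

/-- The companion matrix of `X ^ 2 - t X + n`. -/
def companionGL (p : F × Fˣ) : GL (Fin 2) F :=
  Matrix.GeneralLinearGroup.mkOfDetNeZero !![0, -(p.2 : F); 1, p.1] (by simp)

theorem coe_companionGL (p : F × Fˣ) :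
    (companionGL p : Matrix (Fin 2) (Fin 2) F) = !![0, -(p.2 : F); 1, p.1] := rfl

theorem mul_cyclicMatrix (M : Matrix (Fin 2) (Fin 2) F) (v : F × F) :
    M * cyclicMatrix M v = cyclicMatrix M v * !![0, -M.det; 1, M.trace] := by
  ext i j
  fin_cases i <;> fin_cases j <;>
    simp [cyclicMatrix, Matrix.mul_apply, Fin.sum_univ_two, Matrix.det_fin_two,
      Matrix.trace_fin_two] <;> ring

/-- The pair (trace, determinant) of an invertible matrix. -/
def traceDet (g : GL (Fin 2) F) : F × Fˣ :=
  ((g : Matrix (Fin 2) (Fin 2) F).trace, Matrix.GeneralLinearGroup.det g)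

theorem traceDet_conj (g h : GL (Fin 2) F) : traceDet (h * g * h⁻¹) = traceDet g := by
  refine Prod.ext ?_ ?_
  · simp only [traceDet, Units.val_mul]
    rw [Matrix.trace_mul_comm, ← mul_assoc, ← Units.val_mul, inv_mul_cancel, Units.val_one,
      one_mul]
  · simp only [traceDet, map_mul, map_inv]
    rw [mul_comm, inv_mul_cancel_left]

theorem traceDet_companionGL (p : F × Fˣ) : traceDet (companionGL p) = p := by
  refine Prod.ext ?_ (Units.ext ?_)
  · simp [traceDet, coe_companionGL, Matrix.trace_fin_two]
  · simp [traceDet, coe_companionGL, Matrix.det_fin_two]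

theorem eq_conj_companionGL {g P : GL (Fin 2) F} {v : F × F}
    (hP : (P : Matrix (Fin 2) (Fin 2) F) = cyclicMatrix g v) :
    P * companionGL (traceDet g) * P⁻¹ = g := by
  rw [mul_inv_eq_iff_eq_mul]
  ext1
  rw [Units.val_mul, Units.val_mul, hP, mul_cyclicMatrix]
  rfl

theorem exists_conj_companionGL {g : GL (Fin 2) F} {v : F × F}
    (h : cyclicDet (g : Matrix _ _ F) v ≠ 0) :
    ∃ P : GL (Fin 2) F, P * companionGL (traceDet g) * P⁻¹ = g :=
  ⟨Matrix.GeneralLinearGroup.mkOfDetNeZero (cyclicMatrix g v) (by rwa [det_cyclicMatrix]),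
    eq_conj_companionGL rfl⟩

theorem cyclicMatrix_conj (P : GL (Fin 2) F) (p : F × Fˣ) :
    cyclicMatrix (P * companionGL p * P⁻¹ : GL (Fin 2) F) (P 0 0, P 1 0) =
      (P : Matrix (Fin 2) (Fin 2) F) := by
  set M := P * companionGL p * P⁻¹ with hM
  have h : (M : Matrix (Fin 2) (Fin 2) F) * P = P * !![0, -(p.2 : F); 1, p.1] := by
    rw [← coe_companionGL, ← Units.val_mul, ← Units.val_mul, hM, inv_mul_cancel_right]
  have h0 := congrFun (congrFun h 0) 0
  have h1 := congrFun (congrFun h 1) 0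
  simp [Matrix.mul_apply, Fin.sum_univ_two] at h0 h1
  ext i j
  fin_cases i <;> fin_cases j <;> simp [cyclicMatrix, h0, h1]

theorem cyclicMatrix_conj_mul (g h : GL (Fin 2) F) (v : F × F) :
    cyclicMatrix (h * g * h⁻¹ : GL (Fin 2) F)
      (h 0 0 * v.1 + h 0 1 * v.2, h 1 0 * v.1 + h 1 1 * v.2) =
      (h : Matrix (Fin 2) (Fin 2) F) * cyclicMatrix g v := by
  set M := h * g * h⁻¹ with hM
  have e : (M : Matrix (Fin 2) (Fin 2) F) * h = h * g := by
    rw [← Units.val_mul, ← Units.val_mul, hM, inv_mul_cancel_right]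
  have e00 := congrFun (congrFun e 0) 0
  have e01 := congrFun (congrFun e 0) 1
  have e10 := congrFun (congrFun e 1) 0
  have e11 := congrFun (congrFun e 1) 1
  simp only [Matrix.mul_apply, Fin.sum_univ_two] at e00 e01 e10 e11
  ext i j
  fin_cases i <;> fin_cases j <;> simp [cyclicMatrix, Matrix.mul_apply, Fin.sum_univ_two]
  · linear_combination v.1 * e00 + v.2 * e01
  · linear_combination v.1 * e10 + v.2 * e11

/-- The upper triangular matrix with diagonal `a`, `b` and upper right entry `x`. -/
def upperTri (a b : Fˣ) (x : F) : GL (Fin 2) F :=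
  Matrix.GeneralLinearGroup.mkOfDetNeZero !![(a : F), x; 0, (b : F)] (by simp)

theorem coe_upperTri (a b : Fˣ) (x : F) :
    (upperTri a b x : Matrix (Fin 2) (Fin 2) F) = !![(a : F), x; 0, (b : F)] := rfl

theorem upperTri_mul (a b a' b' : Fˣ) (x x' : F) :
    upperTri a b x * upperTri a' b' x' = upperTri (a * a') (b * b') (a * x' + x * b') := by
  ext i j
  fin_cases i <;> fin_cases j <;> simp [coe_upperTri, Matrix.mul_apply, Fin.sum_univ_two]

theorem upperTri_one : upperTri (1 : Fˣ) 1 (0 : F) = 1 := by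
  ext i j
  fin_cases i <;> fin_cases j <;> simp [coe_upperTri]

theorem upperTri_inv (a b : Fˣ) (x : F) :
    (upperTri a b x)⁻¹ = upperTri a⁻¹ b⁻¹ (-(a⁻¹ * x * b⁻¹ : F)) := by
  rw [inv_eq_iff_mul_eq_one, upperTri_mul, ← upperTri_one]
  congr 1 <;> simp [mul_assoc]

theorem upperTri_self_zero_commute (a : Fˣ) (g : GL (Fin 2) F) :
    upperTri a a 0 * g = g * upperTri a a 0 := by
  ext i j
  fin_cases i <;> fin_cases j <;>
    simp [coe_upperTri, Matrix.mul_apply, Fin.sum_univ_two, mul_comm]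

theorem traceDet_upperTri (a b : Fˣ) (x : F) :
    traceDet (upperTri a b x) = ((a : F) + b, a * b) := by
  refine Prod.ext ?_ (Units.ext ?_)
  · simp [traceDet, coe_upperTri, Matrix.trace_fin_two]
  · simp [traceDet, coe_upperTri, Matrix.det_fin_two]

theorem cyclicDet_upperTri (a b : Fˣ) (x : F) (v : F × F) :
    cyclicDet (upperTri a b x : Matrix _ _ F) v = v.2 * ((b - a : F) * v.1 - x * v.2) := by
  simp [cyclicDet, coe_upperTri]
  ring

theorem exists_eq_upperTri {g : GL (Fin 2) F} (h : ∀ v, cyclicDet (g : Matrix _ _ F) v = 0) :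
    ∃ a : Fˣ, g = upperTri a a 0 := by
  have h1 := h (1, 0)
  have h2 := h (0, 1)
  have h3 := h (1, 1)
  simp only [cyclicDet] at h1 h2 h3
  have e1 : (g : Matrix (Fin 2) (Fin 2) F) 1 0 = 0 := by simpa using h1
  have e2 : (g : Matrix (Fin 2) (Fin 2) F) 0 1 = 0 := by simpa using h2
  have e3 : (g : Matrix (Fin 2) (Fin 2) F) 1 1 = (g : Matrix (Fin 2) (Fin 2) F) 0 0 := by
    linear_combination h3 - e1 + e2
  have h0 : (g : Matrix (Fin 2) (Fin 2) F) 0 0 ≠ 0 := by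
    intro h0
    have hd := (Matrix.GeneralLinearGroup.det g).ne_zero
    apply hd
    simp [Matrix.det_fin_two, h0, e1]
  refine ⟨Units.mk0 _ h0, ?_⟩
  ext i j
  fin_cases i <;> fin_cases j <;> simp [coe_upperTri, e1, e2, e3]

end Companion

section CyclicCount

variable {F : Type*} [Field F] [Fintype F]

open Classical in
/-- The number of cyclic vectors of a matrix. -/
noncomputable def cyclicCount (g : GL (Fin 2) F) : ℕ :=
  (Finset.univ.filter fun v => cyclicDet (g : Matrix _ _ F) v ≠ 0).card

open Classical in
theorem sum_cyclicCount_mul {f : GL (Fin 2) F → ℂ} (hf : ∀ g h, f (h * g * h⁻¹) = f g) :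
    ∑ g, (cyclicCount g : ℂ) * f g = Fintype.card (GL (Fin 2) F) * ∑ p, f (companionGL p) := by
  have hL : ∑ g, (cyclicCount g : ℂ) * f g =
      ∑ x ∈ (Finset.univ : Finset (GL (Fin 2) F × (F × F))).filter
        (fun x => cyclicDet (x.1 : Matrix _ _ F) x.2 ≠ 0), f x.1 := by
    rw [Finset.sum_filter, Fintype.sum_prod_type]
    refine Finset.sum_congr rfl fun g _ => ?_
    simp only
    rw [← Finset.sum_filter, Finset.sum_const, nsmul_eq_mul, cyclicCount]
  have hR : (Fintype.card (GL (Fin 2) F) : ℂ) * ∑ p, f (companionGL p) =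
      ∑ y : GL (Fin 2) F × (F × Fˣ), f (companionGL y.2) := by
    symm
    rw [Fintype.sum_prod_type]
    simp only
    rw [Finset.sum_const, Finset.card_univ, nsmul_eq_mul]
  rw [hL, hR]
  symm
  refine Finset.sum_nbij
    (fun y => (y.1 * companionGL y.2 * y.1⁻¹, (y.1 0 0, y.1 1 0))) ?_ ?_ ?_ ?_
  · rintro ⟨P, p⟩ -
    simp only [Finset.mem_filter, Finset.mem_univ, true_and]
    rw [← det_cyclicMatrix, cyclicMatrix_conj]
    exact (Matrix.GeneralLinearGroup.det P).ne_zero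
  · rintro ⟨P, p⟩ - ⟨P', p'⟩ - h
    simp only [Prod.mk.injEq] at h
    have hP : P = P' := by
      ext1
      rw [← cyclicMatrix_conj P p, ← cyclicMatrix_conj P' p', h.1, h.2.1, h.2.2]
    subst hP
    have hp := congrArg traceDet h.1
    rw [traceDet_conj, traceDet_conj, traceDet_companionGL, traceDet_companionGL] at hp
    rw [hp]
  · rintro ⟨g, v⟩ h
    simp only [Finset.coe_filter, Finset.mem_univ, true_and, Set.mem_ofPred_eq] at h
    let P := Matrix.GeneralLinearGroup.mkOfDetNeZero (cyclicMatrix g v)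
      (by rwa [det_cyclicMatrix])
    refine ⟨(P, traceDet g), by simp, ?_⟩
    refine Prod.ext ?_ rfl
    exact eq_conj_companionGL (P := P) (v := v) rfl
  · rintro ⟨P, p⟩ -
    exact (hf _ _).symm

theorem cyclicCount_le_conj (g h : GL (Fin 2) F) :
    cyclicCount g ≤ cyclicCount (h * g * h⁻¹) := by
  classical
  have hd := (Matrix.GeneralLinearGroup.det h).ne_zero
  refine Finset.card_le_card_of_injOn
    (fun v => (h 0 0 * v.1 + h 0 1 * v.2, h 1 0 * v.1 + h 1 1 * v.2)) ?_ ?_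
  · intro v hv
    simp only [Finset.coe_filter, Finset.mem_univ, true_and, Set.mem_ofPred_eq] at hv ⊢
    rw [← det_cyclicMatrix, cyclicMatrix_conj_mul, Matrix.det_mul, det_cyclicMatrix]
    exact mul_ne_zero hd hv
  · rintro ⟨v, v'⟩ - ⟨w, w'⟩ - hvw
    simp only [Prod.mk.injEq] at hvw
    rw [Matrix.GeneralLinearGroup.val_det_apply, Matrix.det_fin_two] at hd
    obtain ⟨h1, h2⟩ := hvw
    refine Prod.ext (mul_left_cancel₀ hd ?_) (mul_left_cancel₀ hd ?_)
    · linear_combination h 1 1 * h1 - h 0 1 * h2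
    · linear_combination h 0 0 * h2 - h 1 0 * h1

theorem cyclicCount_conj (g h : GL (Fin 2) F) : cyclicCount (h * g * h⁻¹) = cyclicCount g := by
  refine le_antisymm ?_ (cyclicCount_le_conj g h)
  convert! cyclicCount_le_conj (h * g * h⁻¹) h⁻¹ using 2
  group

theorem cyclicCount_eq_zero_iff (g : GL (Fin 2) F) :
    cyclicCount g = 0 ↔ ∃ a : Fˣ, g = upperTri a a 0 := by
  classical
  rw [cyclicCount, Finset.card_eq_zero, Finset.filter_eq_empty_iff]
  simp only [Finset.mem_univ, not_not, forall_true_left]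
  refine ⟨exists_eq_upperTri, ?_⟩
  rintro ⟨a, rfl⟩ v
  simp [cyclicDet_upperTri]

open Finset in
theorem cyclicCount_diagonal {a b : Fˣ} (h : a ≠ b) :
    cyclicCount (upperTri a b 0) = (Fintype.card F - 1) ^ 2 := by
  classical
  have h' : (b : F) - a ≠ 0 := sub_ne_zero.2 fun h' => h (Units.ext h'.symm)
  have : (univ.filter fun v => cyclicDet (upperTri a b 0 : Matrix _ _ F) v ≠ 0) =
      (univ.erase (0 : F)) ×ˢ (univ.erase (0 : F)) := by
    ext v
    simp [cyclicDet_upperTri, h', and_comm]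
  rw [cyclicCount]
  convert! congrArg card this
  rw [card_product, card_erase_of_mem (mem_univ _), card_univ, sq]

open Finset in
theorem cyclicCount_jordan (a : Fˣ) :
    cyclicCount (upperTri a a 1) = Fintype.card F * (Fintype.card F - 1) := by
  classical
  have : (univ.filter fun v => cyclicDet (upperTri a a 1 : Matrix _ _ F) v ≠ 0) =
      (univ : Finset F) ×ˢ (univ.erase (0 : F)) := by
    ext v
    simp [cyclicDet_upperTri]
  rw [cyclicCount]
  convert! congrArg card this
  rw [card_product, card_erase_of_mem (mem_univ _), card_univ]

open Classical in
theorem sum_eq_scalar_add_companion {f : GL (Fin 2) F → ℂ} (hf : ∀ g h, f (h * g * h⁻¹) = f g) :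
    ∑ g, f g = ∑ a : Fˣ, f (upperTri a a 0) +
      Fintype.card (GL (Fin 2) F) * ∑ p, f (companionGL p) / cyclicCount (companionGL p) := by
  have h := sum_cyclicCount_mul (f := fun g => f g / cyclicCount g)
    (fun g h => by rw [hf, cyclicCount_conj])
  rw [← h]
  have h₁ : ∀ g : GL (Fin 2) F, f g = (if cyclicCount g = 0 then f g else 0) +
      cyclicCount g * (f g / cyclicCount g) := by
    intro g
    split_ifs with h0
    · simp [h0]
    · rw [mul_div_cancel₀ _ (Nat.cast_ne_zero.2 h0), zero_add]
  rw [Finset.sum_congr rfl fun g _ => h₁ g, Finset.sum_add_distrib, ← Finset.sum_filter]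
  congr 1
  symm
  refine Finset.sum_nbij (fun a => upperTri a a 0) ?_ ?_ ?_ fun _ _ => rfl
  · intro a _
    simpa [cyclicCount_eq_zero_iff] using ⟨a, rfl⟩
  · intro a _ b _ hab
    have := congrArg (fun g : GL (Fin 2) F => (g : Matrix (Fin 2) (Fin 2) F) 0 0) hab
    exact Units.ext (by simpa [coe_upperTri] using this)
  · intro g hg
    simp only [Finset.coe_filter, Finset.mem_univ, true_and, Set.mem_ofPred_eq,
      cyclicCount_eq_zero_iff] at hg
    obtain ⟨a, rfl⟩ := hg
    exact ⟨a, by simp, rfl⟩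

end CyclicCount

section QuadraticExtension

variable {F K : Type*} [Field F] [Fintype F] [Field K] [Fintype K] [Algebra F K]
  (b : Module.Basis (Fin 2) F K)

include b in
theorem algebraMap_trace_eq_add_pow (z : K) :
    algebraMap F K (Algebra.trace F K z) = z + z ^ Fintype.card F := by
  rw [FiniteField.algebraMap_trace_eq_sum_pow, Module.finrank_eq_card_basis b]
  simp [Finset.sum_range_succ]

include b in
theorem algebraMap_norm_eq_mul_pow (z : K) :
    algebraMap F K (Algebra.norm F z) = z * z ^ Fintype.card F := by
  rw [FiniteField.algebraMap_norm_eq_prod_pow, Module.finrank_eq_card_basis b]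
  simp [Finset.prod_range_succ]

include b in
theorem card_eq_sq_of_basis : Fintype.card K = Fintype.card F ^ 2 := by
  rw [Module.card_eq_pow_finrank (K := F) (V := K), Module.finrank_eq_card_basis b]
  simp

include b in
theorem pow_card_pow_card (z : K) : (z ^ Fintype.card F) ^ Fintype.card F = z := by
  rw [← pow_mul, ← sq, ← card_eq_sq_of_basis b, FiniteField.pow_card]

omit [Fintype F] [Fintype K] in
theorem mem_range_of_pow_card_eq [Fintype F] [Finite K] {z : K} (h : z ^ Fintype.card F = z) :
    z ∈ Set.range (algebraMap F K) := by
  rw [IsGalois.mem_range_algebraMap_iff_fixed]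
  intro σ
  obtain ⟨i, rfl⟩ := (FiniteField.bijective_frobeniusAlgEquivOfAlgebraic_pow F K).2 σ
  rw [AlgEquiv.coe_pow, FiniteField.coe_frobeniusAlgEquivOfAlgebraic]
  exact Function.iterate_fixed h _

include b in
/-- A quadratic polynomial over `F` has a root in the quadratic extension. -/
theorem exists_root_of_basis (t n : F) :
    ∃ z : K, z ^ 2 - algebraMap F K t * z + algebraMap F K n = 0 := by
  open Polynomial in
  by_cases h : ∃ a : F, a ^ 2 - t * a + n = 0
  · obtain ⟨a, ha⟩ := h
    exact ⟨algebraMap F K a, by simpa using congrArg (algebraMap F K) ha⟩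
  · push Not at h
    let f : F[X] := X ^ 2 - C t * X + C n
    have hdeg : f.natDegree = 2 := by simp only [f]; compute_degree!
    have hf : Irreducible f := by
      refine irreducible_of_degree_le_three_of_not_isRoot (by simp [hdeg]) fun a ha => h a ?_
      simpa [f] using ha
    have hdvd := hf.natDegree_dvd_iff_dvd_X_pow_card_pow_sub_X.1 (dvd_of_eq hdeg)
    have hs : ((X ^ Fintype.card K - X : F[X]).map (algebraMap F K)).Splits :=
      (FiniteField.isSplittingField_sub K F).splits'
    rw [Nat.card_eq_fintype_card, ← card_eq_sq_of_basis b] at hdvd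
    have hne : (X ^ Fintype.card K - X : F[X]) ≠ 0 :=
      FiniteField.X_pow_card_sub_X_ne_zero F Fintype.one_lt_card
    have hs' := hs.of_dvd (by simpa using Polynomial.map_ne_zero (f := algebraMap F K) hne)
      (Polynomial.map_dvd (algebraMap F K) hdvd)
    obtain ⟨z, hz⟩ := hs'.exists_eval_eq_zero (by
      rw [Polynomial.degree_map, Polynomial.degree_eq_natDegree hf.ne_zero, hdeg]; decide)
    exact ⟨z, by simpa [f] using hz⟩

/-- The non-split torus of `GL₂(F)` given by multiplication on the quadratic extension. -/
noncomputable def torusHom : Kˣ →* GL (Fin 2) F :=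
  Units.map (Algebra.leftMulMatrix b).toRingHom.toMonoidHom

omit [Fintype F] [Fintype K] in
theorem coe_torusHom (z : Kˣ) :
    (torusHom b z : Matrix (Fin 2) (Fin 2) F) = Algebra.leftMulMatrix b (z : K) := rfl

omit [Fintype F] [Fintype K] in
theorem torusHom_algebraMap (a : Fˣ) :
    torusHom b (Units.map (algebraMap F K).toMonoidHom a) = upperTri a a 0 := by
  ext1
  rw [coe_torusHom]
  refine ((Algebra.leftMulMatrix b).commutes (a : F)).trans ?_
  ext i j
  fin_cases i <;> fin_cases j <;> simp [coe_upperTri, Matrix.algebraMap_matrix_apply]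

/-- The pair (trace, norm) of a unit of the quadratic extension. -/
noncomputable def traceNorm (z : Kˣ) : F × Fˣ :=
  (Algebra.trace F K (z : K), Units.map (Algebra.norm F (S := K)) z)

omit [Fintype F] [Fintype K] in
theorem traceDet_torusHom (z : Kˣ) : traceDet (torusHom b z) = traceNorm z := by
  refine Prod.ext ?_ (Units.ext ?_)
  · simp [traceDet, traceNorm, coe_torusHom, Algebra.trace_eq_matrix_trace b]
  · simp [traceDet, traceNorm, coe_torusHom, Algebra.norm_eq_matrix_det b]

include b in
theorem traceNorm_eq_iff {z : Kˣ} {t : F} {n : Fˣ} :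
    traceNorm z = (t, n) ↔ algebraMap F K t = z + (z : K) ^ Fintype.card F ∧
      algebraMap F K n = z * (z : K) ^ Fintype.card F := by
  rw [← algebraMap_trace_eq_add_pow b, ← algebraMap_norm_eq_mul_pow b,
    (algebraMap F K).injective.eq_iff, (algebraMap F K).injective.eq_iff, Prod.ext_iff,
    Units.ext_iff]
  simp only [traceNorm, Units.coe_map]
  exact and_congr eq_comm eq_comm

omit [Fintype F] [Fintype K] in
theorem cyclicDet_torusHom_ne_zero {z : Kˣ} (hz : (z : K) ∉ Set.range (algebraMap F K))
    {v : F × F} (hv : v ≠ 0) : cyclicDet (torusHom b z : Matrix _ _ F) v ≠ 0 := by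
  set M := (torusHom b z : Matrix (Fin 2) (Fin 2) F) with hM
  have hdet : ∀ c : F, (M 0 0 - c) * (M 1 1 - c) - M 0 1 * M 1 0 ≠ 0 := by
    intro c hc
    have h1 : Algebra.norm F ((z : K) - algebraMap F K c) = 0 := by
      rw [Algebra.norm_eq_matrix_det b, map_sub, ← coe_torusHom, ← hM, AlgHom.commutes,
        Matrix.det_fin_two]
      simpa [Matrix.algebraMap_matrix_apply] using hc
    have : Module.Finite F K := Module.Finite.of_basis b
    exact hz ⟨c, (sub_eq_zero.1 (Algebra.norm_eq_zero_iff.1 h1)).symm⟩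
  intro h
  simp only [cyclicDet] at h
  obtain ⟨v, w⟩ := v
  simp only at h
  by_cases hw : w = 0
  · have hv' : v ≠ 0 := by
      rintro rfl
      exact hv (by simp [hw])
    have h10 : M 1 0 = 0 := by simpa [hw, hv'] using h
    exact hdet (M 0 0) (by rw [h10]; ring)
  · have key : w ^ 2 * ((M 0 0 - (M 1 0 * (v / w) + M 1 1)) * (M 1 1 - (M 1 0 * (v / w) + M 1 1)) -
        M 0 1 * M 1 0) = 0 := by
      have e : (v / w) * w = v := div_mul_cancel₀ _ hw
      generalize v / w = s at e
      rw [← e] at h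
      linear_combination M 1 0 * h
    exact hdet _ ((mul_eq_zero.1 key).resolve_left (pow_ne_zero _ hw))

omit [Fintype K] in
open Finset in
theorem cyclicCount_torusHom {z : Kˣ} (hz : (z : K) ∉ Set.range (algebraMap F K)) :
    cyclicCount (torusHom b z) = Fintype.card F ^ 2 - 1 := by
  classical
  have : (univ.filter fun v => cyclicDet (torusHom b z : Matrix _ _ F) v ≠ 0) =
      univ.erase (0 : F × F) := by
    ext v
    simp only [mem_filter, mem_univ, true_and, mem_erase, and_true]
    refine ⟨?_, cyclicDet_torusHom_ne_zero b hz⟩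
    rintro h rfl
    exact h (by simp [cyclicDet])
  rw [cyclicCount]
  convert! congrArg card this
  rw [card_erase_of_mem (mem_univ _), card_univ, Fintype.card_prod, sq]

end QuadraticExtension

section ConjugacyClasses

variable {F K : Type*} [Field F] [Fintype F] [Field K] [Fintype K] [Algebra F K]
  (b : Module.Basis (Fin 2) F K)

omit [Fintype F] in
theorem add_mul_eq_iff {a b c d : Fˣ} :
    (((a : F) + b, a * b) : F × Fˣ) = ((c : F) + d, c * d) ↔ (a = c ∧ b = d) ∨ (a = d ∧ b = c) := by
  constructor
  · intro h
    obtain ⟨h1, h2⟩ := Prod.ext_iff.1 h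
    have h2' : (a : F) * b = c * d := by simpa using congrArg Units.val h2
    simp only at h1
    have : ((a : F) - c) * (a - d) = 0 := by linear_combination a * h1 - h2'
    rcases mul_eq_zero.1 this with h' | h'
    · have h3 := sub_eq_zero.1 h'
      exact Or.inl ⟨Units.ext h3, Units.ext (by linear_combination h1 - h3)⟩
    · have h3 := sub_eq_zero.1 h'
      exact Or.inr ⟨Units.ext h3, Units.ext (by linear_combination h1 - h3)⟩
  · rintro (⟨rfl, rfl⟩ | ⟨rfl, rfl⟩)
    · rfl
    · rw [add_comm, mul_comm]

include b in
theorem mem_range_of_traceNorm_eq {z : Kˣ} {c d : Fˣ} (h : traceNorm z = ((c : F) + d, c * d)) :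
    (z : K) ∈ Set.range (algebraMap F K) := by
  obtain ⟨h1, h2⟩ := (traceNorm_eq_iff b).1 h
  rw [map_add] at h1
  rw [Units.val_mul, map_mul] at h2
  have : ((z : K) - algebraMap F K c) * (z - algebraMap F K d) = 0 := by
    linear_combination h2 - z * h1
  rcases mul_eq_zero.1 this with h' | h'
  · exact ⟨c, (sub_eq_zero.1 h').symm⟩
  · exact ⟨d, (sub_eq_zero.1 h').symm⟩

include b in
theorem traceNorm_pow_card (z : Kˣ) : (traceNorm (z ^ Fintype.card F) : F × Fˣ) = traceNorm z := by
  obtain ⟨h1, h2⟩ := (traceNorm_eq_iff b (z := z) (t := (traceNorm z).1)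
    (n := (traceNorm z).2)).1 rfl
  refine (traceNorm_eq_iff b).2 ⟨?_, ?_⟩
  · rw [Units.val_pow_eq_pow_val, pow_card_pow_card b, add_comm]
    exact h1
  · rw [Units.val_pow_eq_pow_val, pow_card_pow_card b, mul_comm]
    exact h2

include b in
theorem eq_or_eq_pow_of_traceNorm_eq {z w : Kˣ} (h : (traceNorm w : F × Fˣ) = traceNorm z) :
    w = z ∨ w = z ^ Fintype.card F := by
  obtain ⟨h1, h2⟩ := (traceNorm_eq_iff b (z := z) (t := (traceNorm z).1)
    (n := (traceNorm z).2)).1 rfl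
  obtain ⟨h3, h4⟩ := (traceNorm_eq_iff b).1 h
  replace h3 := h1.symm.trans h3
  replace h4 := h2.symm.trans h4
  have : ((w : K) - z) * (w - (z : K) ^ Fintype.card F) = 0 := by
    linear_combination h4 - w * h3
  rcases mul_eq_zero.1 this with h' | h'
  · exact Or.inl (Units.ext (sub_eq_zero.1 h'))
  · exact Or.inr (Units.ext (by simpa using sub_eq_zero.1 h'))

include b in
theorem exists_traceNorm_eq {t : F} {n : Fˣ} (h : ∀ a : F, a ^ 2 - t * a + n ≠ 0) :
    ∃ z : Kˣ, traceNorm z = (t, n) ∧ (z : K) ∉ Set.range (algebraMap F K) := by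
  obtain ⟨z, hz⟩ := exists_root_of_basis b t n
  have hzF : z ∉ Set.range (algebraMap F K) := by
    rintro ⟨a, rfl⟩
    refine h a ((algebraMap F K).injective ?_)
    simpa using hz
  have hz0 : z ≠ 0 := by
    rintro rfl
    exact hzF ⟨0, map_zero _⟩
  refine ⟨Units.mk0 z hz0, ?_, hzF⟩
  have hz' : (z ^ Fintype.card F) ^ 2 - algebraMap F K t * z ^ Fintype.card F +
      algebraMap F K n = 0 := by
    have := congrArg (FiniteField.frobeniusAlgHom F K) hz
    rw [map_add, map_sub, map_pow, map_mul, AlgHom.commutes, AlgHom.commutes, map_zero] at this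
    exact this
  have hne : z ^ Fintype.card F - z ≠ 0 := fun h' =>
    hzF (mem_range_of_pow_card_eq (sub_eq_zero.1 h'))
  have ht : algebraMap F K t = z + z ^ Fintype.card F :=
    mul_left_cancel₀ hne (by linear_combination hz - hz')
  refine (traceNorm_eq_iff b).2 ⟨ht, ?_⟩
  rw [Units.val_mk0]
  linear_combination hz + z * ht

open Classical in
variable (F K) in
/-- The elements of `Kˣ` outside `F`. -/
noncomputable def nonscalarUnits : Finset Kˣ :=
  Finset.univ.filter fun z => (z : K) ∉ Set.range (algebraMap F K)

theorem mem_nonscalarUnits {z : Kˣ} :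
    z ∈ nonscalarUnits F K ↔ (z : K) ∉ Set.range (algebraMap F K) := by
  simp [nonscalarUnits]

open Finset Classical in
include b in
/-- Each pair (trace, determinant) is attained twice, counted appropriately, on the regular
elements of the two tori and the Jordan blocks. -/
theorem card_traceDet_fibers (p : F × Fˣ) :
    #{x ∈ (univ : Finset (Fˣ × Fˣ)).filter (fun x => x.1 ≠ x.2) |
        ((x.1 : F) + x.2, x.1 * x.2) = p} +
      2 * #{a : Fˣ | ((a : F) + a, a * a) = p} +
      #{z ∈ nonscalarUnits F K |
        traceNorm z = p} = 2 := by
  obtain ⟨t, n⟩ := p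
  by_cases h : ∃ a : F, a ^ 2 - t * a + n = 0
  · obtain ⟨c, d, hp⟩ : ∃ c d : Fˣ, ((c : F) + d, c * d) = (t, n) := by
      obtain ⟨a, ha⟩ := h
      have hn : a * (t - a) = n := by linear_combination -ha
      have h0 : a * (t - a) ≠ 0 := hn ▸ n.ne_zero
      refine ⟨Units.mk0 a (left_ne_zero_of_mul h0), Units.mk0 (t - a) (right_ne_zero_of_mul h0),
        Prod.ext (by simp) (Units.ext (by simpa using hn))⟩
    rw [← hp]
    simp only [add_mul_eq_iff]
    have h3 : #{z ∈ nonscalarUnits F K |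
        traceNorm z = ((c : F) + d, c * d)} = 0 := by
      rw [card_eq_zero, filter_eq_empty_iff]
      intro z hz hz'
      exact mem_nonscalarUnits.1 hz (mem_range_of_traceNorm_eq b hz')
    rw [h3]
    by_cases hcd : c = d
    · subst hcd
      have h1 : #{x ∈ (univ : Finset (Fˣ × Fˣ)).filter (fun x => x.1 ≠ x.2) |
          (x.1 = c ∧ x.2 = c) ∨ (x.1 = c ∧ x.2 = c)} = 0 := by
        rw [card_eq_zero, filter_eq_empty_iff]
        intro x hx
        rw [mem_filter] at hx
        rintro (⟨h1, h2⟩ | ⟨h1, h2⟩) <;> exact hx.2 (h1.trans h2.symm)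
      have h2 : univ.filter (fun a : Fˣ => (a = c ∧ a = c) ∨ (a = c ∧ a = c)) = {c} := by
        ext a
        simp
      rw [h1, h2, card_singleton]
    · have h1 : {x ∈ (univ : Finset (Fˣ × Fˣ)).filter (fun x => x.1 ≠ x.2) |
          (x.1 = c ∧ x.2 = d) ∨ (x.1 = d ∧ x.2 = c)} = {(c, d), (d, c)} := by
        ext ⟨x, y⟩
        simp only [mem_filter, mem_univ, true_and, mem_insert, mem_singleton, Prod.mk.injEq]
        constructor
        · tauto
        · rintro (⟨rfl, rfl⟩ | ⟨rfl, rfl⟩)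
          · exact ⟨hcd, by tauto⟩
          · exact ⟨Ne.symm hcd, by tauto⟩
      have h2 : #{a : Fˣ | (a = c ∧ a = d) ∨ (a = d ∧ a = c)} = 0 := by
        rw [card_eq_zero, filter_eq_empty_iff]
        rintro a - (⟨h1, h2⟩ | ⟨h1, h2⟩)
        · exact hcd (h1.symm.trans h2)
        · exact hcd (h2.symm.trans h1)
      rw [h1, h2, card_pair]
      intro he
      exact hcd (Prod.mk.inj he).1
  · push Not at h
    have hroot : ∀ c d : Fˣ, ((c : F) + d, c * d) ≠ (t, n) := by
      intro c d hcd
      obtain ⟨h1, h2⟩ := Prod.ext_iff.1 hcd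
      have h2' : (c : F) * d = n := by simpa using congrArg Units.val h2
      simp only at h1
      exact h c (by linear_combination c * h1 - h2')
    obtain ⟨z, hz, hzF⟩ := exists_traceNorm_eq b h
    have h1 : #{x ∈ (univ : Finset (Fˣ × Fˣ)).filter (fun x => x.1 ≠ x.2) |
        ((x.1 : F) + x.2, x.1 * x.2) = (t, n)} = 0 := by
      rw [card_eq_zero, filter_eq_empty_iff]
      exact fun x _ => hroot _ _
    have h2 : #{a : Fˣ | ((a : F) + a, a * a) = (t, n)} = 0 := by
      rw [card_eq_zero, filter_eq_empty_iff]
      exact fun x _ => hroot _ _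
    have h3 : {z ∈ nonscalarUnits F K |
        traceNorm z = (t, n)} = {z, z ^ Fintype.card F} := by
      ext w
      simp only [mem_filter, mem_nonscalarUnits, mem_insert, mem_singleton]
      rw [← hz]
      constructor
      · rintro ⟨-, hw⟩
        exact eq_or_eq_pow_of_traceNorm_eq b hw
      · rintro (rfl | rfl)
        · exact ⟨hzF, rfl⟩
        · refine ⟨?_, traceNorm_pow_card b z⟩
          rintro ⟨c, hc⟩
          refine hzF ⟨c, ?_⟩
          rw [← pow_card_pow_card b (z : K), ← Units.val_pow_eq_pow_val, ← hc, ← map_pow,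
            FiniteField.pow_card]
    rw [h1, h2, h3, card_pair]
    intro he
    exact hzF (mem_range_of_pow_card_eq (by simpa using (congrArg Units.val he).symm))

open Finset in
theorem sum_comp_eq_sum_card_mul {ι κ : Type*} [Fintype κ] [DecidableEq κ] (s : Finset ι)
    (π : ι → κ) (f : κ → ℂ) : ∑ i ∈ s, f (π i) = ∑ k, (#{i ∈ s | π i = k} : ℂ) * f k := by
  rw [← sum_fiberwise s π]
  refine sum_congr rfl fun k _ => ?_
  rw [← nsmul_eq_mul, ← sum_const]
  exact sum_congr rfl fun i hi => by rw [(mem_filter.1 hi).2]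

variable {f : GL (Fin 2) F → ℂ}

omit [Fintype F] in
theorem apply_eq_apply_companionGL {α : Type*} {f : GL (Fin 2) F → α}
    (hf : ∀ g h, f (h * g * h⁻¹) = f g) {g : GL (Fin 2) F}
    {v : F × F} (hv : cyclicDet (g : Matrix _ _ F) v ≠ 0) : f g = f (companionGL (traceDet g)) := by
  obtain ⟨P, hP⟩ := exists_conj_companionGL hv
  rw [← hf (companionGL (traceDet g)) P, hP]

omit [Fintype F] in
theorem apply_diagonal {α : Type*} {f : GL (Fin 2) F → α} (hf : ∀ g h, f (h * g * h⁻¹) = f g)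
    {c d : Fˣ} (h : c ≠ d) (x : F) :
    f (upperTri c d x) = f (companionGL ((c : F) + d, c * d)) := by
  have h' : (d : F) - c ≠ 0 := sub_ne_zero.2 fun h' => h (Units.ext h'.symm)
  rw [apply_eq_apply_companionGL hf (v := ((1 + x) / (d - c), 1)), traceDet_upperTri]
  rw [cyclicDet_upperTri]
  simp [mul_div_cancel₀ _ h']

omit [Fintype F] in
theorem apply_jordan {α : Type*} {f : GL (Fin 2) F → α} (hf : ∀ g h, f (h * g * h⁻¹) = f g)
    (c : Fˣ) {x : F} (hx : x ≠ 0) :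
    f (upperTri c c x) = f (companionGL ((c : F) + c, c * c)) := by
  rw [apply_eq_apply_companionGL hf (v := (0, 1)), traceDet_upperTri]
  rw [cyclicDet_upperTri]
  simpa using hx

omit [Fintype F] [Fintype K] in
theorem apply_torusHom {α : Type*} {f : GL (Fin 2) F → α} (hf : ∀ g h, f (h * g * h⁻¹) = f g)
    {z : Kˣ} (hz : (z : K) ∉ Set.range (algebraMap F K)) :
    f (torusHom b z) = f (companionGL (traceNorm z)) := by
  rw [apply_eq_apply_companionGL hf (cyclicDet_torusHom_ne_zero b hz (v := (0, 1)) (by simp)),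
    traceDet_torusHom]

open Classical in
theorem two_mul_sum_companionGL (hf : ∀ g h, f (h * g * h⁻¹) = f g) :
    2 * ∑ p, f (companionGL p) =
      ∑ x : Fˣ × Fˣ with x.1 ≠ x.2, f (upperTri x.1 x.2 0) +
      2 * ∑ c : Fˣ, f (upperTri c c 1) +
      ∑ z ∈ nonscalarUnits F K, f (torusHom b z) := by
  have h1 : ∑ x : Fˣ × Fˣ with x.1 ≠ x.2, f (upperTri x.1 x.2 0) =
      ∑ x : Fˣ × Fˣ with x.1 ≠ x.2, f (companionGL ((x.1 : F) + x.2, x.1 * x.2)) :=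
    Finset.sum_congr rfl fun x hx => apply_diagonal hf (Finset.mem_filter.1 hx).2 0
  have h2 : ∑ c : Fˣ, f (upperTri c c 1) = ∑ c : Fˣ, f (companionGL ((c : F) + c, c * c)) :=
    Finset.sum_congr rfl fun c _ => apply_jordan hf c one_ne_zero
  have h3 : ∑ z ∈ nonscalarUnits F K, f (torusHom b z) =
      ∑ z ∈ nonscalarUnits F K, f (companionGL (traceNorm z)) :=
    Finset.sum_congr rfl fun z hz => apply_torusHom b hf (mem_nonscalarUnits.1 hz)
  rw [h1, h2, h3,
    sum_comp_eq_sum_card_mul _ (fun x : Fˣ × Fˣ => ((x.1 : F) + x.2, x.1 * x.2))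
      (fun p => f (companionGL p)),
    sum_comp_eq_sum_card_mul _ (fun c : Fˣ => ((c : F) + c, c * c)) (fun p => f (companionGL p)),
    sum_comp_eq_sum_card_mul _ traceNorm (fun p => f (companionGL p)),
    Finset.mul_sum, Finset.mul_sum, ← Finset.sum_add_distrib, ← Finset.sum_add_distrib]
  refine Finset.sum_congr rfl fun p _ => ?_
  rw [← mul_assoc, ← add_mul, ← add_mul]
  congr 1
  exact_mod_cast (card_traceDet_fibers b p).symm

open Classical in
/-- The Weyl integration formula for class functions on `GL₂(F)`. -/
theorem sum_classFunction (hf : ∀ g h, f (h * g * h⁻¹) = f g) :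
    ∑ g, f g = ∑ c : Fˣ, f (upperTri c c 0) + Fintype.card (GL (Fin 2) F) *
      ((∑ x : Fˣ × Fˣ with x.1 ≠ x.2, f (upperTri x.1 x.2 0)) / (2 * (Fintype.card F - 1) ^ 2) +
      (∑ c : Fˣ, f (upperTri c c 1)) / (Fintype.card F * (Fintype.card F - 1)) +
      (∑ z ∈ nonscalarUnits F K, f (torusHom b z)) /
        (2 * (Fintype.card F ^ 2 - 1))) := by
  rw [sum_eq_scalar_add_companion hf]
  congr 2
  have hq : 1 ≤ Fintype.card F := Fintype.card_pos
  have hq2 : 1 ≤ Fintype.card F ^ 2 := Nat.one_le_pow _ _ hq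
  have h := two_mul_sum_companionGL b (f := fun g => f g / cyclicCount g)
    (fun g h => by rw [hf, cyclicCount_conj])
  have h1 : ∑ x : Fˣ × Fˣ with x.1 ≠ x.2,
      f (upperTri x.1 x.2 0) / cyclicCount (upperTri x.1 x.2 0) =
      (∑ x : Fˣ × Fˣ with x.1 ≠ x.2, f (upperTri x.1 x.2 0)) / (Fintype.card F - 1) ^ 2 := by
    rw [Finset.sum_div]
    refine Finset.sum_congr rfl fun x hx => ?_
    rw [cyclicCount_diagonal (Finset.mem_filter.1 hx).2]
    push_cast [hq]
    rfl
  have h2 : ∑ c : Fˣ, f (upperTri c c 1) / cyclicCount (upperTri c c 1) =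
      (∑ c : Fˣ, f (upperTri c c 1)) / (Fintype.card F * (Fintype.card F - 1)) := by
    rw [Finset.sum_div]
    refine Finset.sum_congr rfl fun x hx => ?_
    rw [cyclicCount_jordan]
    push_cast [hq]
    rfl
  have h3 : ∑ z ∈ nonscalarUnits F K,
        f (torusHom b z) / cyclicCount (torusHom b z) =
      (∑ z ∈ nonscalarUnits F K, f (torusHom b z)) /
        (Fintype.card F ^ 2 - 1) := by
    rw [Finset.sum_div]
    refine Finset.sum_congr rfl fun z hz => ?_
    rw [cyclicCount_torusHom b (mem_nonscalarUnits.1 hz)]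
    push_cast [hq2]
    rfl
  rw [h1, h2, h3] at h
  generalize ∑ x : Fˣ × Fˣ with x.1 ≠ x.2, f (upperTri x.1 x.2 0) = A at h ⊢
  generalize ∑ c : Fˣ, f (upperTri c c 1) = B at h ⊢
  generalize ∑ z ∈ nonscalarUnits F K, f (torusHom b z) = C at h ⊢
  rw [mul_comm (2 : ℂ) (((Fintype.card F : ℂ) - 1) ^ 2),
    mul_comm (2 : ℂ) ((Fintype.card F : ℂ) ^ 2 - 1),
    ← div_div A, ← div_div C]
  generalize A / ((Fintype.card F : ℂ) - 1) ^ 2 = A' at h ⊢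
  generalize B / ((Fintype.card F : ℂ) * (Fintype.card F - 1)) = B' at h ⊢
  generalize C / ((Fintype.card F : ℂ) ^ 2 - 1) = C' at h ⊢
  linear_combination h / 2

/-- A property invariant under conjugation holds on `GL₂(F)` if it holds on the scalar matrices,
Jordan blocks and regular elements of the two tori. -/
theorem forall_of_classes {Q : GL (Fin 2) F → Prop} (hQ : ∀ g h, Q (h * g * h⁻¹) = Q g)
    (hscalar : ∀ c, Q (upperTri c c 0)) (hjordan : ∀ c, Q (upperTri c c 1))
    (hdiag : ∀ c d, c ≠ d → Q (upperTri c d 0))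
    (htorus : ∀ z : Kˣ, (z : K) ∉ Set.range (algebraMap F K) → Q (torusHom b z)) (g) : Q g := by
  by_cases h : ∀ v, cyclicDet (g : Matrix _ _ F) v = 0
  · obtain ⟨a, rfl⟩ := exists_eq_upperTri h
    exact hscalar a
  push Not at h
  obtain ⟨v, hv⟩ := h
  rw [apply_eq_apply_companionGL hQ hv]
  generalize traceDet g = p
  obtain ⟨t, n⟩ := p
  by_cases h : ∃ a : F, a ^ 2 - t * a + n = 0
  · obtain ⟨a, ha⟩ := h
    have hn : a * (t - a) = n := by linear_combination -ha
    have h0 : a * (t - a) ≠ 0 := hn ▸ n.ne_zero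
    obtain ⟨c, d, hp⟩ : ∃ c d : Fˣ, ((c : F) + d, c * d) = (t, n) :=
      ⟨Units.mk0 a (left_ne_zero_of_mul h0), Units.mk0 (t - a) (right_ne_zero_of_mul h0),
        Prod.ext (by simp) (Units.ext (by simpa using hn))⟩
    rw [← hp]
    by_cases hcd : c = d
    · subst hcd
      rw [← apply_jordan hQ c one_ne_zero]
      exact hjordan c
    · rw [← apply_diagonal hQ hcd 0]
      exact hdiag c d hcd
  · push Not at h
    obtain ⟨z, hz, hzF⟩ := exists_traceNorm_eq b h
    rw [← hz, ← apply_torusHom b hQ hzF]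
    exact htorus z hzF

end ConjugacyClasses

section Multiplicities

/-- The multiplicity of a linear character in the restriction of a character along a
homomorphism is a natural number. -/
theorem exists_multiplicity {G H V : Type*} [Group G] [Group H] [Fintype H] [AddCommGroup V]
    [Module ℂ V] [FiniteDimensional ℂ V] (ρ : Representation ℂ G V) (ι : H →* G) (θ : H →* ℂ) :
    ∃ n : ℕ, ∑ h, ρ.character (ι h) * θ h = Fintype.card H * n := by
  let σ : Representation ℂ H V :=
    { toFun := fun h => θ h • ρ (ι h)
      map_one' := by simp
      map_mul' := fun g h => by
        rw [map_mul, map_mul, map_mul, smul_mul_smul_comm] }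
  have hH : (Nat.card H : ℂ) ≠ 0 := Nat.cast_ne_zero.2 Nat.card_pos.ne'
  have : Invertible (Nat.card H : ℂ) := invertibleOfNonzero hH
  refine ⟨Module.finrank ℂ σ.invariants, ?_⟩
  rw [← Nat.card_eq_fintype_card, ← Representation.card_inv_mul_sum_char_eq_finrank σ,
    mul_inv_cancel_left₀ hH]
  refine Finset.sum_congr rfl fun h _ => ?_
  change _ = LinearMap.trace ℂ V (θ h • ρ (ι h))
  rw [map_smul, smul_eq_mul, mul_comm]
  rfl

theorem exists_sum_eq_card_mul {H : Type*} [Group H] [Fintype H] (θ : H →* ℂ) :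
    ∃ k : ℕ, ∑ h, θ h = Fintype.card H * k := by
  classical
  rw [sum_hom_units]
  split_ifs
  · exact ⟨1, by simp⟩
  · exact ⟨0, by simp⟩

theorem norm_hom_eq_one {H : Type*} [Group H] [Finite H] (θ : H →* ℂ) (h : H) : ‖θ h‖ = 1 := by
  refine Complex.norm_eq_one_of_pow_eq_one (n := Nat.card H) ?_ Nat.card_pos.ne'
  rw [← map_pow, pow_card_eq_one', map_one]

variable {G : Type} [Group G] (V : FDRep ℂ G) [Simple V]

theorem finrank_ne_zero_of_simple : (Module.finrank ℂ V : ℂ) ≠ 0 := by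
  intro h
  have h0 : Module.finrank ℂ V = 0 := by exact_mod_cast h
  have := Module.finrank_zero_iff.1 h0
  refine id_nonzero V ?_
  ext x
  exact Subsingleton.elim _ _

/-- Schur's lemma for central elements. -/
theorem character_central_mul {z : G} (hz : ∀ g, z * g = g * z) (g : G) :
    V.character (z * g) = V.character z / Module.finrank ℂ V * V.character g := by
  let φ : V ⟶ V := ⟨FGModuleCat.ofHom (V.ρ z), fun h => by
    ext x
    have := LinearMap.congr_fun (congrArg V.ρ (hz h)) x
    rw [map_mul, map_mul] at this
    exact this⟩
  obtain ⟨c, hc⟩ := endomorphism_simple_eq_smul_id ℂ φ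
  have hρ : V.ρ z = c • LinearMap.id := by
    ext x
    have := congrArg (fun ψ : V ⟶ V => ψ.hom.hom.hom x) hc
    exact this.symm
  have hmul : ∀ g, V.character (z * g) = c * V.character g := fun g => by
    unfold FDRep.character
    rw [map_mul, hρ, smul_mul_assoc, map_smul, smul_eq_mul]
    rfl
  have h1 := hmul 1
  rw [mul_one, FDRep.char_one] at h1
  rw [hmul, h1, mul_div_cancel_right₀ _ (finrank_ne_zero_of_simple V)]

end Multiplicities

section BorelGroup

/-- The group of upper triangular invertible matrices, as a type of triples. -/
@[ext]
structure BorelGroup (F : Type*) [Field F] where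
  /-- The upper left entry. -/
  fst : Fˣ
  /-- The lower right entry. -/
  snd : Fˣ
  /-- The upper right entry. -/
  off : F

namespace BorelGroup

variable {F : Type*} [Field F]

instance : Mul (BorelGroup F) :=
  ⟨fun s t => ⟨s.fst * t.fst, s.snd * t.snd, s.fst * t.off + s.off * t.snd⟩⟩

instance : One (BorelGroup F) := ⟨⟨1, 1, 0⟩⟩

instance : Inv (BorelGroup F) :=
  ⟨fun s => ⟨s.fst⁻¹, s.snd⁻¹, -((s.fst⁻¹ : Fˣ) * s.off * (s.snd⁻¹ : Fˣ))⟩⟩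

theorem mul_def (s t : BorelGroup F) :
    s * t = ⟨s.fst * t.fst, s.snd * t.snd, s.fst * t.off + s.off * t.snd⟩ := rfl

theorem one_def : (1 : BorelGroup F) = ⟨1, 1, 0⟩ := rfl

theorem inv_def (s : BorelGroup F) :
    s⁻¹ = ⟨s.fst⁻¹, s.snd⁻¹, -((s.fst⁻¹ : Fˣ) * s.off * (s.snd⁻¹ : Fˣ))⟩ := rfl

instance : Group (BorelGroup F) :=
  Group.ofLeftAxioms
    (fun s t u => by
      simp only [mul_def, Units.val_mul]
      ext <;> simp only [mul_assoc, mul_add, add_mul, add_assoc])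
    (fun s => by simp [mul_def, one_def])
    (fun s => by simp [mul_def, one_def, inv_def])

variable (F) in
/-- The underlying set of triples. -/
def equivProd : BorelGroup F ≃ (Fˣ × Fˣ) × F where
  toFun s := ((s.fst, s.snd), s.off)
  invFun p := ⟨p.1.1, p.1.2, p.2⟩

noncomputable instance [Fintype F] : Fintype (BorelGroup F) :=
  letI := Classical.decEq F
  Fintype.ofEquiv _ (equivProd F).symm

variable (F) in
/-- The inclusion into `GL₂(F)`. -/
noncomputable def toGL : BorelGroup F →* GL (Fin 2) F where
  toFun s := upperTri s.fst s.snd s.off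
  map_one' := upperTri_one
  map_mul' _ _ := (upperTri_mul _ _ _ _ _ _).symm

variable (F) in
/-- The diagonal part. -/
def toTorus : BorelGroup F →* Fˣ × Fˣ where
  toFun s := (s.fst, s.snd)
  map_one' := rfl
  map_mul' _ _ := rfl

end BorelGroup

end BorelGroup

section Restriction

open scoped Classical

open Additive in
/-- The multiplicative form of the inverse of a character of a commutative group. -/
noncomputable def AddChar.invHom {A : Type*} [CommGroup A]
    (θ : AddChar (Additive A) ℂ) : A →* ℂ where
  toFun a := θ (ofMul a⁻¹)
  map_one' := by simp
  map_mul' a b := by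
    rw [mul_inv, ofMul_mul, AddChar.map_add_eq_mul]

variable {F K : Type} [Field F] [Fintype F] [Field K] [Fintype K] [Algebra F K]
  (b : Module.Basis (Fin 2) F K) (V : FDRep ℂ (GL (Fin 2) F)) [Simple V]

/-- The central character. -/
noncomputable def centralChar : Fˣ →* ℂ where
  toFun a := V.character (upperTri a a 0) / Module.finrank ℂ V
  map_one' := by
    rw [upperTri_one, FDRep.char_one, div_self (finrank_ne_zero_of_simple V)]
  map_mul' a c := by
    have : upperTri (a * c) (a * c) (0 : F) = upperTri a a 0 * upperTri c c 0 := by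
      simp [upperTri_mul]
    rw [this, character_central_mul V (upperTri_self_zero_commute a), mul_div_assoc]

omit [Fintype F] in
theorem character_scalar_mul (a : Fˣ) (g : GL (Fin 2) F) :
    V.character (upperTri a a 0 * g) = centralChar V a * V.character g :=
  character_central_mul V (upperTri_self_zero_commute a) g

omit [Fintype F] in
theorem character_scalar (a : Fˣ) :
    V.character (upperTri a a 0) = centralChar V a * V.character 1 := by
  rw [← character_scalar_mul, mul_one]

omit [Fintype F] in
theorem character_jordan (a : Fˣ) {x : F} (hx : x ≠ 0) :
    V.character (upperTri a a x) = centralChar V a * V.character (upperTri 1 1 1) := by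
  have : upperTri a a (a : F) = upperTri a a 0 * upperTri 1 1 1 := by simp [upperTri_mul]
  rw [← character_scalar_mul, ← this, apply_jordan (V.char_conj) a hx,
    apply_jordan (V.char_conj) a a.ne_zero]

omit [Simple V] in
theorem sum_character_jordan (f : F → ℂ) :
    ∑ x, V.character (upperTri 1 1 x) * f x =
      V.character 1 * f 0 + V.character (upperTri 1 1 1) * (∑ x, f x - f 0) := by
  classical
  rw [← Finset.add_sum_erase _ _ (Finset.mem_univ (0 : F)), upperTri_one,
    ← Finset.add_sum_erase _ f (Finset.mem_univ (0 : F)), add_sub_cancel_left, Finset.mul_sum]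
  congr 1
  refine Finset.sum_congr rfl fun x hx => ?_
  rw [apply_jordan V.char_conj 1 (Finset.ne_of_mem_erase hx),
    apply_jordan V.char_conj 1 one_ne_zero]

variable (F) in
/-- The inclusion of the unipotent radical. -/
noncomputable def unipotentHom : Multiplicative F →* GL (Fin 2) F where
  toFun x := upperTri 1 1 x.toAdd
  map_one' := upperTri_one
  map_mul' x y := by
    rw [upperTri_mul]
    simp [add_comm]

omit [Simple V] in
theorem exists_sub_eq_card_mul : ∃ m : ℕ,
    V.character 1 - V.character (upperTri 1 1 1) = Fintype.card F * m := by
  obtain ⟨ψ, hψ⟩ := AddChar.exists_apply_ne_zero.2 (one_ne_zero (α := F))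
  obtain ⟨m, hm⟩ := exists_multiplicity V.ρ (unipotentHom F) ψ.toMonoidHom
  refine ⟨m, ?_⟩
  rw [Fintype.card_multiplicative] at hm
  rw [← hm]
  have h := sum_character_jordan V ψ
  have h0 : ∑ x, ψ x = 0 := AddChar.sum_eq_zero_of_ne_one (by rintro rfl; simp at hψ)
  rw [h0, AddChar.map_zero_eq_one] at h
  calc _ = ∑ x, V.character (upperTri 1 1 x) * ψ x := by rw [h]; ring
    _ = _ := Fintype.sum_equiv Multiplicative.ofAdd _ _ fun x => rfl

/-- The character of the Jacquet module on the split torus. -/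
noncomputable def splitPart (p : Fˣ × Fˣ) : ℂ :=
  (∑ x : F, V.character (upperTri p.1 p.2 x)) / Fintype.card F

theorem splitPart_self (a : Fˣ) :
    splitPart V (a, a) = centralChar V a * splitPart V (1, 1) := by
  simp only [splitPart]
  rw [mul_div_assoc', Finset.mul_sum]
  congr 1
  refine Fintype.sum_equiv (Equiv.mulLeft₀ _ (a⁻¹).ne_zero) _ _ fun x => ?_
  rw [← character_scalar_mul, upperTri_mul]
  simp

omit [Simple V] in
theorem splitPart_of_ne {p : Fˣ × Fˣ} (h : p.1 ≠ p.2) :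
    splitPart V p = V.character (upperTri p.1 p.2 0) := by
  have hF : (Fintype.card F : ℂ) ≠ 0 := Nat.cast_ne_zero.2 Fintype.card_ne_zero
  rw [splitPart, div_eq_iff hF, mul_comm, apply_diagonal V.char_conj h 0, ← nsmul_eq_mul]
  refine Finset.sum_eq_card_nsmul fun x _ => apply_diagonal V.char_conj h x

open Additive in
omit [Simple V] in
theorem exists_splitPart_coeff (θ : AddChar (Additive (Fˣ × Fˣ)) ℂ) : ∃ n : ℕ,
    ∑ p, splitPart V p * θ (ofMul p⁻¹) = Fintype.card (Fˣ × Fˣ) * (n : ℂ) := by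
  obtain ⟨n, hn⟩ := exists_multiplicity V.ρ (BorelGroup.toGL F)
    (θ.invHom.comp (BorelGroup.toTorus F))
  refine ⟨n, ?_⟩
  have hF : (Fintype.card F : ℂ) ≠ 0 := Nat.cast_ne_zero.2 Fintype.card_ne_zero
  have hsum := Fintype.sum_equiv (BorelGroup.equivProd F)
    (fun s => Representation.character V.ρ (BorelGroup.toGL F s) *
      θ.invHom.comp (BorelGroup.toTorus F) s)
    (fun p => V.character (upperTri p.1.1 p.1.2 p.2) * θ (ofMul p.1⁻¹)) fun s => rfl
  replace hn := hsum.symm.trans hn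
  rw [Fintype.card_congr (BorelGroup.equivProd F), Fintype.card_prod,
    Fintype.sum_prod_type] at hn
  refine mul_left_cancel₀ hF ?_
  rw [← mul_assoc, mul_comm (Fintype.card F : ℂ) (Fintype.card (Fˣ × Fˣ) : ℂ)]
  push_cast at hn ⊢
  rw [← hn, Finset.mul_sum]
  refine Finset.sum_congr rfl fun p _ => ?_
  rw [splitPart, ← Finset.sum_mul, ← mul_assoc, mul_div_cancel₀ _ hF]

variable (F K) in
/-- The inclusion of unit groups. -/
noncomputable abbrev scalarUnits : Fˣ →* Kˣ := Units.map (algebraMap F K).toMonoidHom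

omit [Fintype F] [Fintype K] in
theorem scalarUnits_injective : Function.Injective (scalarUnits F K) :=
  Units.map_injective (algebraMap F K).injective

theorem scalarUnits_notMem (a : Fˣ) : scalarUnits F K a ∉ nonscalarUnits F K := by
  rw [mem_nonscalarUnits, not_not]
  exact ⟨a, rfl⟩

theorem exists_scalarUnits_eq {z : Kˣ} (hz : z ∉ nonscalarUnits F K) :
    ∃ a, scalarUnits F K a = z := by
  rw [mem_nonscalarUnits, not_not] at hz
  obtain ⟨a, ha⟩ := hz
  have h0 : a ≠ 0 := by
    rintro rfl
    exact z.ne_zero (by rw [← ha, map_zero])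
  exact ⟨Units.mk0 a h0, Units.ext ha⟩

theorem sum_units_eq (f : Kˣ → ℂ) :
    ∑ z, f z = ∑ a, f (scalarUnits F K a) + ∑ z ∈ nonscalarUnits F K, f z := by
  rw [← Finset.sum_compl_add_sum (nonscalarUnits F K)]
  congr 1
  symm
  refine Finset.sum_bij (fun a _ => scalarUnits F K a) ?_ ?_ ?_ fun _ _ => rfl
  · intro a _
    exact Finset.mem_compl.2 (scalarUnits_notMem a)
  · intro a _ c _ h
    exact scalarUnits_injective h
  · intro z hz
    obtain ⟨a, ha⟩ := exists_scalarUnits_eq (Finset.mem_compl.1 hz)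
    exact ⟨a, Finset.mem_univ _, ha⟩

/-- The difference on the nonsplit torus of the character induced from the centre and the
restricted character. -/
noncomputable def nonsplitPart (m : ℕ) (z : Kˣ) : ℂ :=
  m * ∑ a, (if scalarUnits F K a = z then (Fintype.card F + 1) * centralChar V a else 0) -
    V.character (torusHom b z)

omit [Fintype K] in
theorem nonsplitPart_scalar (m : ℕ) (a : Fˣ) : nonsplitPart b V m (scalarUnits F K a) =
    centralChar V a * (m * (Fintype.card F + 1) - V.character 1) := by
  rw [nonsplitPart, torusHom_algebraMap, character_scalar]
  simp only [scalarUnits_injective.eq_iff, Finset.sum_ite_eq', Finset.mem_univ, if_true]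
  ring

theorem nonsplitPart_of_mem (m : ℕ) {z : Kˣ} (hz : z ∈ nonscalarUnits F K) :
    nonsplitPart b V m z = -V.character (torusHom b z) := by
  rw [nonsplitPart, Finset.sum_eq_zero, mul_zero, zero_sub]
  intro a _
  rw [if_neg]
  rintro rfl
  exact scalarUnits_notMem a hz

include b in
omit V [Simple V] in
theorem card_units_eq_mul : (Fintype.card Kˣ : ℂ) = (Fintype.card F + 1) * Fintype.card Fˣ := by
  have hq : 1 ≤ Fintype.card F := Fintype.card_pos
  rw [Fintype.card_units, Fintype.card_units, card_eq_sq_of_basis b,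
    Nat.cast_sub (Nat.one_le_pow _ _ hq), Nat.cast_sub hq]
  push_cast
  ring

open Additive in
theorem exists_nonsplitPart_coeff (m : ℕ) (θ : AddChar (Additive Kˣ) ℂ) : ∃ c : ℤ,
    ∑ z, nonsplitPart b V m z * θ (ofMul z⁻¹) = Fintype.card Kˣ * (c : ℂ) := by
  obtain ⟨n, hn⟩ := exists_multiplicity V.ρ (torusHom b) θ.invHom
  obtain ⟨k, hk⟩ := exists_sum_eq_card_mul (centralChar V * θ.invHom.comp (scalarUnits F K))
  refine ⟨m * k - n, ?_⟩
  have h1 : ∑ z, (∑ a, (if scalarUnits F K a = z then (Fintype.card F + 1) * centralChar V a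
      else 0)) * θ (ofMul z⁻¹) = Fintype.card Kˣ * (k : ℂ) := by
    rw [card_units_eq_mul b, mul_assoc, ← hk, Finset.mul_sum]
    simp only [Finset.sum_mul]
    rw [Finset.sum_comm]
    refine Finset.sum_congr rfl fun a _ => ?_
    simp only [ite_mul, zero_mul, Finset.sum_ite_eq, Finset.mem_univ, if_true, mul_assoc]
    rfl
  have h2 : ∑ z, V.character (torusHom b z) * θ (ofMul z⁻¹) = Fintype.card Kˣ * (n : ℂ) := hn
  simp only [nonsplitPart, sub_mul, Finset.sum_sub_distrib, mul_assoc]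
  rw [← Finset.mul_sum, h1, h2]
  push_cast
  ring

end Restriction

section NormEquation

open scoped Classical

variable {F K : Type} [Field F] [Fintype F] [Field K] [Fintype K] [Algebra F K]
  (b : Module.Basis (Fin 2) F K) (V : FDRep ℂ (GL (Fin 2) F)) [Simple V]

omit [Simple V] in
theorem splitPart_one_one : Fintype.card F * splitPart V (1, 1) =
    V.character 1 + (Fintype.card F - 1) * V.character (upperTri 1 1 1) := by
  have hF : (Fintype.card F : ℂ) ≠ 0 := Nat.cast_ne_zero.2 Fintype.card_ne_zero
  have h := sum_character_jordan V (fun _ => 1)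
  simp only [mul_one, Finset.sum_const, Finset.card_univ, nsmul_eq_mul] at h
  rw [splitPart, mul_div_cancel₀ _ hF, h]
  ring

omit [Fintype F] in
theorem centralChar_mul_inv (a : Fˣ) : centralChar V a * centralChar V a⁻¹ = 1 := by
  rw [← map_mul, mul_inv_cancel, map_one]

theorem sum_split_norm : ∑ x : Fˣ × Fˣ with x.1 ≠ x.2,
      V.character (upperTri x.1 x.2 0) * V.character (upperTri x.1 x.2 0)⁻¹ =
    ∑ p, splitPart V p * splitPart V p⁻¹ - Fintype.card Fˣ * splitPart V (1, 1) ^ 2 := by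
  rw [eq_sub_iff_add_eq, ← Finset.sum_filter_add_sum_filter_not Finset.univ
    (fun x : Fˣ × Fˣ => x.1 ≠ x.2)]
  congr 1
  · refine Finset.sum_congr rfl fun x hx => ?_
    have hx' := (Finset.mem_filter.1 hx).2
    have hx'' : x⁻¹.1 ≠ x⁻¹.2 := fun h => hx' (inv_injective h)
    rw [splitPart_of_ne V hx', splitPart_of_ne V hx'', upperTri_inv]
    simp
  · have : Finset.univ.filter (fun x : Fˣ × Fˣ => ¬ x.1 ≠ x.2) =
        Finset.univ.map ⟨fun a => (a, a), fun a c h => (Prod.mk.inj h).1⟩ := by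
      ext x
      simp only [Finset.mem_filter, Finset.mem_univ, true_and, not_not, Finset.mem_map]
      exact ⟨fun h => ⟨x.1, Prod.ext rfl h⟩, by rintro ⟨a, rfl⟩; rfl⟩
    rw [this, Finset.sum_map, ← nsmul_eq_mul, ← Finset.card_univ]
    refine (Finset.sum_eq_card_nsmul fun a _ => ?_).symm
    change splitPart V (a, a) * splitPart V (a⁻¹, a⁻¹) = _
    rw [splitPart_self, splitPart_self V a⁻¹]
    linear_combination splitPart V (1, 1) ^ 2 * centralChar_mul_inv V a

theorem sum_nonsplit_norm (m : ℕ) : ∑ z ∈ nonscalarUnits F K,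
      V.character (torusHom b z) * V.character (torusHom b z)⁻¹ =
    ∑ z, nonsplitPart b V m z * nonsplitPart b V m z⁻¹ -
      Fintype.card Fˣ * (m * (Fintype.card F + 1) - V.character 1) ^ 2 := by
  rw [eq_sub_iff_add_eq, sum_units_eq (F := F), add_comm]
  congr 1
  · rw [← nsmul_eq_mul, ← Finset.card_univ]
    refine (Finset.sum_eq_card_nsmul fun a _ => ?_).symm
    rw [← map_inv, nonsplitPart_scalar, nonsplitPart_scalar]
    linear_combination (m * (Fintype.card F + 1) - V.character 1) ^ 2 * centralChar_mul_inv V a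
  · refine Finset.sum_congr rfl fun z hz => ?_
    have hz' : z⁻¹ ∈ nonscalarUnits F K := by
      by_contra h
      obtain ⟨a, ha⟩ := exists_scalarUnits_eq h
      refine scalarUnits_notMem a⁻¹ (K := K) ?_
      rwa [map_inv, ha, inv_inv]
    rw [nonsplitPart_of_mem b V m hz, nonsplitPart_of_mem b V m hz', map_inv, neg_mul_neg]

theorem two_eq_norm_add_norm {m : ℕ}
    (hm : V.character 1 - V.character (upperTri 1 1 1) = Fintype.card F * m) :
    (2 : ℂ) = (∑ p, splitPart V p * splitPart V p⁻¹) / Fintype.card (Fˣ × Fˣ) +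
      (∑ z, nonsplitPart b V m z * nonsplitPart b V m z⁻¹) / Fintype.card Kˣ := by
  have hq : 1 < Fintype.card F := Fintype.one_lt_card
  have hnorm := (FDRep.simple_iff_char_is_norm_one V).1 inferInstance
  have hclass : ∀ g h : GL (Fin 2) F, V.character (h * g * h⁻¹) * V.character (h * g * h⁻¹)⁻¹ =
      V.character g * V.character g⁻¹ := fun g h => by
    rw [V.char_conj, conj_inv, V.char_conj]
  have hscalar : ∑ c : Fˣ, V.character (upperTri c c 0) * V.character (upperTri c c 0)⁻¹ =
      Fintype.card Fˣ * V.character 1 ^ 2 := by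
    rw [← nsmul_eq_mul, ← Finset.card_univ]
    refine Finset.sum_eq_card_nsmul fun a _ => ?_
    rw [upperTri_inv, mul_zero, zero_mul, neg_zero, character_scalar, character_scalar]
    linear_combination V.character 1 ^ 2 * centralChar_mul_inv V a
  have hjordan : ∑ c : Fˣ, V.character (upperTri c c 1) * V.character (upperTri c c 1)⁻¹ =
      Fintype.card Fˣ * V.character (upperTri 1 1 1) ^ 2 := by
    rw [← nsmul_eq_mul, ← Finset.card_univ]
    refine Finset.sum_eq_card_nsmul fun a _ => ?_
    rw [upperTri_inv, character_jordan V a one_ne_zero, character_jordan V a⁻¹ (by simp)]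
    linear_combination V.character (upperTri 1 1 1) ^ 2 * centralChar_mul_inv V a
  have hG : (Fintype.card (GL (Fin 2) F) : ℂ) =
      ((Fintype.card F : ℂ) ^ 2 - 1) * (Fintype.card F ^ 2 - Fintype.card F) := by
    rw [← Nat.card_eq_fintype_card, Matrix.card_GL_field]
    simp only [Fin.prod_univ_two, Fin.val_zero, Fin.val_one, pow_zero, pow_one]
    rw [Nat.cast_mul, Nat.cast_sub (Nat.one_le_pow _ _ hq.le),
      Nat.cast_sub (Nat.le_self_pow two_ne_zero _)]
    push_cast
    rfl
  rw [sum_classFunction b hclass, hscalar, hjordan, sum_split_norm, sum_nonsplit_norm b V m,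
    Nat.card_eq_fintype_card, hG] at hnorm
  have hd := splitPart_one_one V
  rw [card_units_eq_mul b, Fintype.card_prod]
  rw [Fintype.card_units, Nat.cast_sub hq.le] at hnorm
  rw [Fintype.card_units, Nat.cast_mul, Nat.cast_sub hq.le]
  have hq1 : (Fintype.card F : ℂ) - 1 ≠ 0 := sub_ne_zero.2 (by exact_mod_cast hq.ne')
  have hq0 : (Fintype.card F : ℂ) ≠ 0 := by exact_mod_cast (by omega : Fintype.card F ≠ 0)
  have hq2 : (Fintype.card F : ℂ) + 1 ≠ 0 := by exact_mod_cast (by omega : Fintype.card F + 1 ≠ 0)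
  generalize ∑ p, splitPart V p * splitPart V p⁻¹ = A at hnorm ⊢
  generalize ∑ z, nonsplitPart b V m z * nonsplitPart b V m z⁻¹ = B at hnorm ⊢
  generalize splitPart V (1, 1) = d at hd hnorm
  generalize V.character (upperTri 1 1 1) = e at hd hnorm hm
  generalize V.character 1 = D at hd hnorm hm
  generalize (Fintype.card F : ℂ) = q at *
  have he : e = d - m := mul_left_cancel₀ hq0 (by linear_combination -hm - hd)
  have hD : D = d + m * (q - 1) := by linear_combination hm + he
  subst he hD
  have h3 : q ^ 2 - 1 = (q - 1) * (q + 1) := by ring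
  have h4 : q ^ 2 - q = q * (q - 1) := by ring
  rw [h3, h4] at hnorm
  push_cast at hnorm ⊢
  field_simp at hnorm ⊢
  exact mul_left_cancel₀ hq0 (by linear_combination -hnorm)

open Additive in
/-- The values of an irreducible character of `GL₂(F)` on the two tori, in terms of characters
of these tori. -/
theorem exists_expansion : ∃ (m d : ℕ) (n : AddChar (Additive (Fˣ × Fˣ)) ℂ → ℕ)
    (c : AddChar (Additive Kˣ) ℂ → ℤ),
    V.character 1 = d + m * (Fintype.card F - 1) ∧ V.character (upperTri 1 1 1) = d - m ∧
    splitPart V (1, 1) = d ∧ (∀ p, splitPart V p = ∑ θ, n θ * θ (ofMul p)) ∧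
    (∀ z, nonsplitPart b V m z = ∑ θ, c θ * θ (ofMul z)) ∧
    ∑ θ, (n θ : ℤ) ^ 2 + ∑ θ, c θ ^ 2 = 2 := by
  obtain ⟨m, hm⟩ := exists_sub_eq_card_mul V
  choose n hn using exists_splitPart_coeff V
  choose c hc using exists_nonsplitPart_coeff b V m
  have hA : (Fintype.card (Fˣ × Fˣ) : ℂ) ≠ 0 := Nat.cast_ne_zero.2 Fintype.card_ne_zero
  have hK : (Fintype.card Kˣ : ℂ) ≠ 0 := Nat.cast_ne_zero.2 Fintype.card_ne_zero
  have hq0 : (Fintype.card F : ℂ) ≠ 0 := Nat.cast_ne_zero.2 Fintype.card_ne_zero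
  have hd : splitPart V (1, 1) = (∑ θ, n θ : ℕ) := by
    rw [eq_sum_of_sum_mul_char hn (1, 1)]
    push_cast
    refine Finset.sum_congr rfl fun θ _ => ?_
    have : ofMul ((1, 1) : Fˣ × Fˣ) = 0 := rfl
    rw [this, AddChar.map_zero_eq_one, mul_one]
  have hd' := splitPart_one_one V
  rw [hd] at hd'
  have he : V.character (upperTri 1 1 1) = (∑ θ, n θ : ℕ) - m :=
    mul_left_cancel₀ hq0 (by linear_combination -hm - hd')
  refine ⟨m, ∑ θ, n θ, n, c, by linear_combination hm + he, he, hd,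
    eq_sum_of_sum_mul_char hn, eq_sum_of_sum_mul_char hc, ?_⟩
  have h2 := two_eq_norm_add_norm b V hm
  rw [sum_mul_inv_eq hn, sum_mul_inv_eq hc, mul_div_cancel_left₀ _ hA,
    mul_div_cancel_left₀ _ hK] at h2
  exact_mod_cast h2.symm

end NormEquation

section SubfieldMembership

variable {L : Subfield ℂ} {x y r : ℂ}

theorem pow_add_neg_pow_mem (h : x ^ 2 ∈ L) (k : ℕ) : x ^ k + (-x) ^ k ∈ L := by
  rcases Nat.even_or_odd k with hk | hk
  · rw [hk.neg_pow]
    obtain ⟨j, rfl⟩ := hk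
    rw [← two_mul j, pow_mul]
    exact add_mem (pow_mem h j) (pow_mem h j)
  · rw [hk.neg_pow, add_neg_cancel]
    exact zero_mem L

theorem mem_of_sq_eq_sq (h : x ^ 2 = r ^ 2) (hr : r ∈ L) : x ∈ L := by
  rcases sq_eq_sq_iff_eq_or_eq_neg.1 h with rfl | rfl
  · exact hr
  · exact neg_mem hr

theorem mem_of_natCast_mul_mem {n : ℕ} (hn : n ≠ 0) (h : n * x ∈ L) : x ∈ L := by
  have hn' : (n : ℂ) ≠ 0 := Nat.cast_ne_zero.2 hn
  rw [← mul_div_cancel_left₀ x hn']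
  exact div_mem h (natCast_mem L n)

end SubfieldMembership

section Symmetry

open scoped Classical

variable {F K : Type} [Field F] [Fintype F] [Field K] [Fintype K] [Algebra F K]
  (b : Module.Basis (Fin 2) F K) (V : FDRep ℂ (GL (Fin 2) F)) [Simple V]

omit [Simple V] in
theorem splitPart_swap (a c : Fˣ) : splitPart V (a, c) = splitPart V (c, a) := by
  by_cases h : a = c
  · rw [h]
  · rw [splitPart_of_ne V h, splitPart_of_ne V (Ne.symm h), apply_diagonal V.char_conj h,
      apply_diagonal V.char_conj (Ne.symm h), add_comm, mul_comm]

theorem nonsplitPart_pow_card (m : ℕ) (z : Kˣ) :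
    nonsplitPart b V m (z ^ Fintype.card F) = nonsplitPart b V m z := by
  by_cases hz : z ∈ nonscalarUnits F K
  · have hz' : z ^ Fintype.card F ∈ nonscalarUnits F K := by
      rw [mem_nonscalarUnits] at hz ⊢
      rintro ⟨a, ha⟩
      refine hz ⟨a, ?_⟩
      rw [← pow_card_pow_card b (z : K), ← Units.val_pow_eq_pow_val, ← ha, ← map_pow,
        FiniteField.pow_card]
    rw [nonsplitPart_of_mem b V m hz, nonsplitPart_of_mem b V m hz',
      apply_torusHom b V.char_conj (mem_nonscalarUnits.1 hz),
      apply_torusHom b V.char_conj (mem_nonscalarUnits.1 hz'), traceNorm_pow_card b]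
  · obtain ⟨a, rfl⟩ := exists_scalarUnits_eq hz
    have : a ^ Fintype.card F = a :=
      Units.ext (by rw [Units.val_pow_eq_pow_val, FiniteField.pow_card])
    rw [← map_pow, this]

/-- If a subfield contains the values of the central character and of the two torus parts at
powers of generators, it contains all values of the character. -/
theorem character_mem {L : Subfield ℂ} {m d : ℕ} {w : Fˣ} {z : Kˣ}
    (hD : V.character 1 = d + m * (Fintype.card F - 1))
    (hJ : V.character (upperTri 1 1 1) = d - m) (hw : ∀ a, ∃ k : ℕ, a = w ^ k)
    (hz : ∀ y, ∃ k : ℕ, y = z ^ k) (hc : centralChar V w ∈ L)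
    (hs : ∀ s t : ℕ, splitPart V (w ^ s, w ^ t) ∈ L)
    (ht : ∀ k : ℕ, nonsplitPart b V m (z ^ k) ∈ L) (g : GL (Fin 2) F) : V.character g ∈ L := by
  have hc' : ∀ a, centralChar V a ∈ L := fun a => by
    obtain ⟨k, rfl⟩ := hw a
    rw [map_pow]
    exact pow_mem hc k
  refine forall_of_classes b (Q := fun g => V.character g ∈ L) (fun g h => by rw [V.char_conj])
    (fun a => ?_) (fun a => ?_) (fun a c hac => ?_) (fun y hy => ?_) g
  · rw [character_scalar, hD]
    exact mul_mem (hc' a) (add_mem (natCast_mem L d) (mul_mem (natCast_mem L m)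
      (sub_mem (natCast_mem L _) (one_mem L))))
  · rw [character_jordan V a one_ne_zero, hJ]
    exact mul_mem (hc' a) (sub_mem (natCast_mem L d) (natCast_mem L m))
  · obtain ⟨s, rfl⟩ := hw a
    obtain ⟨t, rfl⟩ := hw c
    rw [← splitPart_of_ne V (p := (w ^ s, w ^ t)) hac]
    exact hs s t
  · obtain ⟨k, rfl⟩ := hz y
    have := neg_mem (ht k)
    rwa [nonsplitPart_of_mem b V m (mem_nonscalarUnits.2 hy), neg_neg] at this

omit [Simple V] in
theorem exists_splitPart_mem {d : ℕ} (hd : splitPart V (1, 1) = d) (w : Fˣ) :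
    ∃ g, ∀ L : Subfield ℂ, V.character g ∈ L → splitPart V (w, 1) ∈ L := by
  by_cases h : w = 1
  · exact ⟨1, fun L _ => by rw [h, hd]; exact natCast_mem L d⟩
  · exact ⟨upperTri w 1 0, fun L hL => by rwa [splitPart_of_ne V (p := (w, 1)) h]⟩

omit [Fintype F] in
theorem centralChar_mem_of_character_mem {L : Subfield ℂ} {a : Fˣ}
    (h : V.character (upperTri a a 0) ∈ L) : centralChar V a ∈ L := by
  rw [character_scalar, FDRep.char_one, mul_comm] at h
  exact mem_of_natCast_mul_mem (fun h0 => finrank_ne_zero_of_simple V (by rw [h0]; simp)) h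

end Symmetry

section Cases

open scoped Classical

open Additive

theorem addChar_ofMul_pow {A : Type*} [CommGroup A] (θ : AddChar (Additive A) ℂ) (a : A) (k : ℕ) :
    θ (ofMul (a ^ k)) = θ (ofMul a) ^ k := by
  rw [ofMul_pow, AddChar.map_nsmul_eq_pow]

theorem addChar_ofMul_pow_prod {A : Type*} [CommGroup A] (θ : AddChar (Additive (A × A)) ℂ) (a : A)
    (s t : ℕ) : θ (ofMul (a ^ s, a ^ t)) = θ (ofMul (a, 1)) ^ s * θ (ofMul (1, a)) ^ t := by
  rw [← addChar_ofMul_pow, ← addChar_ofMul_pow, ← AddChar.map_add_eq_mul, ← ofMul_mul]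
  simp

variable {F K : Type} [Field F] [Fintype F] [Field K] [Fintype K] [Algebra F K]
  (b : Module.Basis (Fin 2) F K) (V : FDRep ℂ (GL (Fin 2) F)) [Simple V] {m d : ℕ} {w : Fˣ} {z : Kˣ}

/-- The cuspidal case. -/
theorem exists_character_mem_of_cuspidal
    (hD : V.character 1 = d + m * (Fintype.card F - 1))
    (hJ : V.character (upperTri 1 1 1) = d - m) (hw : ∀ a, ∃ k : ℕ, a = w ^ k)
    (hz : ∀ y, ∃ k : ℕ, y = z ^ k) (hzF : z ∈ nonscalarUnits F K)
    (hwz : scalarUnits F K w = z ^ (Fintype.card F + 1)) (hs : ∀ p, splitPart V p = 0)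
    {θ η : AddChar (Additive Kˣ) ℂ}
    (ht : ∀ y, nonsplitPart b V m y = θ (ofMul y) + η (ofMul y)) :
    ∃ g, ∀ L : ℕ, V.character g ∈ cycField L → ∀ h, V.character h ∈ cycField L := by
  set x := θ (ofMul z) with hx
  set y := η (ofMul z) with hy
  have hpow : ∀ k : ℕ, nonsplitPart b V m (z ^ k) = x ^ k + y ^ k := fun k => by
    rw [ht, addChar_ofMul_pow, addChar_ofMul_pow]
  have hx1 : ‖x‖ = 1 := AddChar.norm_apply _ _
  have hy1 : ‖y‖ = 1 := AddChar.norm_apply _ _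
  have h1 : (m * (Fintype.card F + 1) - V.character 1 : ℂ) = 2 := by
    have := nonsplitPart_scalar b V m 1
    rw [map_one, ← pow_zero z, hpow, map_one, one_mul] at this
    rw [← this]
    norm_num
  have h2 := nonsplitPart_scalar b V m w
  rw [hwz, hpow, h1] at h2
  obtain ⟨hxw, hyw⟩ := eq_of_add_eq_two_mul (by rw [norm_pow, hx1, one_pow])
    (by rw [norm_pow, hy1, one_pow]) (norm_hom_eq_one (centralChar V) w) (h2.trans (mul_comm _ _))
  by_cases h0 : x + y = 0
  · refine ⟨upperTri w w 0, fun L hL => ?_⟩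
    have hc := centralChar_mem_of_character_mem V hL
    have hyx : y = -x := by linear_combination h0
    have hx2 : x ^ 2 ∈ cycField L := by
      refine mem_of_sq_eq_sq (r := centralChar V w) ?_ hc
      have h3 := nonsplitPart_pow_card b V m (z ^ 2)
      rw [← pow_mul, hpow, hpow, hyx, Even.neg_pow (by simp), Even.neg_pow (by simp)] at h3
      rw [← hxw]
      linear_combination (-x ^ 2 / 2) * h3
    refine character_mem b V hD hJ hw hz hc (fun s t => by rw [hs]; exact zero_mem _) fun k => ?_
    rw [hpow, hyx]
    exact pow_add_neg_pow_mem hx2 k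
  · refine ⟨torusHom b z, fun L hL => ?_⟩
    have hxy : x + y ∈ cycField L := by
      rw [← neg_neg (V.character _), ← nonsplitPart_of_mem b V m hzF, ht] at hL
      exact neg_mem_iff.1 hL
    have hp := pow_add_pow_mem hxy (mul_mem_cycField_of_add_mem hx1 hy1 h0 hxy)
    refine character_mem b V hD hJ hw hz ?_ (fun s t => by rw [hs]; exact zero_mem _) fun k => ?_
    · refine mem_of_natCast_mul_mem two_ne_zero ?_
      rw [Nat.cast_ofNat, mul_comm, ← h2]
      exact hp _
    · rw [hpow]
      exact hp k

/-- The case of one-dimensional characters and twists of the Steinberg character. -/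
theorem exists_character_mem_of_linear
    (hD : V.character 1 = d + m * (Fintype.card F - 1))
    (hJ : V.character (upperTri 1 1 1) = d - m) (hw : ∀ a, ∃ k : ℕ, a = w ^ k)
    (hz : ∀ y, ∃ k : ℕ, y = z ^ k)
    (hwz : scalarUnits F K w = z ^ (Fintype.card F + 1)) (hd : splitPart V (1, 1) = d)
    {μ : AddChar (Additive (Fˣ × Fˣ)) ℂ} (hs : ∀ p, splitPart V p = μ (ofMul p))
    {θ : AddChar (Additive Kˣ) ℂ} {ε : ℤ} (hε : ε ≠ 0)
    (ht : ∀ y, nonsplitPart b V m y = ε * θ (ofMul y)) :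
    ∃ g, ∀ L : ℕ, V.character g ∈ cycField L → ∀ h, V.character h ∈ cycField L := by
  obtain ⟨g, hg⟩ := exists_splitPart_mem V hd w
  refine ⟨g, fun L hL => ?_⟩
  have hx := hg _ hL
  have hsw := splitPart_swap V w 1
  have hsc := splitPart_self V w
  have hone : splitPart V (1, 1) = 1 := by
    rw [hs]
    exact AddChar.map_zero_eq_one _
  have hpow : ∀ s t : ℕ, splitPart V (w ^ s, w ^ t) =
      splitPart V (w, 1) ^ s * splitPart V (1, w) ^ t := fun s t => by
    rw [hs, hs, hs, addChar_ofMul_pow_prod]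
  rw [hone, mul_one] at hsc
  have h11 := hpow 1 1
  rw [pow_one, pow_one, pow_one, hsc, ← hsw] at h11
  set x := splitPart V (w, 1)
  have hε' : (ε : ℂ) ≠ 0 := Int.cast_ne_zero.2 hε
  have hX : θ (ofMul z) ∈ cycField L := by
    refine mem_of_sq_eq_sq (r := x) ?_ hx
    have h1 := nonsplitPart_scalar b V m 1
    have h2 := nonsplitPart_scalar b V m w
    have h3 := nonsplitPart_pow_card b V m z
    rw [map_one, map_one, one_mul, ht, ofMul_one, AddChar.map_zero_eq_one] at h1
    rw [← h1, hwz, ht, addChar_ofMul_pow] at h2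
    rw [ht, ht, addChar_ofMul_pow] at h3
    replace h3 := mul_left_cancel₀ hε' h3
    refine mul_left_cancel₀ hε' ?_
    rw [pow_succ, h3] at h2
    linear_combination h2 + ε * h11
  refine character_mem b V hD hJ hw hz ?_ (fun s t => ?_) fun k => ?_
  · rw [h11]
    exact mul_mem hx hx
  · rw [hpow, ← hsw]
    exact mul_mem (pow_mem hx s) (pow_mem hx t)
  · rw [ht, addChar_ofMul_pow]
    exact mul_mem (intCast_mem _ ε) (pow_mem hX k)

/-- The principal series case. -/
theorem exists_character_mem_of_principal
    (hD : V.character 1 = d + m * (Fintype.card F - 1))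
    (hJ : V.character (upperTri 1 1 1) = d - m) (hw : ∀ a, ∃ k : ℕ, a = w ^ k)
    (hz : ∀ y, ∃ k : ℕ, y = z ^ k) (hd : splitPart V (1, 1) = d)
    {μ ν : AddChar (Additive (Fˣ × Fˣ)) ℂ}
    (hs : ∀ p, splitPart V p = μ (ofMul p) + ν (ofMul p))
    (ht : ∀ y, nonsplitPart b V m y = 0) :
    ∃ g, ∀ L : ℕ, V.character g ∈ cycField L → ∀ h, V.character h ∈ cycField L := by
  have hpow : ∀ s t : ℕ, splitPart V (w ^ s, w ^ t) =
      μ (ofMul (w, 1)) ^ s * μ (ofMul (1, w)) ^ t + ν (ofMul (w, 1)) ^ s * ν (ofMul (1, w)) ^ t :=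
    fun s t => by rw [hs, addChar_ofMul_pow_prod, addChar_ofMul_pow_prod]
  have hw1 : splitPart V (w, 1) = μ (ofMul (w, 1)) + ν (ofMul (w, 1)) := hs _
  set x := μ (ofMul (w, 1))
  set y := μ (ofMul (1, w))
  set x' := ν (ofMul (w, 1))
  set y' := ν (ofMul (1, w))
  have hx1 : ‖x‖ = 1 := AddChar.norm_apply _ _
  have hy1 : ‖y‖ = 1 := AddChar.norm_apply _ _
  have hx'1 : ‖x'‖ = 1 := AddChar.norm_apply _ _
  have hy'1 : ‖y'‖ = 1 := AddChar.norm_apply _ _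
  have hswap : ∀ s : ℕ, x ^ s + x' ^ s = y ^ s + y' ^ s := fun s => by
    have h := splitPart_swap V (w ^ s) (w ^ 0)
    rw [hpow, hpow] at h
    simpa using h
  have hsum := hswap 1
  simp only [pow_one] at hsum
  have htwo : splitPart V (1, 1) = 2 := by
    have := hpow 0 0
    simp only [pow_zero, mul_one] at this
    rw [this]
    norm_num
  have hself := splitPart_self V w
  have h11 := hpow 1 1
  simp only [pow_one] at h11
  rw [h11, htwo, mul_comm _ (2 : ℂ)] at hself
  obtain ⟨hxy, hxy'⟩ := eq_of_add_eq_two_mul (by rw [norm_mul, hx1, hy1, one_mul])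
    (by rw [norm_mul, hx'1, hy'1, one_mul]) (norm_hom_eq_one (centralChar V) w) hself
  by_cases h0 : x + x' = 0
  · refine ⟨upperTri w w 0, fun L hL => ?_⟩
    have hc := centralChar_mem_of_character_mem V hL
    refine character_mem b V hD hJ hw hz hc (fun s t => ?_) fun k => by
      rw [ht]
      exact zero_mem _
    have ex : x' = -x := by linear_combination h0
    have ey : y' = -y := by linear_combination h0 - hsum
    have hsq : x ^ 2 = y ^ 2 := by
      have := hswap 2
      rw [ex, ey] at this
      linear_combination this / 2
    have hx2 : x ^ 2 ∈ cycField L := by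
      refine mem_of_sq_eq_sq (r := centralChar V w) ?_ hc
      rw [← hxy]
      linear_combination x ^ 2 * hsq
    have hmem := pow_add_neg_pow_mem hx2 (s + t)
    rw [hpow, ex, ey]
    rcases sq_eq_sq_iff_eq_or_eq_neg.1 hsq.symm with h | h
    · rw [h, ← pow_add, ← pow_add]
      exact hmem
    · rw [h, neg_neg]
      have : x ^ s * (-x) ^ t + (-x) ^ s * x ^ t = (-1) ^ t * (x ^ (s + t) + (-x) ^ (s + t)) := by
        rw [neg_pow x t, neg_pow x s, neg_pow x (s + t), pow_add, pow_add]
        have h1 : ((-1 : ℂ) ^ t) * (-1) ^ t = 1 := by rw [← mul_pow]; simp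
        linear_combination -(-1) ^ s * x ^ s * x ^ t * h1
      rw [this]
      exact mul_mem (pow_mem (neg_mem (one_mem _)) t) hmem
  · have hyx : y = x' ∧ y' = x := by
      rcases pair_eq_of_add_eq hx1 hx'1 hy1 hy'1 hsum h0 with ⟨h1, h2⟩ | ⟨h1, h2⟩
      · have : x ^ 2 = x' ^ 2 := by
          rw [sq, sq]
          nth_rw 2 [h1]
          nth_rw 2 [h2]
          rw [hxy, hxy']
        rcases sq_eq_sq_iff_eq_or_eq_neg.1 this with h | h
        · exact ⟨h1.symm.trans h, h2.symm.trans h.symm⟩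
        · exact absurd (by linear_combination h) h0
      · exact ⟨h2.symm, h1.symm⟩
    rw [hyx.1] at hxy
    obtain ⟨g, hg⟩ := exists_splitPart_mem V hd w
    refine ⟨g, fun L hL => ?_⟩
    have hx := hg _ hL
    rw [hw1] at hx
    have hp := mul_mem_cycField_of_add_mem hx1 hx'1 h0 hx
    refine character_mem b V hD hJ hw hz (hxy ▸ hp) (fun s t => ?_) fun k => by
      rw [ht]
      exact zero_mem _
    rw [hpow, hyx.1, hyx.2]
    exact pow_mul_pow_add_mem hx hp s t

include b in
theorem exists_character_mem :
    ∃ g, ∀ L : ℕ, V.character g ∈ cycField L → ∀ h, V.character h ∈ cycField L := by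
  obtain ⟨m, d, n, c, hD, hJ, hd, hs, ht, hsum⟩ := exists_expansion b V
  obtain ⟨z, hz⟩ := IsCyclic.exists_monoid_generator (α := Kˣ)
  replace hz : ∀ y, ∃ k : ℕ, y = z ^ k := fun y => by
    obtain ⟨k, hk⟩ := Submonoid.mem_powers_iff _ _ |>.1 (hz y)
    exact ⟨k, hk.symm⟩
  have hw : ∀ a : Fˣ, ∃ k : ℕ, a = Units.map (Algebra.norm F (S := K)) z ^ k := fun a => by
    obtain ⟨y, rfl⟩ := FiniteField.unitsMap_norm_surjective F K a
    obtain ⟨k, rfl⟩ := hz y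
    exact ⟨k, map_pow _ _ _⟩
  set w := Units.map (Algebra.norm F (S := K)) z
  have hwz : scalarUnits F K w = z ^ (Fintype.card F + 1) := by
    refine Units.ext ((algebraMap_norm_eq_mul_pow b (z : K)).trans ?_)
    rw [Units.val_pow_eq_pow_val, pow_succ, mul_comm]
  have hzF : z ∈ nonscalarUnits F K := by
    by_contra h
    obtain ⟨a, rfl⟩ := exists_scalarUnits_eq h
    have hsurj : Function.Surjective (scalarUnits F K) := fun y => by
      obtain ⟨k, rfl⟩ := hz y
      exact ⟨a ^ k, map_pow _ _ _⟩
    have hle := Fintype.card_le_of_surjective _ hsurj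
    have hq : 1 < Fintype.card F := Fintype.one_lt_card
    rw [Fintype.card_units, Fintype.card_units, card_eq_sq_of_basis b] at hle
    have : Fintype.card F < Fintype.card F ^ 2 := lt_self_pow₀ hq one_lt_two
    omega
  have hn0 : 0 ≤ ∑ θ, (n θ : ℤ) ^ 2 := Finset.sum_nonneg fun _ _ => sq_nonneg _
  have hc0 : 0 ≤ ∑ θ, c θ ^ 2 := Finset.sum_nonneg fun _ _ => sq_nonneg _
  have hcases : ∑ θ, (n θ : ℤ) ^ 2 = 0 ∧ ∑ θ, c θ ^ 2 = 2 ∨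
      ∑ θ, (n θ : ℤ) ^ 2 = 1 ∧ ∑ θ, c θ ^ 2 = 1 ∨
      ∑ θ, (n θ : ℤ) ^ 2 = 2 ∧ ∑ θ, c θ ^ 2 = 0 := by omega
  have hn1 : ∀ θ, ((n θ : ℤ) = 1 ∨ (n θ : ℤ) = -1) → n θ = 1 := fun θ h => by omega
  rcases hcases with ⟨hN, hC⟩ | ⟨hN, hC⟩ | ⟨hN, hC⟩
  · have hn : ∀ θ, n θ = 0 := fun θ => by
      simpa using (Finset.sum_eq_zero_iff_of_nonneg fun _ _ => sq_nonneg _).1 hN θ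
        (Finset.mem_univ θ)
    replace hs : ∀ p, splitPart V p = 0 := fun p => by
      rw [hs]
      simp [hn]
    have hd0 : (d : ℂ) = 0 := by rw [← hd, hs]
    obtain ⟨θ, η, hne, hθ, hη, hother⟩ := exists_units_of_sum_sq_eq_two hC
    replace ht : ∀ y, nonsplitPart b V m y = c θ * θ (ofMul y) + c η * η (ofMul y) := fun y => by
      rw [ht, Fintype.sum_eq_add θ η hne]
      rintro κ ⟨h1, h2⟩
      rw [hother κ h1 h2, Int.cast_zero, zero_mul]
    have hm : (2 * m : ℤ) = c θ + c η := by
      have h1 := nonsplitPart_scalar b V m 1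
      rw [map_one, map_one, ht, ofMul_one, AddChar.map_zero_eq_one, AddChar.map_zero_eq_one, hD,
        hd0] at h1
      have h2 : (2 * m : ℂ) = c θ + c η := by linear_combination -h1
      exact_mod_cast h2
    have hm0 : m ≠ 0 := by
      rintro rfl
      apply finrank_ne_zero_of_simple V
      rw [← FDRep.char_one, hD, hd0]
      simp
    have h1 : c θ = 1 := by omega
    have h2 : c η = 1 := by omega
    refine exists_character_mem_of_cuspidal b V hD hJ hw hz hzF hwz hs (θ := θ) (η := η)
      fun y => ?_
    rw [ht, h1, h2, Int.cast_one, one_mul, one_mul]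
  · obtain ⟨μ, hμ, hμ'⟩ := exists_unit_of_sum_sq_eq_one hN
    obtain ⟨θ, hθ, hθ'⟩ := exists_unit_of_sum_sq_eq_one hC
    refine exists_character_mem_of_linear b V hD hJ hw hz hwz hd (μ := μ) (θ := θ) (ε := c θ)
      (fun p => ?_) (by omega) fun y => ?_
    · rw [hs, Fintype.sum_eq_single μ, hn1 μ hμ, Nat.cast_one, one_mul]
      intro κ hκ
      have : n κ = 0 := by exact_mod_cast hμ' κ hκ
      rw [this, Nat.cast_zero, zero_mul]
    · rw [ht, Fintype.sum_eq_single θ]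
      intro κ hκ
      rw [hθ' κ hκ, Int.cast_zero, zero_mul]
  · obtain ⟨μ, ν, hne, hμ, hν, hother⟩ := exists_units_of_sum_sq_eq_two hN
    have hc : ∀ θ, c θ = 0 := fun θ => by
      simpa using (Finset.sum_eq_zero_iff_of_nonneg fun _ _ => sq_nonneg _).1 hC θ
        (Finset.mem_univ θ)
    refine exists_character_mem_of_principal b V hD hJ hw hz hd (μ := μ) (ν := ν) (fun p => ?_)
      fun y => ?_
    · rw [hs, Fintype.sum_eq_add μ ν hne, hn1 μ hμ, hn1 ν hν, Nat.cast_one, one_mul, one_mul]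
      rintro κ ⟨h1, h2⟩
      have : n κ = 0 := by exact_mod_cast hother κ h1 h2
      rw [this, Nat.cast_zero, zero_mul]
    · rw [ht]
      simp [hc]

end Cases

/-- For `G = GL₂(F_q)` with `q` a prime power and `χ` an irreducible complex character of `G`,
there exists `g ∈ G` with `c(χ) = c(χ(g))`. -/
theorem conductor_one_value_GL2 (q : ℕ) (hq : IsPrimePow q)
    (F : Type) [Field F] [Fintype F] (hF : Fintype.card F = q)
    (V : FDRep ℂ (GL (Fin 2) F)) (hV : Simple V) :
    ∃ g : GL (Fin 2) F,
      conductorOf (Set.range V.character) = conductorOf {V.character g} := by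
  have : Fact (ringChar F).Prime := ⟨CharP.char_is_prime F _⟩
  have : CharP F (ringChar F) := ringChar.charP F
  let K := FiniteField.Extension F (ringChar F) 2
  have : Finite K := Module.finite_of_finite F
  have := Fintype.ofFinite K
  have b : Module.Basis (Fin 2) F K :=
    Module.finBasisOfFinrankEq F K (FiniteField.finrank_extension F (ringChar F) 2)
  obtain ⟨g, hg⟩ := exists_character_mem b V
  exact ⟨g, conductorOf_range_eq g hg⟩
end

section
/- Let G = SL₂(F_q) be the special linear group of 2×2 matrices of determinant 1 over the finite field with q elements, where q is a prime power, and let χ be a complex irreducible character of G. Then there exists an element g ∈ G such that c(χ) = c(χ(g)). -/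
open CategoryTheory

section Fourier

variable {A : Type*} [AddCommGroup A] [Fintype A]

/-- Fourier inversion on a finite abelian group. -/
lemma eq_sum_fourierCoeff (f : A → ℂ) (c : AddChar A ℂ → ℂ)
    (hc : ∀ θ, c θ * Fintype.card A = ∑ a, f a * θ (-a)) (a : A) :
    f a = ∑ θ, c θ * θ a := by
  classical
  have hA : (Fintype.card A : ℂ) ≠ 0 := by simp
  apply mul_right_cancel₀ hA
  calc f a * Fintype.card A = ∑ b, f b * ∑ θ : AddChar A ℂ, θ (a - b) := by
        simp [AddChar.sum_apply_eq_ite, sub_eq_zero]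
    _ = ∑ θ : AddChar A ℂ, (∑ b, f b * θ (-b)) * θ a := by
        simp_rw [Finset.mul_sum, Finset.sum_mul]
        rw [Finset.sum_comm]
        refine Finset.sum_congr rfl fun θ _ => Finset.sum_congr rfl fun b _ => ?_
        rw [sub_eq_add_neg, AddChar.map_add_eq_mul]
        ring
    _ = (∑ θ, c θ * θ a) * Fintype.card A := by
        rw [Finset.sum_mul]
        refine Finset.sum_congr rfl fun θ _ => ?_
        rw [← hc]
        ring

/-- Parseval's identity on a finite abelian group. -/
lemma sum_mul_neg_eq_sum_fourierCoeff_sq (f : A → ℂ) (c : AddChar A ℂ → ℂ)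
    (hc : ∀ θ, c θ * Fintype.card A = ∑ a, f a * θ (-a)) :
    ∑ a, f a * f (-a) = Fintype.card A * ∑ θ, c θ ^ 2 := by
  calc ∑ a, f a * f (-a) = ∑ a, f a * ∑ θ, c θ * θ (-a) := by
        simp_rw [← eq_sum_fourierCoeff f c hc]
    _ = ∑ θ, c θ * ∑ a, f a * θ (-a) := by
        simp_rw [Finset.mul_sum]
        rw [Finset.sum_comm]
        exact Finset.sum_congr rfl fun θ _ => Finset.sum_congr rfl fun b _ => by ring
    _ = _ := by
        rw [Finset.mul_sum]
        refine Finset.sum_congr rfl fun θ _ => ?_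
        rw [← hc]
        ring

/-- The Fourier coefficients of an even function are even. -/
lemma fourierCoeff_inv (f : A → ℂ) (hf : ∀ a, f (-a) = f a) (c : AddChar A ℂ → ℤ)
    (hc : ∀ θ, (c θ : ℂ) * Fintype.card A = ∑ a, f a * θ (-a)) (θ : AddChar A ℂ) :
    c θ⁻¹ = c θ := by
  have hA : (Fintype.card A : ℂ) ≠ 0 := by simp
  have : (c θ⁻¹ : ℂ) = c θ := by
    apply mul_right_cancel₀ hA
    rw [hc, hc, ← Equiv.sum_comp (Equiv.neg A)]
    simp [hf, AddChar.inv_apply]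
  exact_mod_cast this

lemma Subfield.pow_add_inv_pow_mem (K : Subfield ℂ) {z : ℂ} (hz : z ≠ 0)
    (h : z + z⁻¹ ∈ K) (k : ℕ) : z ^ k + z⁻¹ ^ k ∈ K := by
  induction k using Nat.twoStepInduction with
  | zero => simpa using K.add_mem K.one_mem K.one_mem
  | one => simpa using h
  | more k ih0 ih1 =>
    have : z ^ (k + 2) + z⁻¹ ^ (k + 2)
        = (z + z⁻¹) * (z ^ (k + 1) + z⁻¹ ^ (k + 1)) - (z ^ k + z⁻¹ ^ k) := by
      have e : z * z⁻¹ = 1 := mul_inv_cancel₀ hz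
      linear_combination (-(z ^ k) - z⁻¹ ^ k) * e
    rw [this]
    exact K.sub_mem (K.mul_mem h ih1) ih0

/-- An even integral combination of characters of norm at most two either takes integer
values or is `±(θ + θ⁻¹)` for some character `θ`. -/
lemma evenCharSum_cases (c : AddChar A ℂ → ℤ) (hs : ∀ θ, c θ⁻¹ = c θ)
    (h : ∑ θ, c θ ^ 2 ≤ 2) :
    (∀ a, ∃ m : ℤ, ∑ θ, (c θ : ℂ) * θ a = m) ∨
    (2 ≤ ∑ θ, c θ ^ 2 ∧ ∃ θ : AddChar A ℂ, ∃ k : ℤ, k ^ 2 = 1 ∧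
      ∀ a, ∑ η, (c η : ℂ) * η a = k * (θ a + (θ a)⁻¹)) := by
  classical
  by_cases H : ∀ θ, c θ ≠ 0 → θ⁻¹ = θ
  · left
    intro a
    have : ∀ θ, ∃ m : ℤ, (c θ : ℂ) * θ a = m := by
      intro θ
      by_cases h0 : c θ = 0
      · exact ⟨0, by simp [h0]⟩
      · have h1 : θ a * θ a = 1 := by
          conv_lhs => rw [← H θ h0]
          conv_lhs => arg 2; rw [H θ h0]
          rw [AddChar.inv_apply, ← AddChar.map_add_eq_mul]; simp
        rcases mul_self_eq_one_iff.mp h1 with h2 | h2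
        · exact ⟨c θ, by simp [h2]⟩
        · exact ⟨-c θ, by simp [h2]⟩
    choose m hm using this
    exact ⟨∑ θ, m θ, by simp [hm]⟩
  · right
    push Not at H
    obtain ⟨θ, h0, hne⟩ := H
    have hpos : 1 ≤ c θ ^ 2 := by
      have := sq_nonneg (c θ)
      have : c θ ^ 2 ≠ 0 := pow_ne_zero 2 h0
      omega
    have key : ∀ S : Finset (AddChar A ℂ), ∑ η ∈ S, c η ^ 2 ≤ ∑ η, c η ^ 2 := fun S =>
      Finset.sum_le_univ_sum_of_nonneg fun η => sq_nonneg (c η)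
    have hpair := key {θ⁻¹, θ}
    rw [Finset.sum_pair hne, hs] at hpair
    have hz : ∀ η, η ≠ θ → η ≠ θ⁻¹ → c η = 0 := by
      intro η h1 h2
      have := key {η, θ⁻¹, θ}
      rw [Finset.sum_insert (by simp [h1, h2]), Finset.sum_pair hne, hs] at this
      have h3 := sq_nonneg (c η)
      exact pow_eq_zero_iff two_ne_zero |>.mp (by omega : c η ^ 2 = 0)
    refine ⟨by omega, θ, c θ, by omega, fun a => ?_⟩
    rw [← Finset.sum_subset (Finset.subset_univ {θ⁻¹, θ}), Finset.sum_pair hne, hs,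
      AddChar.inv_apply, AddChar.map_neg_eq_inv]
    · ring
    · intro η _ hη
      simp only [Finset.mem_insert, Finset.mem_singleton, not_or] at hη
      simp [hz η hη.2 hη.1]

lemma evenCharSum_mem_of_le_one (c : AddChar A ℂ → ℤ) (hs : ∀ θ, c θ⁻¹ = c θ)
    (h : ∑ θ, c θ ^ 2 ≤ 1) (K : Subfield ℂ) (a : A) : ∑ θ, (c θ : ℂ) * θ a ∈ K := by
  rcases evenCharSum_cases c hs (by omega) with h1 | ⟨h1, -⟩
  · obtain ⟨m, hm⟩ := h1 a
    rw [hm]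
    exact intCast_mem K m
  · omega

/-- An even integral combination of characters of norm at most two on a cyclic group has its
field of values generated by a single value. -/
lemma evenCharSum_exists_generator [IsAddCyclic A] (c : AddChar A ℂ → ℤ)
    (hs : ∀ θ, c θ⁻¹ = c θ) (h : ∑ θ, c θ ^ 2 ≤ 2) :
    ∃ a₀ : A, ∀ K : Subfield ℂ, ∑ θ, (c θ : ℂ) * θ a₀ ∈ K →
      ∀ a, ∑ θ, (c θ : ℂ) * θ a ∈ K := by
  obtain ⟨a₀, ha₀⟩ := IsAddCyclic.exists_generator (α := A)
  refine ⟨a₀, fun K hK a => ?_⟩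
  rcases evenCharSum_cases c hs h with h1 | ⟨-, θ, k, hk, h1⟩
  · obtain ⟨m, hm⟩ := h1 a
    rw [hm]
    exact intCast_mem K m
  · obtain ⟨n, rfl⟩ := mem_multiples_iff_mem_zmultiples.mpr (ha₀ a)
    rw [h1] at hK ⊢
    have hmem : θ a₀ + (θ a₀)⁻¹ ∈ K := by
      have := K.mul_mem (intCast_mem K k) hK
      rwa [← mul_assoc, ← Int.cast_mul, ← pow_two, hk, Int.cast_one, one_mul] at this
    have hne : θ a₀ ≠ 0 := fun h0 => by
      have := AddChar.map_add_eq_mul θ a₀ (-a₀)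
      simp [h0] at this
    simp only [AddChar.map_nsmul_eq_pow, ← inv_pow]
    exact K.mul_mem (intCast_mem K k) (K.pow_add_inv_pow_mem hne hmem n)

end Fourier

section Multiplicity

universe u
variable {G : Type u} [Group G]

/-- The multiplicity of a linear character in a restricted representation is a natural
number. -/
lemma exists_sum_mul_character_eq (V : FDRep ℂ G) {H : Type*} [Group H] [Fintype H]
    (φ : H →* G) (l : H →* ℂ) :
    ∃ n : ℕ, (n : ℂ) * Fintype.card H = ∑ h, V.character (φ h) * l h := by
  let ρ : Representation ℂ H V :=
    { toFun := fun h => l h • V.ρ (φ h)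
      map_one' := by simp
      map_mul' := fun x y => by
        simp only [map_mul, smul_mul_smul_comm] }
  have hc : (Nat.card H : ℂ) ≠ 0 := by simp
  let : Invertible (Nat.card H : ℂ) := invertibleOfNonzero hc
  have := ρ.card_inv_mul_sum_char_eq_finrank
  refine ⟨Module.finrank ℂ ρ.invariants, ?_⟩
  rw [← this, Fintype.card_eq_nat_card, mul_comm, mul_inv_cancel_left₀ hc]
  refine Finset.sum_congr rfl fun h _ => ?_
  change LinearMap.trace ℂ V (l h • V.ρ (φ h)) = LinearMap.trace ℂ V (V.ρ (φ h)) * l h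
  rw [map_smul, smul_eq_mul, mul_comm]

/-- Central elements act by scalars on an irreducible representation. -/
lemma exists_character_mul_central (V : FDRep ℂ G) [Simple V] (z : G)
    (hz : ∀ g, z * g = g * z) (hz2 : z * z = 1) :
    ∃ ε : ℂ, ε ^ 2 = 1 ∧ ∀ g, V.character (z * g) = ε * V.character g := by
  have hfr : Module.finrank ℂ (Representation.linHom V.ρ V.ρ).invariants = 1 := by
    rw [(Representation.linHom.invariantsEquivFDRepHom V V).finrank_eq,
      FDRep.finrank_hom_simple_simple, if_pos ⟨Iso.refl V⟩]
  have hmem : ∀ y : G, (∀ g, y * g = g * y) →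
      V.ρ y ∈ (Representation.linHom V.ρ V.ρ).invariants := by
    intro y hy g
    rw [Representation.linHom_apply, ← Module.End.mul_eq_comp, ← Module.End.mul_eq_comp,
      ← map_mul, ← map_mul, hy, mul_inv_cancel_left]
  have hone := hmem 1 (by simp)
  have hV : V.ρ (1 : G) ≠ 0 := by
    intro h0
    rw [map_one] at h0
    have : Subsingleton (V →ₗ[ℂ] V) := subsingleton_of_zero_eq_one (M₀ := Module.End ℂ V) h0.symm
    rw [Module.finrank_zero_of_subsingleton] at hfr
    exact zero_ne_one hfr
  obtain ⟨ε, hε⟩ := (finrank_eq_one_iff_of_nonzero' (⟨V.ρ 1, hone⟩ :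
    (Representation.linHom V.ρ V.ρ).invariants) (by simpa [Subtype.ext_iff] using hV)).mp hfr
    ⟨V.ρ z, hmem z hz⟩
  have hε' : V.ρ z = ε • (1 : V →ₗ[ℂ] V) := by
    have := congrArg Subtype.val hε
    simpa using this.symm
  refine ⟨ε, ?_, fun g => ?_⟩
  · have h1 : (ε ^ 2) • (V.ρ (1 : G)) = (1 : ℂ) • V.ρ (1 : G) := by
      rw [one_smul]
      nth_rw 2 [← hz2]
      rw [map_mul, hε', map_one, smul_mul_smul_comm, one_mul, pow_two]
    exact smul_left_injective ℂ hV h1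
  · simp only [FDRep.character]
    rw [map_mul, hε', smul_mul_assoc, one_mul, map_smul, smul_eq_mul]

end Multiplicity

section Cyclic

variable {C : Type*} [Group C] [IsCyclic C] [Fintype C]

/-- An even function on a finite cyclic group with integral Fourier coefficients has an integral
norm. If the norm is at most one its values are rational, and if it is at most two its field of
values is generated by a single value. -/
lemma exists_norm_of_even_of_integral (f : C → ℂ) (hf : ∀ a, f a⁻¹ = f a)
    (hc : ∃ c : AddChar (Additive C) ℂ → ℤ, ∀ θ, (c θ : ℂ) * Fintype.card (Additive C) =
      ∑ a : Additive C, f a.toMul * θ (-a)) :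
    ∃ N : ℤ, 0 ≤ N ∧ ∑ a, f a * f a⁻¹ = Fintype.card C * N ∧
      (N ≤ 1 → ∀ K : Subfield ℂ, ∀ a, f a ∈ K) ∧
      (N ≤ 2 → ∃ a₀, ∀ K : Subfield ℂ, f a₀ ∈ K → ∀ a, f a ∈ K) := by
  let _ : CommGroup C := IsCyclic.commGroup
  obtain ⟨c, hc⟩ := hc
  have hs := fourierCoeff_inv (fun a : Additive C => f a.toMul) (fun a => hf a.toMul) c hc
  have hinv : ∀ a : C, f a = ∑ θ, (c θ : ℂ) * θ (Additive.ofMul a) := fun a =>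
    eq_sum_fourierCoeff (fun a : Additive C => f a.toMul) (fun θ => c θ) hc (Additive.ofMul a)
  refine ⟨∑ θ, c θ ^ 2, Finset.sum_nonneg fun θ _ => sq_nonneg _, ?_, fun h K a => ?_, fun h => ?_⟩
  · push_cast
    rw [← Fintype.card_additive, ← sum_mul_neg_eq_sum_fourierCoeff_sq
      (fun a : Additive C => f a.toMul) (fun θ => c θ) hc]
    exact Fintype.sum_equiv Additive.ofMul _ _ fun a => rfl
  · rw [hinv]
    exact evenCharSum_mem_of_le_one c hs h K _
  · obtain ⟨a₀, h₀⟩ := evenCharSum_exists_generator c hs h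
    refine ⟨a₀.toMul, fun K hK a => ?_⟩
    rw [hinv] at hK ⊢
    exact h₀ K hK _

end Cyclic

section ConjCount

variable {G : Type*} [Group G] [Fintype G]

open scoped Classical in
/-- The number of `x` conjugating `g` into `S`. -/
noncomputable def conjCount (S : Finset G) (g : G) : ℕ :=
  (Finset.univ.filter fun x => x⁻¹ * g * x ∈ S).card

lemma sum_mul_conjCount (S : Finset G) (f : G → ℂ) (hf : ∀ g x, f (x * g * x⁻¹) = f g) :
    ∑ g, f g * conjCount S g = Fintype.card G * ∑ s ∈ S, f s := by
  classical
  calc ∑ g, f g * conjCount S g = ∑ g, ∑ x, if x⁻¹ * g * x ∈ S then f g else 0 := by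
        refine Finset.sum_congr rfl fun g _ => ?_
        rw [conjCount, Finset.card_filter, Nat.cast_sum, Finset.mul_sum]
        refine Finset.sum_congr rfl fun x _ => ?_
        split_ifs <;> simp
    _ = ∑ _x : G, ∑ s, if s ∈ S then f s else 0 := by
        rw [Finset.sum_comm]
        refine Finset.sum_congr rfl fun x _ => ?_
        rw [← Equiv.sum_comp (MulAut.conj x).toEquiv]
        refine Finset.sum_congr rfl fun s _ => ?_
        have h1 : x⁻¹ * (x * s * x⁻¹) * x = s := by group
        simp [h1, hf]
    _ = _ := by simp

lemma exists_of_conjCount_ne_zero {S : Finset G} {g : G} (h : conjCount S g ≠ 0) :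
    ∃ x s, s ∈ S ∧ g = x * s * x⁻¹ := by
  obtain ⟨x, hx⟩ := Finset.card_ne_zero.mp h
  exact ⟨x, x⁻¹ * g * x, by simpa using hx, by group⟩

lemma conjCount_conj (S : Finset G) (g x : G) : conjCount S (x * g * x⁻¹) = conjCount S g := by
  classical
  refine Finset.card_bij' (fun y _ => x⁻¹ * y) (fun y _ => x * y) ?_ ?_ ?_ ?_ <;>
    simp [mul_assoc]

lemma conjCount_le {S : Finset G} {N : ℕ} (h : ∀ s ∈ S, conjCount S s ≤ N) (g : G) :
    conjCount S g ≤ N := by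
  by_cases h0 : conjCount S g = 0
  · omega
  · obtain ⟨x, s, hs, rfl⟩ := exists_of_conjCount_ne_zero h0
    rw [conjCount_conj]
    exact h s hs

lemma conjCount_le_card (S : Finset G) (g : G) : conjCount S g ≤ Fintype.card G := by
  classical
  exact Finset.card_le_univ _

end ConjCount

namespace SL2

open Matrix
open scoped MatrixGroups

variable {F : Type*} [Field F]

lemma mul_entry (g h : SL(2, F)) (i j : Fin 2) :
    (g * h) i j = g i 0 * h 0 j + g i 1 * h 1 j := by
  change (g.1 * h.1) i j = _
  rw [Matrix.mul_apply, Fin.sum_univ_two]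

lemma inv_entries (g : SL(2, F)) :
    g⁻¹ 0 0 = g 1 1 ∧ g⁻¹ 0 1 = -g 0 1 ∧ g⁻¹ 1 0 = -g 1 0 ∧ g⁻¹ 1 1 = g 0 0 := by
  rw [SpecialLinearGroup.SL2_inv_expl]
  exact ⟨rfl, rfl, rfl, rfl⟩

lemma det_entries (g : SL(2, F)) : g 0 0 * g 1 1 - g 0 1 * g 1 0 = 1 := by
  rw [← det_fin_two]
  exact g.det_coe

lemma ext_entries {g h : SL(2, F)} (h00 : g 0 0 = h 0 0) (h01 : g 0 1 = h 0 1)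
    (h10 : g 1 0 = h 1 0) (h11 : g 1 1 = h 1 1) : g = h := by
  ext i j
  fin_cases i <;> fin_cases j <;> assumption

/-- The upper unitriangular matrix with off-diagonal entry `x`. -/
def uni (x : F) : SL(2, F) := ⟨!![1, x; 0, 1], by simp⟩

lemma uni_entries (x : F) : uni x 0 0 = 1 ∧ uni x 0 1 = x ∧ uni x 1 0 = 0 ∧ uni x 1 1 = 1 :=
  ⟨rfl, rfl, rfl, rfl⟩

/-- The diagonal matrix with entries `a` and `a⁻¹`. -/
def diag (a : Fˣ) : SL(2, F) := ⟨!![(a : F), 0; 0, ((a⁻¹ : Fˣ) : F)], by simp⟩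

lemma diag_entries (a : Fˣ) : diag a 0 0 = a ∧ diag a 0 1 = 0 ∧ diag a 1 0 = 0 ∧
    diag a 1 1 = ((a⁻¹ : Fˣ) : F) :=
  ⟨rfl, rfl, rfl, rfl⟩

/-- A Weyl element. -/
def weyl : SL(2, F) := ⟨!![0, 1; -1, 0], by simp⟩

lemma weyl_entries : (weyl : SL(2, F)) 0 0 = 0 ∧ (weyl : SL(2, F)) 0 1 = 1 ∧
    (weyl : SL(2, F)) 1 0 = -1 ∧ (weyl : SL(2, F)) 1 1 = 0 :=
  ⟨rfl, rfl, rfl, rfl⟩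

lemma one_entries : (1 : SL(2, F)) 0 0 = 1 ∧ (1 : SL(2, F)) 0 1 = 0 ∧
    (1 : SL(2, F)) 1 0 = 0 ∧ (1 : SL(2, F)) 1 1 = 1 :=
  ⟨rfl, rfl, rfl, rfl⟩

lemma neg_entry (g : SL(2, F)) (i j : Fin 2) : (-g) i j = -g i j := rfl

lemma uni_add (x y : F) : uni (x + y) = uni x * uni y := by
  apply ext_entries <;> simp [mul_entry, uni_entries, add_comm]

/-- `uni` as a homomorphism. -/
def uniHom : Multiplicative F →* SL(2, F) where
  toFun x := uni x.toAdd
  map_one' := by apply ext_entries <;> simp [uni_entries]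
  map_mul' x y := uni_add _ _

lemma diag_mul_uni_mul_inv (b : Fˣ) (x : F) :
    diag b * uni x * (diag b)⁻¹ = uni ((b : F) ^ 2 * x) := by
  apply ext_entries <;> simp [mul_entry, uni_entries, diag_entries, inv_entries]
  ring

lemma uni_zero : uni (0 : F) = 1 := by
  apply ext_entries <;> simp [uni_entries]

lemma uni_inv (x : F) : (uni x)⁻¹ = uni (-x) := by
  rw [inv_eq_iff_mul_eq_one, ← uni_add, add_neg_cancel, uni_zero]

/-- `a` is an eigenvalue of `g`. -/
def IsEigen (g : SL(2, F)) (a : F) : Prop := a ^ 2 - (g 0 0 + g 1 1) * a + 1 = 0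

lemma trace_conj (g x : SL(2, F)) :
    (x * g * x⁻¹) 0 0 + (x * g * x⁻¹) 1 1 = g 0 0 + g 1 1 := by
  have hd := det_entries x
  obtain ⟨h1, h2, h3, h4⟩ := inv_entries x
  simp only [mul_entry, h1, h2, h3, h4]
  linear_combination (g 0 0 + g 1 1) * hd

lemma isEigen_conj (g x : SL(2, F)) (a : F) : IsEigen (x * g * x⁻¹) a ↔ IsEigen g a := by
  unfold IsEigen
  rw [trace_conj]

/-- `g` is `1` or `-1`. -/
def IsSign (g : SL(2, F)) : Prop := g = 1 ∨ g = -1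

lemma isSign_conj (g x : SL(2, F)) : IsSign (x * g * x⁻¹) ↔ IsSign g := by
  unfold IsSign
  rw [conj_eq_one_iff, mul_inv_eq_iff_eq_mul, neg_one_mul, ← mul_neg_one, mul_right_inj]

lemma isSign_iff (g : SL(2, F)) : IsSign g ↔ g 0 1 = 0 ∧ g 1 0 = 0 ∧ g 0 0 = g 1 1 := by
  have hd := det_entries g
  constructor
  · rintro (rfl | rfl) <;> simp [neg_entry, one_entries]
  · rintro ⟨h1, h2, h3⟩
    rw [h1, h3, zero_mul, sub_zero] at hd
    rcases mul_self_eq_one_iff.mp hd with h | h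
    · exact Or.inl (ext_entries (by simp [h, h3]) (by simp [h1]) (by simp [h2]) (by simp [h]))
    · exact Or.inr (ext_entries (by simp [neg_entry, one_entries, h, h3])
        (by simp [neg_entry, one_entries, h1]) (by simp [neg_entry, one_entries, h2])
        (by simp [neg_entry, one_entries, h]))

/-- The subgroup of upper triangular matrices. -/
def borel (F : Type*) [Field F] : Subgroup SL(2, F) where
  carrier := {g | g 1 0 = 0}
  one_mem' := rfl
  mul_mem' {g h} hg hh := by
    simp only [Set.mem_ofPred_eq] at hg hh ⊢
    rw [mul_entry, hg, hh, zero_mul, mul_zero, add_zero]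
  inv_mem' {g} hg := by
    simp only [Set.mem_ofPred_eq] at hg ⊢
    rw [(inv_entries g).2.2.1, hg, neg_zero]

/-- The upper left entry, as a homomorphism on upper triangular matrices. -/
def borelHom (F : Type*) [Field F] : borel F →* Fˣ :=
  MonoidHom.toHomUnits
    { toFun := fun g => g.1 0 0
      map_one' := rfl
      map_mul' := fun g h => by
        have hh : h.1 1 0 = 0 := h.2
        change (g.1 * h.1) 0 0 = _
        rw [mul_entry, hh, mul_zero, add_zero] }

lemma diag_mul_uni_mem_borel (a : Fˣ) (x : F) : diag a * uni x ∈ borel F := by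
  change (diag a * uni x) 1 0 = 0
  simp [mul_entry, diag_entries, uni_entries]

lemma bijective_diag_mul_uni : Function.Bijective fun p : Fˣ × F =>
    (⟨diag p.1 * uni p.2, diag_mul_uni_mem_borel p.1 p.2⟩ : borel F) := by
  constructor
  · rintro ⟨a, x⟩ ⟨b, y⟩ h
    have h0 : diag a * uni x = diag b * uni y := congrArg Subtype.val h
    have h1 : (diag a * uni x) 0 0 = (diag b * uni y) 0 0 := by rw [h0]
    have h2 : (diag a * uni x) 0 1 = (diag b * uni y) 0 1 := by rw [h0]
    simp only [mul_entry, diag_entries, uni_entries, mul_one, mul_zero, add_zero] at h1 h2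
    rw [h1, mul_right_inj' b.ne_zero] at h2
    exact Prod.ext (Units.ext h1) h2
  · rintro ⟨g, hg⟩
    have hg : g 1 0 = 0 := hg
    have hd := det_entries g
    rw [hg, mul_zero, sub_zero] at hd
    have hne : g 0 0 ≠ 0 := left_ne_zero_of_mul_eq_one hd
    refine ⟨⟨Units.mk0 _ hne, g 0 1 / g 0 0⟩, Subtype.ext ?_⟩
    apply ext_entries <;> simp [mul_entry, diag_entries, uni_entries, hg,
      eq_inv_of_mul_eq_one_right hd, mul_div_cancel₀ _ hne]

lemma exists_conj_diag_mul_uni {a : Fˣ} (ha : ¬ IsSign (diag a)) (x : F) :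
    ∃ g, g * diag a * g⁻¹ = diag a * uni x := by
  have hne : ((a⁻¹ : Fˣ) : F) - a ≠ 0 := by
    intro h
    apply ha
    rw [isSign_iff]
    exact ⟨rfl, rfl, (sub_eq_zero.mp h).symm⟩
  refine ⟨uni (a * x / ((a⁻¹ : Fˣ) - a)), ?_⟩
  rw [uni_inv]
  apply ext_entries <;> simp only [mul_entry, diag_entries, uni_entries]
  · ring
  · field_simp
    ring
  · ring
  · ring

lemma diag_inv (a : Fˣ) : (diag a)⁻¹ = diag a⁻¹ := by
  apply ext_entries <;> simp [inv_entries, diag_entries]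

lemma weyl_mul_diag_mul_inv (a : Fˣ) : weyl * diag a * weyl⁻¹ = (diag a)⁻¹ := by
  apply ext_entries <;> simp [mul_entry, inv_entries, diag_entries, weyl_entries]

section SignTwist

open scoped Classical in
/-- The function `f` rescaled on `±1` so as to take the value `r` at `1`. -/
noncomputable def signTwist (f : SL(2, F) → ℂ) (r : ℂ) (g : SL(2, F)) : ℂ :=
  if IsSign g then f g / f 1 * r else f g

variable {f : SL(2, F) → ℂ} {ε : ℂ}

lemma signTwist_of_isSign {g : SL(2, F)} (h : IsSign g) (r : ℂ) :
    signTwist f r g = f g / f 1 * r := by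
  classical
  exact if_pos h

lemma signTwist_of_not_isSign {g : SL(2, F)} (h : ¬ IsSign g) (r : ℂ) :
    signTwist f r g = f g := by
  classical
  exact if_neg h

lemma isSign_inv_iff (g : SL(2, F)) : IsSign g⁻¹ ↔ IsSign g := by
  simp only [IsSign, inv_eq_iff_eq_inv, inv_neg, inv_one]

lemma isSign_neg_iff (g : SL(2, F)) : IsSign (-g) ↔ IsSign g := by
  simp only [IsSign, neg_eq_iff_eq_neg, neg_neg, or_comm]

lemma IsSign.inv_eq {g : SL(2, F)} (h : IsSign g) : g⁻¹ = g := by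
  rcases h with rfl | rfl
  · exact inv_one
  · rw [inv_neg, inv_one]

lemma IsSign.div_eq (hf1 : f 1 ≠ 0) (hε : ∀ g, f (-g) = ε * f g) {g : SL(2, F)}
    (h : IsSign g) : f g / f 1 = 1 ∨ f g / f 1 = ε := by
  rcases h with rfl | rfl
  · exact Or.inl (div_self hf1)
  · right
    rw [hε, mul_div_assoc, div_self hf1, mul_one]

lemma signTwist_neg_mul_inv (hε : ∀ g, f (-g) = ε * f g) (hε2 : ε ^ 2 = 1) (r : ℂ)
    (g : SL(2, F)) : signTwist f r (-g) * signTwist f r (-g)⁻¹ =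
      signTwist f r g * signTwist f r g⁻¹ := by
  rw [inv_neg]
  by_cases h : IsSign g
  · rw [signTwist_of_isSign ((isSign_neg_iff g).mpr h), signTwist_of_isSign h,
      signTwist_of_isSign ((isSign_neg_iff _).mpr ((isSign_inv_iff g).mpr h)),
      signTwist_of_isSign ((isSign_inv_iff g).mpr h), hε, hε]
    linear_combination (f g / f 1 * r * (f g⁻¹ / f 1 * r)) * hε2
  · rw [signTwist_of_not_isSign ((isSign_neg_iff g).not.mpr h), signTwist_of_not_isSign h,
      signTwist_of_not_isSign ((isSign_neg_iff _).not.mpr ((isSign_inv_iff g).not.mpr h)),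
      signTwist_of_not_isSign ((isSign_inv_iff g).not.mpr h), hε, hε]
    linear_combination (f g * f g⁻¹) * hε2

lemma signTwist_one (hf1 : f 1 ≠ 0) (r : ℂ) : signTwist f r 1 = r := by
  rw [signTwist_of_isSign (Or.inl rfl), div_self hf1, one_mul]

lemma signTwist_mem_iff (hf1 : f 1 ≠ 0) (hε : ∀ g, f (-g) = ε * f g) (hε2 : ε ^ 2 = 1) {r : ℂ}
    {K : Subfield ℂ} (hr : r ∈ K) (hK : f 1 ∈ K) (g : SL(2, F)) :
    signTwist f r g ∈ K ↔ f g ∈ K := by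
  by_cases h : IsSign g
  · rw [signTwist_of_isSign h]
    have hεK : ε ∈ K := by
      rcases mul_self_eq_one_iff.mp ((pow_two ε).symm.trans hε2) with rfl | rfl
      · exact K.one_mem
      · exact K.neg_mem K.one_mem
    have h1 : f g / f 1 ∈ K := by
      rcases h.div_eq hf1 hε with h1 | h1 <;> rw [h1]
      · exact K.one_mem
      · exact hεK
    refine iff_of_true (K.mul_mem h1 hr) ?_
    rw [← div_mul_cancel₀ (f g) hf1]
    exact K.mul_mem h1 hK
  · rw [signTwist_of_not_isSign h]

/-- The sign twist of a class function is even at elements conjugate to their inverses. -/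
lemma signTwist_inv (hf : ∀ g x, f (x * g * x⁻¹) = f g) (r : ℂ) {s : SL(2, F)}
    (hs : ¬ IsSign s → ∃ x, x * s * x⁻¹ = s⁻¹) : signTwist f r s⁻¹ = signTwist f r s := by
  by_cases h : IsSign s
  · rw [h.inv_eq]
  · obtain ⟨x, hx⟩ := hs h
    rw [signTwist_of_not_isSign h, signTwist_of_not_isSign ((isSign_inv_iff s).not.mpr h), ← hx, hf]

end SignTwist

/-- Characterization of the nonsplit torus of `SL₂` over a finite field. -/
structure IsNonsplitTorus [Fintype F] (T : Subgroup SL(2, F)) : Prop where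
  isCyclic : IsCyclic T
  card_eq : Nat.card T = Fintype.card F + 1
  neg_one_mem : -1 ∈ T
  not_isEigen : ∀ g ∈ T, ¬ IsSign g → ∀ a, ¬ IsEigen g a
  eq_or_eq_inv : ∀ g ∈ T, ∀ h ∈ T, g 0 0 + g 1 1 = h 0 0 + h 1 1 → h = g ∨ h = g⁻¹
  mem_of_commute : ∀ g ∈ T, ¬ IsSign g → ∀ x, x * g = g * x → x ∈ T

section Extension

variable {K : Type*} [Field K] [Algebra F K]

/-- Multiplication by elements of norm one, as matrices of determinant one. -/
noncomputable def normOneHom (b : Module.Basis (Fin 2) F K) :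
    (Units.map (Algebra.norm F (S := K))).ker →* SL(2, F) where
  toFun k := ⟨Algebra.leftMulMatrix b k.1, by
    rw [← Algebra.norm_eq_matrix_det]
    exact congrArg Units.val k.2⟩
  map_one' := Subtype.ext (map_one (Algebra.leftMulMatrix b))
  map_mul' x y := Subtype.ext (map_mul (Algebra.leftMulMatrix b) _ _)

lemma mem_range_normOneHom [Finite K] {b : Module.Basis (Fin 2) F K} {g : SL(2, F)} {k : K}
    (h : g.1 = Algebra.leftMulMatrix b k) : g ∈ (normOneHom b).range := by
  have hn : Algebra.norm F k = 1 := by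
    rw [Algebra.norm_eq_matrix_det b, ← h, g.2]
  have hk : k ≠ 0 := by
    rintro rfl
    have : Algebra.norm F (0 : K) = 0 := by
      have : FiniteDimensional F K := .of_finite
      simp
    exact zero_ne_one (this.symm.trans hn)
  exact ⟨⟨Units.mk0 k hk, Units.ext hn⟩, Subtype.ext h.symm⟩

lemma leftMulMatrix_sub_algebraMap (b : Module.Basis (Fin 2) F K) (k : K) (a : F) :
    Algebra.leftMulMatrix b (k - algebraMap F K a) =
      Algebra.leftMulMatrix b k - a • 1 := by
  rw [map_sub, AlgHom.commutes, Algebra.algebraMap_eq_smul_one]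

lemma isNonsplitTorus_range_normOneHom [Fintype F] [Finite K] (b : Module.Basis (Fin 2) F K) :
    IsNonsplitTorus (normOneHom b).range := by
  have : FiniteDimensional F K := .of_finite
  have hinj : Function.Injective (normOneHom b) := by
    intro x y h
    exact Subtype.ext (Units.ext (Algebra.leftMulMatrix_injective b (congrArg Subtype.val h)))
  have hcard : Nat.card K = Fintype.card F ^ 2 := by
    rw [Module.natCard_eq_pow_finrank (K := F), Module.finrank_eq_card_basis b]
    simp
  have hchar : ∀ k ∈ (Units.map (Algebra.norm F (S := K))).ker, ∀ t : F,
      t = (Algebra.leftMulMatrix b k) 0 0 + (Algebra.leftMulMatrix b k) 1 1 →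
      (k : K) * k - algebraMap F K t * k + 1 = 0 := by
    intro k hk t ht
    have hd := det_entries (normOneHom b ⟨k, hk⟩)
    change Algebra.leftMulMatrix b k 0 0 * Algebra.leftMulMatrix b k 1 1 -
      Algebra.leftMulMatrix b k 0 1 * Algebra.leftMulMatrix b k 1 0 = 1 at hd
    apply Algebra.leftMulMatrix_injective b
    rw [map_add, map_sub, map_mul, map_mul, map_one, map_zero, AlgHom.commutes,
      Algebra.algebraMap_eq_smul_one, ht]
    ext i j
    fin_cases i <;> fin_cases j <;> simp [Matrix.mul_apply, Fin.sum_univ_two] <;>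
      first | ring1 | linear_combination -hd
  have hnot : ∀ g ∈ (normOneHom b).range, ¬ IsSign g → ∀ a, ¬ IsEigen g a := by
    rintro _ ⟨k, rfl⟩ hs a ha
    apply hs
    set g := normOneHom b k
    have hg : g.1 = Algebra.leftMulMatrix b (k.1 : K) := rfl
    have h0 : Algebra.norm F ((k.1 : K) - algebraMap F K a) = 0 := by
      rw [Algebra.norm_eq_matrix_det b, leftMulMatrix_sub_algebraMap, ← hg, det_fin_two]
      have hd := det_entries g
      simp only [Matrix.sub_apply, Matrix.smul_apply, smul_eq_mul, Matrix.one_apply]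
      simp
      unfold IsEigen at ha
      linear_combination ha + hd
    rw [Algebra.norm_eq_zero_iff, sub_eq_zero] at h0
    rw [h0, AlgHom.commutes, Algebra.algebraMap_eq_smul_one] at hg
    rw [isSign_iff]
    simp [hg]
  refine ⟨?_, ?_, ?_, hnot, ?_, ?_⟩
  · exact isCyclic_of_surjective _ (normOneHom b).rangeRestrict_surjective
  · rw [Nat.card_congr (MonoidHom.ofInjective hinj).symm.toEquiv]
    have h1 := Subgroup.card_mul_index (Units.map (Algebra.norm F (S := K))).ker
    rw [Subgroup.index_ker, MonoidHom.range_eq_top.mpr (FiniteField.unitsMap_norm_surjective F K),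
      Subgroup.card_top, Nat.card_units, Nat.card_units, hcard, Nat.card_eq_fintype_card (α := F)]
      at h1
    have hq : 1 < Fintype.card F := Fintype.one_lt_card
    have h2 : Fintype.card F ^ 2 - 1 = (Fintype.card F + 1) * (Fintype.card F - 1) := by
      have := Nat.sq_sub_sq (Fintype.card F) 1
      simpa using this
    rw [h2] at h1
    exact Nat.eq_of_mul_eq_mul_right (by omega) h1
  · apply mem_range_normOneHom (k := -1)
    simp
  · rintro _ ⟨k, rfl⟩ _ ⟨l, rfl⟩ h
    have h1 := hchar k.1 k.2 _ rfl
    change Algebra.leftMulMatrix b k.1 0 0 + Algebra.leftMulMatrix b k.1 1 1 = _ at h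
    have h2 := hchar l.1 l.2 _ h
    have h3 : ((l.1 : K) - k.1) * (l.1 + k.1 - algebraMap F K
      (Algebra.leftMulMatrix b k.1 0 0 + Algebra.leftMulMatrix b k.1 1 1)) = 0 := by
      linear_combination h2 - h1
    rcases mul_eq_zero.mp h3 with h4 | h4
    · left
      rw [show l = k from Subtype.ext (Units.ext (sub_eq_zero.mp h4))]
    · right
      rw [← map_inv]
      congr 1
      rw [eq_inv_iff_mul_eq_one]
      refine Subtype.ext (Units.ext ?_)
      change (l.1 : K) * k.1 = 1
      linear_combination h4 * (k.1 : K) - h1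
  · rintro g hg hs x hx
    have h01 : g 0 1 ≠ 0 := by
      intro h0
      apply hnot g hg hs (g 0 0)
      have hd := det_entries g
      unfold IsEigen
      rw [h0] at hd
      linear_combination -hd
    obtain ⟨k, rfl⟩ := hg
    set g := normOneHom b k
    have hg : g.1 = Algebra.leftMulMatrix b (k.1 : K) := rfl
    have e00 : (x * g) 0 0 = (g * x) 0 0 := by rw [hx]
    have e01 : (x * g) 0 1 = (g * x) 0 1 := by rw [hx]
    simp only [mul_entry] at e00 e01
    set β := x 0 1 / g 0 1 with hβ
    have hβ' : x 0 1 = β * g 0 1 := by rw [hβ, div_mul_cancel₀ _ h01]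
    rw [hβ'] at e00 e01
    apply mem_range_normOneHom (b := b)
      (k := algebraMap F K (x 0 0 - β * g 0 0) + algebraMap F K β * k.1)
    rw [map_add, map_mul, AlgHom.commutes, AlgHom.commutes, Algebra.algebraMap_eq_smul_one,
      Algebra.algebraMap_eq_smul_one, ← hg]
    ext i j
    fin_cases i <;> fin_cases j <;> simp
    · exact hβ'
    · apply mul_left_cancel₀ h01
      linear_combination -e00
    · apply mul_left_cancel₀ h01
      linear_combination -e01

end Extension

section Finite

variable [Fintype F] [DecidableEq F]

open scoped Classical in
/-- The elements `1` and `-1`. -/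
noncomputable def signSet (F : Type*) [Field F] [Fintype F] [DecidableEq F] : Finset SL(2, F) :=
  Finset.univ.filter IsSign

open scoped Classical in
/-- The non-scalar upper triangular matrices with equal diagonal entries. -/
noncomputable def uniSet (F : Type*) [Field F] [Fintype F] [DecidableEq F] : Finset SL(2, F) :=
  Finset.univ.filter fun g => g 1 0 = 0 ∧ g 0 0 = g 1 1 ∧ g 0 1 ≠ 0

open scoped Classical in
/-- The non-scalar diagonal matrices. -/
noncomputable def torSet (F : Type*) [Field F] [Fintype F] [DecidableEq F] : Finset SL(2, F) :=
  Finset.univ.filter fun g => g 0 1 = 0 ∧ g 1 0 = 0 ∧ g 0 0 ≠ g 1 1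

lemma card_le : Fintype.card SL(2, F) ≤ Fintype.card F * (Fintype.card F ^ 2 - 1) := by
  let ι : Fˣ × SL(2, F) → GL (Fin 2) F := fun p =>
    GeneralLinearGroup.mkOfDetNeZero !![p.1 * p.2 0 0, p.1 * p.2 0 1; p.2 1 0, p.2 1 1] (by
      have hd := det_entries p.2
      rw [det_fin_two_of]
      have : (p.1 : F) * p.2 0 0 * p.2 1 1 - p.1 * p.2 0 1 * p.2 1 0 = p.1 := by
        linear_combination (p.1 : F) * hd
      rw [this]
      exact p.1.ne_zero)
  have hι : Function.Injective ι := by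
    rintro ⟨a, g⟩ ⟨b, h⟩ he
    have hm : ∀ i j, ι (a, g) i j = ι (b, h) i j := fun i j => by rw [he]
    have h00 : (a : F) * g 0 0 = b * h 0 0 := hm 0 0
    have h01 : (a : F) * g 0 1 = b * h 0 1 := hm 0 1
    have h10 : g 1 0 = h 1 0 := hm 1 0
    have h11 : g 1 1 = h 1 1 := hm 1 1
    have hab : (a : F) = b := by
      have hg := det_entries g
      have hh := det_entries h
      rw [← h10, ← h11] at hh
      linear_combination b * hh - a * hg + h00 * g 1 1 - h01 * g 1 0
    rw [← hab, mul_right_inj' a.ne_zero] at h00 h01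
    exact Prod.ext (Units.ext hab) (ext_entries h00 h01 h10 h11)
  have hcard := Fintype.card_le_of_injective ι hι
  rw [Fintype.card_prod, Fintype.card_units, ← Nat.card_eq_fintype_card (α := GL (Fin 2) F),
    card_GL_field, Fin.prod_univ_two] at hcard
  have hq : 1 < Fintype.card F := Fintype.one_lt_card
  have hfac : Fintype.card F ^ 2 - Fintype.card F = Fintype.card F * (Fintype.card F - 1) := by
    rw [pow_two, Nat.mul_sub_one]
  simp only [Fin.val_zero, Fin.val_one, pow_zero, pow_one, hfac] at hcard
  have hpos : 0 < Fintype.card F - 1 := by omega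
  refine Nat.le_of_mul_le_mul_left (hcard.trans_eq ?_) hpos
  ring

lemma conjCount_uniSet_le (g : SL(2, F)) :
    conjCount (uniSet F) g ≤ Fintype.card F * (Fintype.card F - 1) := by
  classical
  refine conjCount_le (fun s hs => ?_) g
  simp only [uniSet, Finset.mem_filter, Finset.mem_univ, true_and] at hs
  obtain ⟨h1, h2, h3⟩ := hs
  rw [← Fintype.card_units, ← Fintype.card_prod]
  have hsub : ∀ x : SL(2, F), x⁻¹ * s * x ∈ uniSet F → x 1 0 = 0 := by
    intro x hx
    simp only [uniSet, Finset.mem_filter, Finset.mem_univ, true_and] at hx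
    have := hx.1
    simp only [mul_entry, inv_entries, h1, h2] at this
    have h4 : s 0 1 * (x 1 0) ^ 2 = 0 := by linear_combination -this
    simpa [h3] using h4
  calc _ ≤ (Finset.univ.image fun p : F × Fˣ => diag p.2 * uni p.1).card := by
        apply Finset.card_le_card
        intro x hx
        have h0 := hsub x (by simpa using hx)
        have hd := det_entries x
        rw [h0, mul_zero, sub_zero] at hd
        have hne : x 0 0 ≠ 0 := left_ne_zero_of_mul_eq_one hd
        simp only [Finset.mem_image, Finset.mem_univ, true_and]
        refine ⟨⟨x 0 1 / x 0 0, Units.mk0 _ hne⟩, ?_⟩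
        have h11 := eq_inv_of_mul_eq_one_right hd
        apply ext_entries <;>
          simp [mul_entry, diag_entries, uni_entries, h0, h11, mul_div_cancel₀ _ hne]
    _ ≤ _ := Finset.card_image_le

lemma conjCount_torSet_le (g : SL(2, F)) :
    conjCount (torSet F) g ≤ 2 * (Fintype.card F - 1) := by
  classical
  refine conjCount_le (fun s hs => ?_) g
  simp only [torSet, Finset.mem_filter, Finset.mem_univ, true_and] at hs
  obtain ⟨h1, h2, h3⟩ := hs
  have hN : 2 * (Fintype.card F - 1) = Fintype.card (Bool × Fˣ) := by
    rw [Fintype.card_prod, Fintype.card_bool, Fintype.card_units]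
  rw [hN]
  have hsub : ∀ x : SL(2, F), x⁻¹ * s * x ∈ torSet F →
      (x 0 1 = 0 ∧ x 1 0 = 0) ∨ (x 0 0 = 0 ∧ x 1 1 = 0) := by
    intro x hx
    have hd := det_entries x
    simp only [torSet, Finset.mem_filter, Finset.mem_univ, true_and] at hx
    obtain ⟨h4, h5, -⟩ := hx
    simp only [mul_entry, inv_entries, h1, h2] at h4 h5
    have h3' := sub_ne_zero.mpr h3
    have h6 : (s 0 0 - s 1 1) * (x 0 1 * x 1 1) = 0 := by linear_combination h4
    have h7 : (s 0 0 - s 1 1) * (x 0 0 * x 1 0) = 0 := by linear_combination -h5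
    simp only [mul_eq_zero, h3', false_or] at h6 h7
    grind
  calc _ ≤ (Finset.univ.image fun p : Bool × Fˣ => cond p.1 (diag p.2) (diag p.2 * weyl)).card := by
        apply Finset.card_le_card
        intro x hx
        have hd := det_entries x
        simp only [Finset.mem_image, Finset.mem_univ, true_and, Prod.exists, Bool.exists_bool,
          cond_true, cond_false]
        rcases hsub x (by simpa using hx) with ⟨h5, h6⟩ | ⟨h5, h6⟩
        · right
          rw [h5, zero_mul, sub_zero] at hd
          refine ⟨Units.mk0 _ (left_ne_zero_of_mul_eq_one hd), ?_⟩
          apply ext_entries <;> simp [diag_entries, h5, h6, eq_inv_of_mul_eq_one_right hd]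
        · left
          rw [h5, zero_mul, zero_sub, ← mul_neg] at hd
          refine ⟨Units.mk0 _ (left_ne_zero_of_mul_eq_one hd), ?_⟩
          apply ext_entries <;>
            simp [mul_entry, diag_entries, weyl_entries, h5, h6, ← eq_inv_of_mul_eq_one_right hd]
    _ ≤ _ := Finset.card_image_le

lemma exists_isNonsplitTorus (F : Type*) [Field F] [Fintype F] :
    ∃ T : Subgroup SL(2, F), IsNonsplitTorus T := by
  obtain ⟨p, hp⟩ := CharP.exists F
  have : Fact p.Prime := ⟨CharP.char_is_prime F p⟩
  exact ⟨_, isNonsplitTorus_range_normOneHom (K := FiniteField.Extension F p 2)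
    (Module.finBasisOfFinrankEq F _ (FiniteField.finrank_extension F p 2))⟩

open scoped Classical in
/-- The elements of a torus other than `1` and `-1`. -/
noncomputable def nsSet (T : Subgroup SL(2, F)) : Finset SL(2, F) :=
  Finset.univ.filter fun g => g ∈ T ∧ ¬ IsSign g

open scoped Classical in
lemma mem_signSet {g : SL(2, F)} : g ∈ signSet F ↔ IsSign g := by simp [signSet]

open scoped Classical in
lemma mem_uniSet {g : SL(2, F)} : g ∈ uniSet F ↔ g 1 0 = 0 ∧ g 0 0 = g 1 1 ∧ g 0 1 ≠ 0 := by
  simp [uniSet]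

open scoped Classical in
lemma mem_torSet {g : SL(2, F)} : g ∈ torSet F ↔ g 0 1 = 0 ∧ g 1 0 = 0 ∧ g 0 0 ≠ g 1 1 := by
  simp [torSet]

open scoped Classical in
lemma mem_nsSet {T : Subgroup SL(2, F)} {g : SL(2, F)} : g ∈ nsSet T ↔ g ∈ T ∧ ¬ IsSign g := by
  simp [nsSet]

lemma conjCount_nsSet_le_aux {T : Subgroup SL(2, F)} (hT : IsNonsplitTorus T) {s : SL(2, F)}
    (hs : s ∈ nsSet T) : conjCount (nsSet T) s ≤ 2 * (Fintype.card F + 1) ∧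
      (conjCount (nsSet T) s ≤ Fintype.card F + 1 ∨ ∃ x, x * s * x⁻¹ = s⁻¹) := by
  classical
  obtain ⟨hsT, hs1⟩ := mem_nsSet.mp hs
  have hTcard : (Finset.univ.filter (· ∈ T)).card = Fintype.card F + 1 := by
    rw [← hT.card_eq, Nat.card_eq_fintype_card, Fintype.card_subtype]
  have hor : ∀ x, x⁻¹ * s * x ∈ nsSet T → x ∈ T ∨ x⁻¹ * s * x = s⁻¹ := by
    intro x hx
    have htr := trace_conj s x⁻¹
    rw [inv_inv] at htr
    rcases hT.eq_or_eq_inv s hsT _ (mem_nsSet.mp hx).1 htr.symm with h | h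
    · left
      refine hT.mem_of_commute s hsT hs1 x ?_
      conv_lhs => rw [← h]
      group
    · exact Or.inr h
  by_cases H : ∃ x, x⁻¹ * s * x = s⁻¹
  · obtain ⟨w, hw⟩ := H
    refine ⟨?_, Or.inr ⟨w⁻¹, by simpa using hw⟩⟩
    calc _ ≤ (Finset.univ.filter (· ∈ T) ∪ (Finset.univ.filter (· ∈ T)).image (· * w)).card := by
          apply Finset.card_le_card
          intro x hx
          rcases hor x (by simpa using hx) with h | h
          · simp [h]
          · rw [Finset.mem_union]
            right
            rw [Finset.mem_image]
            refine ⟨x * w⁻¹, ?_, by group⟩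
            simp only [Finset.mem_filter, Finset.mem_univ, true_and]
            refine hT.mem_of_commute s hsT hs1 _ ?_
            have h2 : w⁻¹ * s * w = x⁻¹ * s * x := hw.trans h.symm
            calc x * w⁻¹ * s = x * (w⁻¹ * s * w) * w⁻¹ := by group
              _ = x * (x⁻¹ * s * x) * w⁻¹ := by rw [h2]
              _ = _ := by group
      _ ≤ _ := Finset.card_union_le _ _
      _ ≤ _ := by
          have := Finset.card_image_le (s := Finset.univ.filter (· ∈ T)) (f := (· * w))
          omega
  · push Not at H
    have : conjCount (nsSet T) s ≤ Fintype.card F + 1 := by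
      rw [← hTcard]
      apply Finset.card_le_card
      intro x hx
      rcases hor x (by simpa using hx) with h | h
      · simp [h]
      · exact absurd h (H x)
    exact ⟨by omega, Or.inl this⟩

section Sums

variable (f : SL(2, F) → ℂ)

lemma sum_signSet (hneg : ∀ g, f (-g) = f g) : ∑ g ∈ signSet F, f g = (signSet F).card * f 1 := by
  rw [Finset.sum_congr rfl (g := fun _ => f 1), Finset.sum_const, nsmul_eq_mul]
  intro g hg
  rcases mem_signSet.mp hg with rfl | rfl
  · rfl
  · exact hneg 1

lemma sum_uniSet (hneg : ∀ g, f (-g) = f g) : ∑ g ∈ uniSet F, f g =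
    (signSet F).card * ∑ x ∈ Finset.univ.erase (0 : F), f (uni x) := by
  rw [← nsmul_eq_mul, ← Finset.sum_const, ← Finset.sum_product']
  symm
  refine Finset.sum_bij' (fun p _ => p.1 * uni p.2)
    (fun g _ => (g * uni (-(g 0 1 / g 0 0)), g 0 1 / g 0 0)) ?_ ?_ ?_ ?_ ?_
  · rintro ⟨z, x⟩ h
    simp only [Finset.mem_product, mem_signSet, Finset.mem_erase, Finset.mem_univ, and_true] at h
    obtain ⟨h1, h2⟩ := h
    rcases h1 with rfl | rfl <;> simp [mem_uniSet, uni_entries, h2, neg_entry]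
  · intro g hg
    obtain ⟨h1, h2, h3⟩ := mem_uniSet.mp hg
    have hd := det_entries g
    rw [h1, mul_zero, sub_zero] at hd
    have hne : g 0 0 ≠ 0 := left_ne_zero_of_mul_eq_one hd
    simp only [Finset.mem_product, mem_signSet, Finset.mem_erase, Finset.mem_univ, and_true]
    refine ⟨?_, div_ne_zero h3 hne⟩
    rw [isSign_iff]
    simp only [mul_entry, uni_entries, h1, h2]
    rw [h2] at hne
    refine ⟨?_, ?_, ?_⟩ <;> field_simp <;> ring
  · rintro ⟨z, x⟩ h
    simp only [Finset.mem_product, mem_signSet, Finset.mem_erase, Finset.mem_univ, and_true] at h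
    obtain ⟨h1, h2⟩ := h
    have e : (z * uni x) 0 1 / (z * uni x) 0 0 = x := by
      rcases h1 with rfl | rfl <;> simp [uni_entries, neg_entry]
    have e2 : uni x * uni (-x) = 1 := by
      apply ext_entries <;> simp [mul_entry, uni_entries]
    ext1
    · simp only [e, mul_assoc, e2, mul_one]
    · exact e
  · intro g hg
    have e2 : ∀ x : F, uni (-x) * uni x = 1 := fun x => by
      apply ext_entries <;> simp [mul_entry, uni_entries]
    simp only [mul_assoc, e2, mul_one]
  · rintro ⟨z, x⟩ h
    simp only [Finset.mem_product, mem_signSet] at h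
    rcases h.1 with rfl | rfl
    · simp
    · simp [hneg]

lemma sum_torSet (hneg : ∀ g, f (-g) = f g) :
    ∑ g ∈ torSet F, f g = ∑ a, f (diag a) - (signSet F).card * f 1 := by
  classical
  rw [← sum_signSet f hneg, eq_sub_iff_add_eq, ← Finset.sum_union]
  · symm
    apply Finset.sum_bij (fun a _ => diag a)
    · intro a _
      simp only [Finset.mem_union, mem_torSet, mem_signSet, isSign_iff, diag_entries]
      tauto
    · intro a _ b _ h
      have : diag a 0 0 = diag b 0 0 := by rw [h]
      exact Units.ext this
    · intro g hg
      simp only [Finset.mem_union, mem_torSet, mem_signSet, isSign_iff] at hg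
      have h1 : g 0 1 = 0 := by tauto
      have h2 : g 1 0 = 0 := by tauto
      have hd := det_entries g
      rw [h2, mul_zero, sub_zero] at hd
      refine ⟨Units.mk0 (g 0 0) (left_ne_zero_of_mul_eq_one hd), Finset.mem_univ _, ?_⟩
      apply ext_entries <;> simp [diag_entries, h1, h2, eq_inv_of_mul_eq_one_right hd]
    · simp
  · rw [Finset.disjoint_left]
    intro g
    rw [mem_torSet, mem_signSet, isSign_iff]
    tauto

lemma sum_nsSet (hneg : ∀ g, f (-g) = f g) {T : Subgroup SL(2, F)} (hT : IsNonsplitTorus T)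
    [Fintype T] :
    ∑ g ∈ nsSet T, f g = ∑ t : T, f t - (signSet F).card * f 1 := by
  classical
  rw [← sum_signSet f hneg, eq_sub_iff_add_eq, ← Finset.sum_union]
  · symm
    rw [← Finset.sum_subtype (p := (· ∈ T)) (f := f)]
    intro g
    rw [Finset.mem_union, mem_nsSet, mem_signSet]
    constructor
    · rintro (h | rfl | rfl)
      · exact h.1
      · exact T.one_mem
      · exact hT.neg_one_mem
    · intro h
      by_cases hs : IsSign g <;> simp [h, hs]
  · rw [Finset.disjoint_left]
    intro g
    rw [mem_nsSet, mem_signSet]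
    tauto

end Sums

section Weight

variable {T : Subgroup SL(2, F)}

/-- The total weight with which the conjugates of `g` lie in the four standard sets. -/
noncomputable def weight (T : Subgroup SL(2, F)) (g : SL(2, F)) : ℝ :=
  conjCount (signSet F) g / Fintype.card SL(2, F)
    + conjCount (uniSet F) g / (Fintype.card F * (Fintype.card F - 1))
    + conjCount (torSet F) g / (2 * (Fintype.card F - 1))
    + conjCount (nsSet T) g / (2 * (Fintype.card F + 1))

lemma isSign_of_conjCount_ne_zero {g : SL(2, F)} (h : conjCount (signSet F) g ≠ 0) :
    IsSign g := by
  obtain ⟨x, s, hs, rfl⟩ := exists_of_conjCount_ne_zero h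
  rw [isSign_conj]
  exact mem_signSet.mp hs

lemma of_conjCount_uniSet_ne_zero {g : SL(2, F)} (h : conjCount (uniSet F) g ≠ 0) :
    ¬ IsSign g ∧ (∃ a, IsEigen g a) ∧ ∀ a, IsEigen g a → a ^ 2 = 1 := by
  obtain ⟨x, s, hs, rfl⟩ := exists_of_conjCount_ne_zero h
  obtain ⟨h1, h2, h3⟩ := mem_uniSet.mp hs
  have hd := det_entries s
  rw [h1, mul_zero, sub_zero] at hd
  simp only [isSign_conj, isEigen_conj]
  refine ⟨fun hh => h3 ((isSign_iff s).mp hh).1, ⟨s 0 0, ?_⟩, fun a ha => ?_⟩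
  · unfold IsEigen
    linear_combination -hd
  · unfold IsEigen at ha
    have : (a - s 0 0) ^ 2 = 0 := by
      linear_combination ha + hd + s 0 0 * h2 - a * h2
    rw [pow_eq_zero_iff two_ne_zero, sub_eq_zero] at this
    rw [this]
    linear_combination hd + s 0 0 * h2

lemma of_conjCount_torSet_ne_zero {g : SL(2, F)} (h : conjCount (torSet F) g ≠ 0) :
    ¬ IsSign g ∧ ∃ a, IsEigen g a ∧ a ^ 2 ≠ 1 := by
  obtain ⟨x, s, hs, rfl⟩ := exists_of_conjCount_ne_zero h
  obtain ⟨h1, h2, h3⟩ := mem_torSet.mp hs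
  have hd := det_entries s
  rw [h1, zero_mul, sub_zero] at hd
  simp only [isSign_conj, isEigen_conj]
  refine ⟨fun hh => h3 ((isSign_iff s).mp hh).2.2, s 0 0, ?_, fun h4 => h3 ?_⟩
  · unfold IsEigen
    linear_combination -hd
  · apply mul_left_cancel₀ (left_ne_zero_of_mul_eq_one hd)
    linear_combination h4 - hd

lemma of_conjCount_nsSet_ne_zero (hT : IsNonsplitTorus T) {g : SL(2, F)}
    (h : conjCount (nsSet T) g ≠ 0) : ¬ IsSign g ∧ ∀ a, ¬ IsEigen g a := by
  obtain ⟨x, s, hs, rfl⟩ := exists_of_conjCount_ne_zero h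
  obtain ⟨h1, h2⟩ := mem_nsSet.mp hs
  simp only [isSign_conj, isEigen_conj]
  exact ⟨h2, hT.not_isEigen s h1 h2⟩

lemma conjCount_nsSet_le (hT : IsNonsplitTorus T) (g : SL(2, F)) :
    conjCount (nsSet T) g ≤ 2 * (Fintype.card F + 1) :=
  conjCount_le (fun _ hs => (conjCount_nsSet_le_aux hT hs).1) g

lemma one_lt_card {F : Type*} [Field F] [Fintype F] : (1 : ℝ) < Fintype.card F := by
  exact_mod_cast Fintype.one_lt_card (α := F)

lemma conjCount_exclusive (hT : IsNonsplitTorus T) (g : SL(2, F)) :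
    (conjCount (uniSet F) g = 0 ∧ conjCount (torSet F) g = 0 ∧
      conjCount (nsSet T) g = 0) ∨ (conjCount (signSet F) g = 0 ∧ conjCount (torSet F) g = 0 ∧
      conjCount (nsSet T) g = 0) ∨ (conjCount (signSet F) g = 0 ∧ conjCount (uniSet F) g = 0 ∧
      conjCount (nsSet T) g = 0) ∨ (conjCount (signSet F) g = 0 ∧ conjCount (uniSet F) g = 0 ∧
      conjCount (torSet F) g = 0) := by
  have a1 := isSign_of_conjCount_ne_zero (g := g)
  have a2 := of_conjCount_uniSet_ne_zero (g := g)
  have a3 := of_conjCount_torSet_ne_zero (g := g)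
  have a4 := of_conjCount_nsSet_ne_zero hT (g := g)
  generalize conjCount (signSet F) g = n₁ at *
  generalize conjCount (uniSet F) g = n₂ at *
  generalize conjCount (torSet F) g = n₃ at *
  generalize conjCount (nsSet T) g = n₄ at *
  by_cases h1 : IsSign g
  · tauto
  by_cases h2 : ∃ a, IsEigen g a
  · obtain ⟨a, ha⟩ := h2
    have h4 : n₄ = 0 := by
      by_contra h
      exact (a4 h).2 a ha
    by_cases h3 : n₃ = 0
    · tauto
    · obtain ⟨b, hb, hb2⟩ := (a3 h3).2
      have h5 : n₂ = 0 := by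
        by_contra h
        exact hb2 ((a2 h).2.2 b hb)
      tauto
  · have h3 : n₃ = 0 := by
      by_contra h
      obtain ⟨b, hb, -⟩ := (a3 h).2
      exact h2 ⟨b, hb⟩
    tauto

lemma weight_le_one (hT : IsNonsplitTorus T) (g : SL(2, F)) : weight T g ≤ 1 := by
  have hq := one_lt_card (F := F)
  have hG : (0 : ℝ) < Fintype.card SL(2, F) := by exact_mod_cast Fintype.card_pos
  have b1 : (conjCount (signSet F) g : ℝ) / Fintype.card SL(2, F) ≤ 1 := by
    rw [div_le_one hG]
    exact_mod_cast conjCount_le_card (signSet F) g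
  have b2 : (conjCount (uniSet F) g : ℝ) / (Fintype.card F * (Fintype.card F - 1)) ≤ 1 := by
    rw [div_le_one (by nlinarith)]
    have := conjCount_uniSet_le g
    have h2 : ((Fintype.card F - 1 : ℕ) : ℝ) = Fintype.card F - 1 := by
      rw [Nat.cast_sub Fintype.card_pos, Nat.cast_one]
    rw [← h2]
    exact_mod_cast this
  have b3 : (conjCount (torSet F) g : ℝ) / (2 * (Fintype.card F - 1)) ≤ 1 := by
    rw [div_le_one (by linarith)]
    have := conjCount_torSet_le g
    have h2 : ((Fintype.card F - 1 : ℕ) : ℝ) = Fintype.card F - 1 := by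
      rw [Nat.cast_sub Fintype.card_pos, Nat.cast_one]
    rw [← h2]
    exact_mod_cast this
  have b4 : (conjCount (nsSet T) g : ℝ) / (2 * (Fintype.card F + 1)) ≤ 1 := by
    rw [div_le_one (by linarith)]
    exact_mod_cast conjCount_nsSet_le hT g
  unfold weight
  rcases conjCount_exclusive hT g with ⟨c1, c2, c3⟩ | ⟨c1, c2, c3⟩ | ⟨c1, c2, c3⟩ | ⟨c1, c2, c3⟩
  · simpa only [c1, c2, c3, Nat.cast_zero, zero_div, add_zero, zero_add] using b1
  · simpa only [c1, c2, c3, Nat.cast_zero, zero_div, add_zero, zero_add] using b2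
  · simpa only [c1, c2, c3, Nat.cast_zero, zero_div, add_zero, zero_add] using b3
  · simpa only [c1, c2, c3, Nat.cast_zero, zero_div, add_zero, zero_add] using b4

lemma sum_conjCount (S : Finset SL(2, F)) :
    ∑ g, (conjCount S g : ℝ) = Fintype.card SL(2, F) * S.card := by
  have := sum_mul_conjCount S (fun _ => 1) (by simp)
  simp only [one_mul, Finset.sum_const, nsmul_eq_mul, mul_one] at this
  exact_mod_cast this

lemma card_uniSet : ((uniSet F).card : ℝ) = (signSet F).card * (Fintype.card F - 1) := by
  have := sum_uniSet (F := F) (fun _ => 1) (by simp)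
  simp only [Finset.sum_const, nsmul_eq_mul, mul_one, Finset.card_erase_of_mem, Finset.mem_univ,
    Finset.card_univ] at this
  rw [Nat.cast_sub Fintype.card_pos, Nat.cast_one] at this
  exact_mod_cast this

lemma card_torSet : ((torSet F).card : ℝ) = Fintype.card F - 1 - (signSet F).card := by
  have := sum_torSet (F := F) (fun _ => 1) (by simp)
  simp only [Finset.sum_const, nsmul_eq_mul, mul_one, Finset.card_univ, Fintype.card_units] at this
  rw [Nat.cast_sub Fintype.card_pos, Nat.cast_one] at this
  exact_mod_cast this

lemma card_nsSet (hT : IsNonsplitTorus T) :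
    ((nsSet T).card : ℝ) = Fintype.card F + 1 - (signSet F).card := by
  classical
  have := sum_nsSet (fun _ => 1) (by simp) hT
  simp only [Finset.sum_const, nsmul_eq_mul, mul_one, Finset.card_univ] at this
  rw [← Nat.card_eq_fintype_card, hT.card_eq] at this
  exact_mod_cast this

lemma weight_eq_one_and_card (hT : IsNonsplitTorus T) : (∀ g, weight T g = 1) ∧
    (Fintype.card SL(2, F) : ℝ) = Fintype.card F * (Fintype.card F ^ 2 - 1) := by
  have hq := one_lt_card (F := F)
  have hG : (0 : ℝ) < Fintype.card SL(2, F) := by exact_mod_cast Fintype.card_pos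
  have hle : (Fintype.card SL(2, F) : ℝ) ≤ Fintype.card F * (Fintype.card F ^ 2 - 1) := by
    have h1 := card_le (F := F)
    have h2 : ((Fintype.card F ^ 2 - 1 : ℕ) : ℝ) = (Fintype.card F : ℝ) ^ 2 - 1 := by
      rw [Nat.cast_sub (Nat.one_le_pow _ _ Fintype.card_pos)]
      simp
    rw [← h2]
    exact_mod_cast h1
  have he : (0 : ℝ) < (signSet F).card := by
    exact_mod_cast Finset.card_pos.mpr ⟨1, mem_signSet.mpr (Or.inl rfl)⟩
  have hsum : ∑ g, weight T g = Fintype.card SL(2, F) + (signSet F).card *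
      (1 - Fintype.card SL(2, F) / (Fintype.card F * (Fintype.card F ^ 2 - 1) : ℝ)) := by
    simp only [weight, Finset.sum_add_distrib, ← Finset.sum_div, sum_conjCount, card_uniSet,
      card_torSet, card_nsSet hT]
    have h1 : (Fintype.card F : ℝ) ≠ 0 := by positivity
    have h2 : (Fintype.card F : ℝ) - 1 ≠ 0 := by linarith
    have h3 : (Fintype.card F : ℝ) + 1 ≠ 0 := by linarith
    have h4 : (Fintype.card F : ℝ) ^ 2 - 1 = (Fintype.card F - 1) * (Fintype.card F + 1) := by ring
    rw [h4]
    field_simp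
    ring
  have hN : (0 : ℝ) < Fintype.card F * (Fintype.card F ^ 2 - 1) := by
    have : (0 : ℝ) < Fintype.card F ^ 2 - 1 := by nlinarith
    positivity
  have h1 : Fintype.card SL(2, F) / (Fintype.card F * (Fintype.card F ^ 2 - 1) : ℝ) ≤ 1 := by
    rwa [div_le_one hN]
  have hle2 : ∑ g, weight T g ≤ Fintype.card SL(2, F) := by
    calc _ ≤ ∑ _g : SL(2, F), (1 : ℝ) := Finset.sum_le_sum fun g _ => weight_le_one hT g
      _ = _ := by simp
  have h2 : Fintype.card SL(2, F) / (Fintype.card F * (Fintype.card F ^ 2 - 1) : ℝ) = 1 := by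
    nlinarith
  refine ⟨fun g => ?_, (div_eq_one_iff_eq hN.ne').mp h2⟩
  have h3 : ∑ g, weight T g = ∑ _g : SL(2, F), (1 : ℝ) := by
    rw [hsum, h2]
    simp
  exact (Finset.sum_eq_sum_iff_of_le fun g _ => weight_le_one hT g).mp h3 g (Finset.mem_univ g)

lemma exists_conj_mem (hT : IsNonsplitTorus T) (g : SL(2, F)) : ∃ x s,
    (s ∈ signSet F ∨ s ∈ uniSet F ∨ s ∈ torSet F ∨ s ∈ nsSet T) ∧ g = x * s * x⁻¹ := by
  by_contra! H
  have h0 : ∀ S : Finset SL(2, F), (∀ s ∈ S,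
      s ∈ signSet F ∨ s ∈ uniSet F ∨ s ∈ torSet F ∨ s ∈ nsSet T) → conjCount S g = 0 := by
    intro S hS
    by_contra h
    obtain ⟨x, s, hs, he⟩ := exists_of_conjCount_ne_zero h
    exact H x s (hS s hs) he
  have := (weight_eq_one_and_card hT).1 g
  rw [weight, h0 _ (by tauto), h0 _ (by tauto), h0 _ (by tauto), h0 _ (by tauto)] at this
  simp at this

lemma exists_conj_eq_inv (hT : IsNonsplitTorus T) {s : SL(2, F)} (hs : s ∈ nsSet T) :
    ∃ x, x * s * x⁻¹ = s⁻¹ := by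
  refine (conjCount_nsSet_le_aux hT hs).2.resolve_left fun hle => ?_
  obtain ⟨h1, h2⟩ := mem_nsSet.mp hs
  have h3 := hT.not_isEigen s h1 h2
  have c1 : conjCount (signSet F) s = 0 := by
    by_contra h
    exact h2 (isSign_of_conjCount_ne_zero h)
  have c2 : conjCount (uniSet F) s = 0 := by
    by_contra h
    obtain ⟨a, ha⟩ := (of_conjCount_uniSet_ne_zero h).2.1
    exact h3 a ha
  have c3 : conjCount (torSet F) s = 0 := by
    by_contra h
    obtain ⟨a, ha, -⟩ := (of_conjCount_torSet_ne_zero h).2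
    exact h3 a ha
  have hw := (weight_eq_one_and_card hT).1 s
  have hq := one_lt_card (F := F)
  rw [weight, c1, c2, c3, Nat.cast_zero, zero_div, zero_div, zero_div, zero_add, zero_add,
    zero_add, div_eq_one_iff_eq (by linarith)] at hw
  have : (conjCount (nsSet T) s : ℝ) ≤ Fintype.card F + 1 := by exact_mod_cast hle
  linarith

/-- Summation of an even class function over `SL₂`. -/
lemma sum_classFunction (hT : IsNonsplitTorus T) [Fintype T] (f : SL(2, F) → ℂ)
    (hneg : ∀ g, f (-g) = f g) (hf : ∀ g x, f (x * g * x⁻¹) = f g) :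
    ∑ g, f g = (signSet F).card * f 1
      + (Fintype.card F + 1) * ((signSet F).card * ∑ x ∈ Finset.univ.erase (0 : F), f (uni x))
      + Fintype.card F * (Fintype.card F + 1) / 2 *
        (∑ a, f (diag a) - (signSet F).card * f 1)
      + Fintype.card F * (Fintype.card F - 1) / 2 *
        (∑ t : T, f t - (signSet F).card * f 1) := by
  have hcard : (Fintype.card SL(2, F) : ℂ) = Fintype.card F * (Fintype.card F ^ 2 - 1) := by
    exact_mod_cast congrArg (Complex.ofReal) (weight_eq_one_and_card hT).2
  have hq : (1 : ℝ) < Fintype.card F := one_lt_card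
  have hq0 : (Fintype.card F : ℂ) ≠ 0 := by simp
  have hq1 : (Fintype.card F : ℂ) - 1 ≠ 0 := by
    have : (Fintype.card F : ℝ) - 1 ≠ 0 := by linarith
    exact_mod_cast this
  have hq2 : (Fintype.card F : ℂ) + 1 ≠ 0 := by
    exact_mod_cast (Fintype.card F).succ_ne_zero
  have hG : (Fintype.card SL(2, F) : ℂ) ≠ 0 := by simp
  have hw : ∀ g, (conjCount (signSet F) g : ℂ) / Fintype.card SL(2, F)
    + conjCount (uniSet F) g / (Fintype.card F * (Fintype.card F - 1))
    + conjCount (torSet F) g / (2 * (Fintype.card F - 1))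
    + conjCount (nsSet T) g / (2 * (Fintype.card F + 1)) = 1 := by
    intro g
    have := congrArg Complex.ofReal ((weight_eq_one_and_card hT).1 g)
    unfold weight at this
    push_cast at this
    exact this
  calc ∑ g, f g = ∑ g, (f g * conjCount (signSet F) g / Fintype.card SL(2, F)
    + f g * conjCount (uniSet F) g / (Fintype.card F * (Fintype.card F - 1))
    + f g * conjCount (torSet F) g / (2 * (Fintype.card F - 1))
    + f g * conjCount (nsSet T) g / (2 * (Fintype.card F + 1))) := by
        refine Finset.sum_congr rfl fun g _ => ?_
        conv_lhs => rw [← mul_one (f g), ← hw g]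
        ring
    _ = _ := by
        simp only [Finset.sum_add_distrib, ← Finset.sum_div, sum_mul_conjCount _ f hf,
          sum_signSet f hneg, sum_uniSet f hneg, sum_torSet f hneg, sum_nsSet f hneg hT]
        rw [mul_div_assoc, hcard]
        have h4 : (Fintype.card F : ℂ) ^ 2 - 1 = (Fintype.card F - 1) * (Fintype.card F + 1) := by
          ring
        rw [h4]
        field_simp

end Weight

lemma signSet_card_cases :
    ((signSet F).card = 2 ∧ (1 : SL(2, F)) ≠ -1) ∨
      ((signSet F).card = 1 ∧ (1 : SL(2, F)) = -1 ∧ ringChar F = 2) := by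
  classical
  have h : signSet F = {1, -1} := by
    ext g
    simp [mem_signSet, IsSign]
  by_cases h1 : (1 : SL(2, F)) = -1
  · right
    refine ⟨by rw [h, ← h1]; simp, h1, ?_⟩
    by_contra h2
    apply Ring.neg_one_ne_one_of_char_ne_two h2
    have : (1 : SL(2, F)) 0 0 = (-1 : SL(2, F)) 0 0 := by rw [← h1]
    exact this.symm
  · left
    exact ⟨by rw [h, Finset.card_pair h1], h1⟩

/-- There is a representative `ν` of the nonsquares, to be read as `1` in characteristic two. -/
lemma exists_nonsquare_representative (F : Type*) [Field F] [Fintype F] :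
    ∃ ν : F, ν ≠ 0 ∧ (ringChar F = 2 → ν = 1) ∧ ∀ x ≠ 0, ∃ b ≠ 0, x = b ^ 2 ∨ x = b ^ 2 * ν := by
  classical
  by_cases h2 : ringChar F = 2
  · refine ⟨1, one_ne_zero, fun _ => rfl, fun x hx => ?_⟩
    obtain ⟨b, rfl⟩ := FiniteField.isSquare_of_char_two h2 x
    exact ⟨b, by simpa using hx, by simp [pow_two]⟩
  · obtain ⟨ν, hν⟩ := FiniteField.exists_nonsquare h2
    have hν0 : ν ≠ 0 := by
      rintro rfl
      exact hν (.zero)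
    refine ⟨ν, hν0, fun h => absurd h h2, fun x hx => ?_⟩
    by_cases hs : IsSquare x
    · obtain ⟨b, rfl⟩ := hs
      exact ⟨b, by simpa using hx, by simp [pow_two]⟩
    · have h1 : IsSquare (x * ν) := by
        rw [← quadraticChar_one_iff_isSquare (mul_ne_zero hx hν0), map_mul,
          quadraticChar_neg_one_iff_not_isSquare.mpr hs,
          quadraticChar_neg_one_iff_not_isSquare.mpr hν]
        norm_num
      obtain ⟨b, hb⟩ := h1
      have hb0 : b ≠ 0 := by
        rintro rfl
        simp [hx, hν0] at hb
      refine ⟨b / ν, div_ne_zero hb0 hν0, Or.inr ?_⟩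
      field_simp
      linear_combination hb

lemma two_mul_sum_of_sq_invariant {ν : F} (hν0 : ν ≠ 0)
    (hν : ∀ x ≠ 0, ∃ b ≠ 0, x = b ^ 2 ∨ x = b ^ 2 * ν) (h : F → ℂ)
    (hh : ∀ b x, b ≠ 0 → h (b ^ 2 * x) = h x) :
    2 * ∑ x ∈ Finset.univ.erase 0, h x = (Fintype.card F - 1) * (h 1 + h ν) := by
  have h1 : ∑ x ∈ Finset.univ.erase 0, h x = ∑ x ∈ Finset.univ.erase 0, h (ν * x) := by
    symm
    refine Finset.sum_bij' (fun x _ => ν * x) (fun x _ => ν⁻¹ * x) ?_ ?_ ?_ ?_ ?_ <;>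
      simp [hν0]
  have h2 : ∀ x ∈ Finset.univ.erase (0 : F), h x + h (ν * x) = h 1 + h ν := by
    intro x hx
    obtain ⟨b, hb, rfl | rfl⟩ := hν x (by simpa using hx)
    · have e1 := hh b 1 hb
      have e2 := hh b ν hb
      rw [mul_one] at e1
      rw [mul_comm ν, e1, e2]
    · have e1 := hh b ν hb
      have e2 := hh (b * ν) 1 (mul_ne_zero hb hν0)
      rw [e1, show ν * (b ^ 2 * ν) = (b * ν) ^ 2 * 1 by ring, e2, add_comm]
  rw [two_mul]
  nth_rewrite 2 [h1]
  rw [← Finset.sum_add_distrib, Finset.sum_congr rfl h2, Finset.sum_const,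
    Finset.card_erase_of_mem (Finset.mem_univ _), Finset.card_univ, nsmul_eq_mul,
    Nat.cast_sub Fintype.card_pos, Nat.cast_one]

/-- The restriction of a character to the unipotent subgroup. -/
lemma exists_uni_data (V : FDRep ℂ SL(2, F)) : ∃ m A B : ℕ,
    ((signSet F).card = 1 → A = B) ∧
    V.character 1 = m + (A + B) * (Fintype.card F - 1) / 2 ∧
    ∑ x : F, V.character (uni x) = Fintype.card F * m ∧
    ∑ x : F, V.character (uni x) * V.character (uni x)⁻¹ =
      Fintype.card F * (m ^ 2 + (A ^ 2 + B ^ 2) * (Fintype.card F - 1) / 2 : ℂ) ∧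
    (A = B → ∀ x ≠ 0, V.character (uni x) = m - A) ∧
    ∀ x ≠ 0, V.character (uni x) = V.character (uni 1) ∨
      V.character (uni x) = 2 * m - (A + B) - V.character (uni 1) := by
  obtain ⟨ν, hν0, hν1, hν⟩ := exists_nonsquare_representative F
  have hinv : ∀ b x : F, b ≠ 0 →
      V.character (uni (b ^ 2 * x)) = V.character (uni x) := by
    intro b x hb
    have := diag_mul_uni_mul_inv (Units.mk0 b hb) x
    rw [Units.val_mk0] at this
    rw [← this, FDRep.char_conj]
  obtain ⟨ψ, hψ1⟩ : ∃ ψ : AddChar F ℂ, ψ ≠ 1 := by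
    have : Nontrivial (AddChar F ℂ) := by
      rw [← Fintype.one_lt_card_iff_nontrivial, AddChar.card_eq]
      exact Fintype.one_lt_card
    exact exists_ne 1
  have hψ : ψ.IsPrimitive := .of_ne_one hψ1
  have hc : ∀ θ : AddChar F ℂ, ∃ n : ℕ, (n : ℂ) * Fintype.card F =
      ∑ x, V.character (uni x) * θ (-x) := by
    intro θ
    obtain ⟨n, hn⟩ := exists_sum_mul_character_eq V uniHom (θ⁻¹).toMonoidHom
    rw [Fintype.card_multiplicative] at hn
    exact ⟨n, hn.trans (Fintype.sum_equiv Multiplicative.toAdd _ _ fun _ => rfl)⟩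
  choose c hc using hc
  let k : F → ℕ := fun x => c (ψ.mulShift x)
  have hk : ∀ x, (k x : ℂ) * Fintype.card F = ∑ y, V.character (uni y) * ψ (-(x * y)) := by
    intro x
    simp only [k, hc, AddChar.mulShift_apply, mul_neg]
  have hq0 : (Fintype.card F : ℂ) ≠ 0 := by simp
  have hkinv : ∀ b x, b ≠ 0 → (k (b ^ 2 * x) : ℂ) = k x := by
    intro b x hb
    apply mul_right_cancel₀ hq0
    rw [hk, hk]
    apply Fintype.sum_equiv (Equiv.mulLeft₀ (b ^ 2) (pow_ne_zero 2 hb))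
    intro y
    simp only [Equiv.mulLeft₀_apply, hinv b y hb]
    congr 3
    ring
  have hbij : Function.Bijective fun x : F => ψ.mulShift x := by
    rw [Fintype.bijective_iff_injective_and_card]
    exact ⟨AddChar.to_mulShift_inj_of_isPrimitive hψ, AddChar.card_eq.symm⟩
  have hsum : ∀ f : F → ℂ, ∑ x, f x = f 0 + ∑ x ∈ Finset.univ.erase 0, f x := fun f =>
    (Finset.add_sum_erase _ f (Finset.mem_univ 0)).symm
  have hexp : ∀ y, V.character (uni y) = ∑ x, (k x : ℂ) * ψ (x * y) := by
    intro y
    rw [eq_sum_fourierCoeff (fun x => V.character (uni x)) (fun θ => c θ) hc y]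
    exact (Fintype.sum_bijective _ hbij _ _ fun x => rfl).symm
  have hsum0 : ∑ x : F, V.character (uni x) = Fintype.card F * k 0 := by
    rw [mul_comm, hk]
    simp
  have hone : V.character 1 = k 0 + (k 1 + k ν) * (Fintype.card F - 1) / 2 := by
    have h1 := hexp 0
    have h2 := two_mul_sum_of_sq_invariant hν0 hν (fun x => (k x : ℂ)) hkinv
    simp only [mul_zero, AddChar.map_zero_eq_one, mul_one, uni_zero] at h1
    rw [h1, hsum]
    linear_combination h2 / 2
  refine ⟨k 0, k 1, k ν, ?_, hone, hsum0, ?_, ?_, ?_⟩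
  · intro h
    rcases signSet_card_cases (F := F) with h1 | h1
    · omega
    · rw [hν1 h1.2.2]
  · have h1 := sum_mul_neg_eq_sum_fourierCoeff_sq (fun x => V.character (uni x)) (fun θ => c θ) hc
    have h2 := two_mul_sum_of_sq_invariant hν0 hν (fun x => (k x : ℂ) ^ 2)
      (fun b x hb => by simp only [hkinv b x hb])
    have h3 : ∑ θ, (c θ : ℂ) ^ 2 = ∑ x, (k x : ℂ) ^ 2 :=
      (Fintype.sum_bijective _ hbij _ _ fun x => rfl).symm
    simp only [uni_inv]
    rw [h1, h3, hsum]
    linear_combination (Fintype.card F / 2 : ℂ) * h2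
  · intro hAB x hx
    have hkc : ∀ y ∈ Finset.univ.erase (0 : F), (k y : ℂ) * ψ (y * x) = k 1 * ψ (y * x) := by
      intro y hy
      obtain ⟨b, hb, rfl | rfl⟩ := hν y (by simpa using hy)
      · have := hkinv b 1 hb
        rw [mul_one] at this
        rw [this]
      · rw [hkinv b ν hb, hAB]
    have h0 := AddChar.sum_mulShift x hψ
    rw [if_neg hx, hsum] at h0
    rw [hexp, hsum, Finset.sum_congr rfl hkc, ← Finset.mul_sum]
    simp only [zero_mul, AddChar.map_zero_eq_one, Nat.cast_zero] at h0 ⊢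
    linear_combination (k 1 : ℂ) * h0
  · have h1 := two_mul_sum_of_sq_invariant hν0 hν (fun x => V.character (uni x)) hinv
    have hs := hsum fun x => V.character (uni x)
    rw [hsum0, uni_zero, hone] at hs
    have hq1 : (Fintype.card F : ℂ) - 1 ≠ 0 := by
      have : (Fintype.card F : ℂ) ≠ 1 := by exact_mod_cast (Fintype.one_lt_card (α := F)).ne'
      exact sub_ne_zero.mpr this
    have h2 : V.character (uni 1) + V.character (uni ν) = 2 * k 0 - (k 1 + k ν) := by
      apply mul_left_cancel₀ hq1
      linear_combination -h1 - 2 * hs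
    intro x hx
    obtain ⟨b, hb, rfl | rfl⟩ := hν x hx
    · left
      have := hinv b 1 hb
      rwa [mul_one] at this
    · right
      rw [hinv b ν hb]
      linear_combination h2

section Torus

variable {f : SL(2, F) → ℂ} {ε : ℂ}

/-- Rescaling an even product on `±1` changes its sum over the split torus only there. -/
lemma sum_diag_signTwist (hf1 : f 1 ≠ 0) (hε : ∀ g, f (-g) = ε * f g) (hε2 : ε ^ 2 = 1) (r : ℂ) :
    ∑ a : Fˣ, f (diag a) * f (diag a)⁻¹ - (signSet F).card * f 1 ^ 2 =
      ∑ a : Fˣ, signTwist f r (diag a) * signTwist f r (diag a)⁻¹ - (signSet F).card * r ^ 2 := by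
  have h1 := sum_torSet (fun g => f g * f g⁻¹) fun g => by
    simp only [inv_neg, hε]
    linear_combination (f g * f g⁻¹) * hε2
  have h2 := sum_torSet (fun g => signTwist f r g * signTwist f r g⁻¹)
    (signTwist_neg_mul_inv hε hε2 r)
  simp only [inv_one, signTwist_one hf1, ← pow_two] at h1 h2
  rw [← h1, ← h2]
  refine Finset.sum_congr rfl fun g hg => ?_
  have hs : ¬ IsSign g := fun hs => (mem_torSet.mp hg).2.2 ((isSign_iff g).mp hs).2.2
  rw [signTwist_of_not_isSign hs, signTwist_of_not_isSign ((isSign_inv_iff g).not.mpr hs)]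

/-- Rescaling an even product on `±1` changes its sum over the nonsplit torus only there. -/
lemma sum_nonsplit_signTwist {T : Subgroup SL(2, F)} (hT : IsNonsplitTorus T) [Fintype T]
    (hf1 : f 1 ≠ 0) (hε : ∀ g, f (-g) = ε * f g) (hε2 : ε ^ 2 = 1) (r : ℂ) :
    ∑ t : T, f t * f (t : SL(2, F))⁻¹ - (signSet F).card * f 1 ^ 2 =
      ∑ t : T, signTwist f r t * signTwist f r (t : SL(2, F))⁻¹ - (signSet F).card * r ^ 2 := by
  have h1 := sum_nsSet (fun g => f g * f g⁻¹) (fun g => by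
    simp only [inv_neg, hε]
    linear_combination (f g * f g⁻¹) * hε2) hT
  have h2 := sum_nsSet (fun g => signTwist f r g * signTwist f r g⁻¹)
    (signTwist_neg_mul_inv hε hε2 r) hT
  simp only [inv_one, signTwist_one hf1, ← pow_two] at h1 h2
  rw [← h1, ← h2]
  refine Finset.sum_congr rfl fun g hg => ?_
  have hs : ¬ IsSign g := (mem_nsSet.mp hg).2
  rw [signTwist_of_not_isSign hs, signTwist_of_not_isSign ((isSign_inv_iff g).not.mpr hs)]

end Torus

section Coefficients

variable (V : FDRep ℂ SL(2, F)) {ε : ℂ}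

/-- Integrality of the Fourier coefficients on the split torus. -/
lemma exists_split_coeff (hV1 : V.character 1 ≠ 0)
    (hε : ∀ g, V.character (-g) = ε * V.character g) {m : ℂ}
    (hm : ∑ x : F, V.character (uni x) = Fintype.card F * m) :
    ∃ n : AddChar (Additive Fˣ) ℂ → ℤ, ∀ θ, (n θ : ℂ) * Fintype.card (Additive Fˣ) =
      ∑ a : Additive Fˣ, signTwist V.character m (diag a.toMul) * θ (-a) := by
  classical
  have hinner : ∀ a : Fˣ, ∑ x, V.character (diag a * uni x) =
      Fintype.card F * signTwist V.character m (diag a) := by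
    intro a
    by_cases h : IsSign (diag a)
    · rw [signTwist_of_isSign h]
      rcases h with h | h <;> rw [h]
      · simp only [one_mul, hm, div_self hV1]
      · simp only [neg_one_mul, hε, ← Finset.mul_sum, hm, mul_div_assoc, div_self hV1]
        ring
    · rw [signTwist_of_not_isSign h, Finset.sum_congr rfl (g := fun _ => V.character (diag a)),
        Finset.sum_const, Finset.card_univ, nsmul_eq_mul]
      intro x _
      obtain ⟨g, hg⟩ := exists_conj_diag_mul_uni h x
      rw [← hg, FDRep.char_conj]
  have : ∀ θ : AddChar (Additive Fˣ) ℂ, ∃ n : ℕ, (n : ℂ) * Fintype.card (Additive Fˣ) =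
      ∑ a : Additive Fˣ, signTwist V.character m (diag a.toMul) * θ (-a) := by
    intro θ
    obtain ⟨n, hn⟩ := exists_sum_mul_character_eq V (borel F).subtype
      { toFun := fun g => θ (-Additive.ofMul (borelHom F g))
        map_one' := by simp
        map_mul' := fun g h => by
          rw [map_mul, ofMul_mul, neg_add, AddChar.map_add_eq_mul] }
    refine ⟨n, ?_⟩
    rw [← Fintype.card_of_bijective bijective_diag_mul_uni,
      ← Fintype.sum_bijective _ bijective_diag_mul_uni _ _ (fun _ => rfl),
      Fintype.sum_prod_type, Fintype.card_prod] at hn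
    have hval : ∀ (a : Fˣ) (x : F),
        borelHom F ⟨diag a * uni x, diag_mul_uni_mem_borel a x⟩ = a := by
      intro a x
      apply Units.ext
      change (diag a * uni x) 0 0 = a
      simp [mul_entry, diag_entries, uni_entries]
    simp only [Subgroup.subtype_apply, MonoidHom.coe_mk, OneHom.coe_mk, hval, ← Finset.sum_mul,
      hinner] at hn
    have hq0 : (Fintype.card F : ℂ) ≠ 0 := by simp
    apply mul_left_cancel₀ hq0
    rw [Fintype.card_additive, Finset.mul_sum]
    push_cast at hn
    rw [← mul_assoc, mul_comm (Fintype.card F : ℂ), mul_assoc, mul_comm (Fintype.card F : ℂ), hn]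
    exact Fintype.sum_equiv Additive.ofMul _ _ fun a => mul_assoc _ _ _
  choose n hn using this
  exact ⟨fun θ => n θ, fun θ => by rw [← hn θ, Int.cast_natCast]⟩

/-- Integrality of the Fourier coefficients on the nonsplit torus. -/
lemma exists_nonsplit_coeff {T : Subgroup SL(2, F)} (hT : IsNonsplitTorus T) [Fintype T]
    (hV1 : V.character 1 ≠ 0) (hε : ∀ g, V.character (-g) = ε * V.character g) (hε2 : ε ^ 2 = 1)
    {m A B : ℕ} (hAB : (signSet F).card = 1 → A = B)
    (hdim : V.character 1 = m + (A + B) * (Fintype.card F - 1) / 2) :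
    ∃ d : AddChar (Additive T) ℂ → ℤ, ∀ θ, (d θ : ℂ) * Fintype.card (Additive T) =
      ∑ t : Additive T, -signTwist V.character (m - (A + B)) t.toMul.1 * θ (-t) := by
  classical
  have hcard : (Fintype.card T : ℂ) = Fintype.card F + 1 := by
    rw [← Nat.card_eq_fintype_card, hT.card_eq]
    push_cast
    rfl
  suffices ∀ θ : AddChar (Additive T) ℂ, ∃ n : ℤ, (n : ℂ) * Fintype.card (Additive T) =
      ∑ t : Additive T, -signTwist V.character (m - (A + B)) t.toMul.1 * θ (-t) by
    choose d hd using this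
    exact ⟨d, hd⟩
  intro θ
  obtain ⟨n, hn⟩ := exists_sum_mul_character_eq V T.subtype
    { toFun := fun t => θ (-Additive.ofMul t)
      map_one' := by simp
      map_mul' := fun g h => by rw [ofMul_mul, neg_add_rev, AddChar.map_add_eq_mul, mul_comm] }
  simp only [Subgroup.subtype_apply, MonoidHom.coe_mk, OneHom.coe_mk] at hn
  let s : T → ℂ := fun t => if IsSign t.1 then
    V.character t / V.character 1 * θ (-Additive.ofMul t) else 0
  have hdiff : ∑ t : Additive T, -signTwist V.character (m - (A + B)) t.toMul.1 * θ (-t) =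
      -(n * Fintype.card T) + (A + B) / 2 * Fintype.card T * ∑ t, s t := by
    rw [hn, Finset.mul_sum, ← Finset.sum_neg_distrib, ← Finset.sum_add_distrib]
    refine Fintype.sum_equiv Additive.toMul _ _ fun t => ?_
    simp only [s, ofMul_toMul]
    by_cases h : IsSign t.toMul.1
    · rw [signTwist_of_isSign h, if_pos h]
      have e : V.character t.toMul.1 = V.character t.toMul.1 / V.character 1 * V.character 1 :=
        (div_mul_cancel₀ _ hV1).symm
      rw [hcard]
      linear_combination θ (-t) * e + V.character t.toMul.1 / V.character 1 * θ (-t) * hdim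
    · rw [signTwist_of_not_isSign h, if_neg h]
      ring
  have hs1 : s 1 = 1 := by
    simp only [s, OneMemClass.coe_one, if_pos (show IsSign (1 : SL(2, F)) from Or.inl rfl),
      div_self hV1, ofMul_one, neg_zero, AddChar.map_zero_eq_one, mul_one]
  let z : T := ⟨-1, hT.neg_one_mem⟩
  have hz : z * z = 1 := Subtype.ext (by simp [z])
  rw [hdiff, Fintype.card_additive]
  rcases signSet_card_cases (F := F) with ⟨-, h1⟩ | ⟨h, h1, -⟩
  · have hne : (1 : T) ≠ z := fun h => h1 (congrArg Subtype.val h)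
    have hsum : ∑ t, s t = s 1 + s z := by
      refine Fintype.sum_eq_add _ _ hne fun t ht => if_neg ?_
      rintro (h | h)
      · exact ht.1 (Subtype.ext h)
      · exact ht.2 (Subtype.ext h)
    have hsz : s z = ε * θ (-Additive.ofMul z) := by
      simp only [s, z, if_pos (show IsSign (-1 : SL(2, F)) from Or.inr rfl), hε, mul_div_assoc,
        div_self hV1, mul_one]
    have hsz2 : s z * s z = 1 := by
      have : θ (-Additive.ofMul z) * θ (-Additive.ofMul z) = 1 := by
        rw [← AddChar.map_add_eq_mul, ← neg_add_rev, ← ofMul_mul, hz]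
        simp
      rw [hsz]
      linear_combination ε ^ 2 * this + hε2
    rw [hsum, hs1]
    rcases mul_self_eq_one_iff.mp hsz2 with h2 | h2 <;> rw [h2]
    · exact ⟨-n + (A + B), by push_cast; ring⟩
    · exact ⟨-n, by push_cast; ring⟩
  · have hsum : ∑ t, s t = s 1 := by
      refine Fintype.sum_eq_single _ fun t ht => if_neg ?_
      rintro (h | h)
      · exact ht (Subtype.ext h)
      · exact ht (Subtype.ext (h.trans h1.symm))
    rw [hsum, hs1, ← hAB h]
    exact ⟨-n + A, by push_cast; ring⟩

end Coefficients

section Values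

variable (V : FDRep ℂ SL(2, F))

/-- The first orthogonality relation for an irreducible character of `SL(2, F)`. -/
lemma sum_character_mul_inv [Simple V] {T : Subgroup SL(2, F)} (hT : IsNonsplitTorus T) :
    ∑ g, V.character g * V.character g⁻¹ =
      (Fintype.card F * (Fintype.card F ^ 2 - 1) : ℂ) := by
  have hc : (Nat.card SL(2, F) : ℂ) ≠ 0 := by simp
  let : Invertible (Nat.card SL(2, F) : ℂ) := invertibleOfNonzero hc
  have h := FDRep.char_orthonormal V V
  rw [if_pos ⟨Iso.refl V⟩, inv_mul_eq_one₀ hc] at h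
  rw [← h, Nat.card_eq_fintype_card]
  exact_mod_cast congrArg (fun r : ℝ => (r : ℂ)) (weight_eq_one_and_card hT).2

/-- The field of values of an irreducible character of `SL(2, F)` is generated by one value. -/
theorem exists_value_generating [Simple V] :
    ∃ g₀, ∀ K : Subfield ℂ, V.character g₀ ∈ K → ∀ g, V.character g ∈ K := by
  classical
  obtain ⟨T, hT⟩ := exists_isNonsplitTorus (F := F)
  have hcyc := hT.isCyclic
  have hconj : ∀ g x, V.character (x * g * x⁻¹) = V.character g := fun g x => V.char_conj g x
  obtain ⟨ε, hε2, hε⟩ := exists_character_mul_central V (-1) (by simp) (by simp)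
  simp only [neg_one_mul] at hε
  obtain ⟨m, A, B, hAB, hdim, hm, hU, hrat, huni⟩ := exists_uni_data V
  have hq := one_lt_card (F := F)
  have hG := sum_character_mul_inv V hT
  have hq0 : (Fintype.card F : ℂ) ≠ 0 := by simp
  have hq1 : (Fintype.card F : ℂ) - 1 ≠ 0 := sub_ne_zero.mpr (by exact_mod_cast hq.ne')
  have hq2 : (Fintype.card F : ℂ) + 1 ≠ 0 := by
    exact_mod_cast Nat.succ_ne_zero (Fintype.card F)
  have hV1 : V.character 1 ≠ 0 := by
    intro h0
    rw [FDRep.char_one, Nat.cast_eq_zero, Module.finrank_zero_iff] at h0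
    have hzero : ∀ g, V.character g = 0 := fun g => by
      rw [FDRep.character, Subsingleton.elim (V.ρ g) 0, map_zero]
    simp only [hzero, mul_zero, Finset.sum_const_zero] at hG
    refine mul_ne_zero hq0 (mul_ne_zero hq1 hq2) ?_
    linear_combination -hG
  obtain ⟨N, hN0, hN, hN1, hN2⟩ := exists_norm_of_even_of_integral
    (fun a : Fˣ => signTwist V.character m (diag a))
    (fun a => by
      rw [← diag_inv]
      exact signTwist_inv hconj _ fun _ => ⟨weyl, weyl_mul_diag_mul_inv a⟩)
    (exists_split_coeff V hV1 hε hm)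
  obtain ⟨D, hD0, hD, hD1, hD2⟩ := exists_norm_of_even_of_integral
    (fun t : T => -signTwist V.character (m - (A + B)) t)
    (fun t => by
      rw [Subgroup.coe_inv, signTwist_inv hconj]
      exact fun h => exists_conj_eq_inv hT (mem_nsSet.mpr ⟨t.2, h⟩))
    (exists_nonsplit_coeff V hT hV1 hε hε2 hAB hdim)
  have hTcard : (Fintype.card T : ℂ) = Fintype.card F + 1 := by
    rw [← Nat.card_eq_fintype_card, hT.card_eq]
    push_cast
    rfl
  have hFcard : (Fintype.card Fˣ : ℂ) = Fintype.card F - 1 := by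
    rw [Fintype.card_units, Nat.cast_sub Fintype.card_pos, Nat.cast_one]
  have key : ((signSet F).card : ℤ) * ((A : ℤ) - B) ^ 2 + 2 * N + 2 * D = 4 := by
    have h1 := sum_classFunction hT (fun g => V.character g * V.character g⁻¹)
      (fun g => by
        simp only [inv_neg, hε]
        linear_combination (V.character g * V.character g⁻¹) * hε2)
      (fun g x => by simp only [conj_inv, hconj])
    have h2 := sum_diag_signTwist hV1 hε hε2 m
    have h3 := sum_nonsplit_signTwist hT hV1 hε hε2 (m - (A + B))
    simp only [diag_inv] at h2
    simp only [Subgroup.coe_inv, neg_mul_neg] at hD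
    rw [hN, hFcard] at h2
    rw [hD, hTcard] at h3
    have h4 := Finset.sum_erase_eq_sub
      (f := fun x : F => V.character (uni x) * V.character (uni x)⁻¹) (Finset.mem_univ 0)
    simp only [uni_zero, inv_one] at h4
    rw [h4, hU, hG] at h1
    simp only [diag_inv, inv_one, ← pow_two] at h1
    rw [h2, h3, hdim] at h1
    have h5 : (((signSet F).card : ℂ) * ((A : ℂ) - B) ^ 2 + 2 * N + 2 * D - 4) *
        (Fintype.card F * (Fintype.card F - 1) * (Fintype.card F + 1)) = 0 := by
      linear_combination -4 * h1
    have h6 := (mul_eq_zero.mp h5).resolve_right (mul_ne_zero (mul_ne_zero hq0 hq1) hq2)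
    have h7 := sub_eq_zero.mp h6
    exact_mod_cast h7
  have hmK : ∀ K : Subfield ℂ, (m : ℂ) ∈ K := fun K => natCast_mem K m
  have hsK : ∀ K : Subfield ℂ, (m - (A + B) : ℂ) ∈ K := fun K =>
    K.sub_mem (hmK K) (K.add_mem (natCast_mem K A) (natCast_mem K B))
  have h1K : ∀ K : Subfield ℂ, V.character 1 ∈ K := fun K => by
    rw [FDRep.char_one]
    exact natCast_mem K _
  have hεK : ∀ K : Subfield ℂ, ε ∈ K := fun K => by
    rcases mul_self_eq_one_iff.mp (pow_two ε ▸ hε2) with rfl | rfl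
    · exact K.one_mem
    · exact K.neg_mem K.one_mem
  have hsplit : ∀ (K : Subfield ℂ) (a : Fˣ), signTwist V.character m (diag a) ∈ K ↔
      V.character (diag a) ∈ K := fun K a =>
    signTwist_mem_iff hV1 hε hε2 (hmK K) (h1K K) _
  have hnonsplit : ∀ (K : Subfield ℂ) (t : T), -signTwist V.character (m - (A + B)) t ∈ K ↔
      V.character t ∈ K := fun K t => by
    rw [neg_mem_iff]
    exact signTwist_mem_iff hV1 hε hε2 (hsK K) (h1K K) _
  simp only [hsplit] at hN1 hN2
  simp only [hnonsplit] at hD1 hD2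
  have hall : ∀ K : Subfield ℂ, (∀ x ≠ 0, V.character (uni x) ∈ K) →
      (∀ a, V.character (diag a) ∈ K) → (∀ t : T, V.character t ∈ K) →
      ∀ g, V.character g ∈ K := by
    intro K hu ha ht g
    obtain ⟨x, s, hs, rfl⟩ := exists_conj_mem hT g
    rw [hconj]
    rcases hs with h | h | h | h
    · rcases mem_signSet.mp h with rfl | rfl
      · exact h1K K
      · rw [hε]
        exact K.mul_mem (hεK K) (h1K K)
    · obtain ⟨h10, h01, hne⟩ := mem_uniSet.mp h
      have hd := det_entries s
      rw [h10, mul_zero, sub_zero, ← h01] at hd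
      rcases mul_self_eq_one_iff.mp hd with h00 | h00
      · have : s = uni (s 0 1) := by
          apply ext_entries <;> simp [uni_entries, h10, ← h01, h00]
        rw [this]
        exact hu _ hne
      · have : s = -uni (-s 0 1) := by
          apply ext_entries <;> simp [uni_entries, neg_entry, h10, ← h01, h00]
        rw [this, hε]
        exact K.mul_mem (hεK K) (hu _ (neg_ne_zero.mpr hne))
    · obtain ⟨h01, h10, -⟩ := mem_torSet.mp h
      have hd := det_entries s
      rw [h10, mul_zero, sub_zero] at hd
      have : s = diag ⟨s 0 0, s 1 1, hd, by rw [mul_comm, hd]⟩ := by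
        apply ext_entries <;> simp [diag_entries, h10, h01]
      rw [this]
      exact ha _
    · exact ht ⟨s, (mem_nsSet.mp h).1⟩
  by_cases hne : A = B
  · have hu : ∀ K : Subfield ℂ, ∀ x ≠ 0, V.character (uni x) ∈ K := fun K x hx => by
      rw [hrat hne x hx]
      exact K.sub_mem (hmK K) (natCast_mem K A)
    by_cases h : N ≤ 1
    · obtain ⟨t₀, h₀⟩ := hD2 (by nlinarith)
      exact ⟨t₀, fun K hK => hall K (hu K) (hN1 h K) (h₀ K hK)⟩
    · have : D ≤ 1 := by
        simp only [hne, sub_self] at key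
        omega
      obtain ⟨a₀, h₀⟩ := hN2 (by nlinarith)
      exact ⟨diag a₀, fun K hK => hall K (hu K) (h₀ K hK) (hD1 this K)⟩
  · have he : (signSet F).card = 2 := by
      rcases signSet_card_cases (F := F) with ⟨h, -⟩ | ⟨h, -⟩
      · exact h
      · exact absurd (hAB h) hne
    have hsq : 1 ≤ ((A : ℤ) - B) ^ 2 := by
      have : (A : ℤ) - B ≠ 0 := sub_ne_zero.mpr (by exact_mod_cast hne)
      have := sq_pos_of_ne_zero this
      omega
    rw [he] at key
    refine ⟨uni 1, fun K hK => hall K (fun x hx => ?_) (hN1 (by omega) K) (hD1 (by omega) K)⟩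
    rcases huni x hx with h | h <;> rw [h]
    · exact hK
    · refine K.sub_mem ?_ hK
      exact_mod_cast K.sub_mem (natCast_mem K (2 * m)) (natCast_mem K (A + B))

end Values

end Finite
end SL2

/-- For `G = SL₂(F_q)` with `q` a prime power and `χ` an irreducible complex character of `G`,
there exists `g ∈ G` with `c(χ) = c(χ(g))`. -/
theorem conductor_one_value_SL2 (q : ℕ) (hq : IsPrimePow q)
    (F : Type) [Field F] [Fintype F] (hF : Fintype.card F = q)
    (V : FDRep ℂ (Matrix.SpecialLinearGroup (Fin 2) F)) (hV : Simple V) :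
    ∃ g : Matrix.SpecialLinearGroup (Fin 2) F,
      conductorOf (Set.range V.character) = conductorOf {V.character g} := by
  classical
  obtain ⟨g₀, h₀⟩ := SL2.exists_value_generating V
  refine ⟨g₀, congrArg sInf (Set.ext fun n => and_congr_right fun _ => ?_)⟩
  rw [Set.singleton_subset_iff, Set.range_subset_iff]
  exact ⟨fun h => h g₀, h₀ (cycField n)⟩
end
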